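/- arXiv:math/0505570 — 5 statements merged into one kernel-verified Lean document; each statement's English description precedes it below -/
import Mathlib

section
/- Let $V$ be a finite-dimensional vector space over a field $k$ of characteristic zero, with $\dim V = v$. For integers $a, p, r \geq 0$ with $v \geq a + p + r$, the linear map $T_a : \mathrm{Hom}_k(\wedge^p V, \wedge^r V) \to \mathrm{Hom}_k(\wedge^{a+p} V, \wedge^{a+r} V)$ defined by $T_a(\phi)(v_I) = \sum_{I = A \cup P} (-1)^{\mathrm{sgn}(A,P)} v_A \wedge \phi(v_P)$ (summing over partitions of $I$ into $A$ and $P$ with $|P| = p$, where the sign is that of the permutation obtained by concatenating $P$ with $A$) is injective. -/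
namespace PBW0

variable (k V : Type) [Field k] [CharZero k] [AddCommGroup V] [Module k V]

/-- Evaluation of `T_a(φ)` on the wedge `v_I = v_0 ∧ ⋯ ∧ v_{a+p-1}`:
`T_a(φ)(v_I) = ∑_{I = A ∪ P} ± v_A ∧ φ(v_P)`, summing over all partitions of `I` into a
subset `P` of cardinality `p` (on which `φ` is applied) and its complement `A`, with the sign
of the permutation obtained by concatenating `P` with `A`.  Here `φ` is a linear map
`∧^p V → ∧^r V`, encoded as an alternating map with values in the exterior algebra. -/
noncomputable def TaEval (a p : ℕ)
    (φ : AlternatingMap k V (ExteriorAlgebra k V) (Fin p)) (v : Fin (a + p) → V) :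
    ExteriorAlgebra k V :=
  ∑ P ∈ (Finset.powersetCard p (Finset.univ : Finset (Fin (a + p)))).attach,
    ((-1 : k) ^ (∑ i ∈ P.1, (i : ℕ))) •
      (ExteriorAlgebra.ιMulti k a (fun t : Fin a =>
          v ((P.1ᶜ.orderIsoOfFin (by
            have h := (Finset.mem_powersetCard.mp P.2).2
            rw [Finset.card_compl, h, Fintype.card_fin]; omega)) t)) *
        φ (fun t : Fin p =>
          v ((P.1.orderIsoOfFin ((Finset.mem_powersetCard.mp P.2).2)) t)))

end PBW0

namespace PBW0


section sl2
variable {k M : Type*} [Field k] [CharZero k] [AddCommGroup M] [Module k M]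

theorem sl2_comm (L D H : Module.End k M) (hDL : ∀ x, D (L x) = L (D x) + H x)
    (hHL : ∀ x, H (L x) = L (H x) - (2 : k) • L x) (h : k) (x : M) (hx : H x = h • x) (a : ℕ) :
    H ((L ^ a) x) = (h - 2 * a) • (L ^ a) x ∧
    D ((L ^ (a + 1)) x) = (L ^ (a + 1)) (D x) + ((a + 1 : k) * (h - a)) • (L ^ a) x := by
  induction a with
  | zero => simp [hx, hDL]
  | succ a ih =>
    have h1 : H ((L ^ (a + 1)) x) = (h - 2 * (a + 1 : ℕ)) • (L ^ (a + 1)) x := by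
      rw [pow_succ', Module.End.mul_apply, hHL, ih.1, map_smul, ← sub_smul]
      push_cast; congr 1; ring
    refine ⟨h1, ?_⟩
    rw [pow_succ' L (a + 1), Module.End.mul_apply, hDL, ih.2, h1, map_add, map_smul,
      ← Module.End.mul_apply L (L ^ a), ← pow_succ', Module.End.mul_apply, add_assoc, ← add_smul]
    push_cast; congr 2; ring

theorem sl2_inj (L D H : Module.End k M) (hDL : ∀ x, D (L x) = L (D x) + H x)
    (hHL : ∀ x, H (L x) = L (H x) - (2 : k) • L x)
    (hHD : ∀ x, H (D x) = D (H x) + (2 : k) • D x) (m : ℕ) :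
    ∀ (h a : ℕ) (x : M), H x = (h : k) • x → a ≤ h → (D ^ m) x = 0 → (L ^ a) x = 0 → x = 0 := by
  induction m with
  | zero => intro h a x _ _ h0 _; simpa using h0
  | succ m ih =>
    intro h a x hx hah hD hL
    have hDx : D x = 0 := by
      apply ih (h + 2) (a + 1) (D x)
      · rw [hHD, hx, map_smul, ← add_smul]; push_cast; rfl
      · omega
      · rw [← Module.End.mul_apply, ← pow_succ, hD]
      · have := (sl2_comm L D H hDL hHL h x hx a).2
        rw [hL, pow_succ' L, Module.End.mul_apply, hL] at this
        simp only [map_zero, smul_zero, add_zero] at this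
        rw [pow_succ', this]
    clear hD ih
    induction a with
    | zero => simpa using hL
    | succ a iha =>
      apply iha (by omega)
      have := (sl2_comm L D H hDL hHL h x hx a).2
      rw [hL, hDx, map_zero, map_zero, zero_add] at this
      have h2 : ((a + 1 : k) * (h - a)) ≠ 0 := by
        have : (h : k) - a = ((h - a : ℕ) : k) := by rw [Nat.cast_sub (by omega)]
        rw [this]
        apply mul_ne_zero
        · exact_mod_cast Nat.succ_ne_zero a
        · exact_mod_cast (by omega : h - a ≠ 0)
      exact (smul_eq_zero.mp this.symm).resolve_left h2
end sl2

section car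
variable {k A : Type*} [Field k] [Ring A] [Algebra k A] {n : ℕ} (c d : Fin n → A)

/-- number operator -/
def Nop : A := ∑ i, c i * d i
variable (k) in
/-- two-sided operator -/
noncomputable def Lop : Module.End k A :=
  ∑ i, LinearMap.mulLeft k (c i) * LinearMap.mulRight k (d i)

theorem Lop_apply (x : A) : Lop k c d x = ∑ i, c i * x * d i := by
  simp [Lop, LinearMap.sum_apply, mul_assoc]

variable (hcd : ∀ i j, d i * c j = (if i = j then 1 else 0) - c j * d i)
include hcd

theorem Nop_c (hc : ∀ i j, c i * c j = - (c j * c i)) (j) :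
    Nop c d * c j = c j * Nop c d + c j := by
  simp only [Nop, Finset.sum_mul, Finset.mul_sum, mul_assoc, hcd, mul_sub, Finset.sum_sub_distrib]
  simp only [mul_ite, mul_one, mul_zero, Finset.sum_ite_eq', Finset.mem_univ, if_true]
  simp only [← mul_assoc, hc _ j, neg_mul, Finset.sum_neg_distrib]
  abel

theorem Nop_d (hd : ∀ i j, d i * d j = - (d j * d i)) (j) :
    Nop c d * d j = d j * Nop c d - d j := by
  have : d j * Nop c d = d j + Nop c d * d j := by
    simp only [Nop, Finset.sum_mul, Finset.mul_sum, ← mul_assoc, hcd, sub_mul,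
      Finset.sum_sub_distrib]
    simp only [mul_assoc, hd j, ite_mul, one_mul, zero_mul, Finset.sum_ite_eq, Finset.mem_univ,
      if_true, mul_neg, Finset.sum_neg_distrib]
    abel
  rw [this]; abel

theorem DL_comm (x : A) : Lop k d c (Lop k c d x) =
    Lop k c d (Lop k d c x) + ((n : k) • x - Nop c d * x - x * Nop c d) := by
  have key : ∀ i j, d i * (c j * x * d j) * c i =
      c j * (d i * x * c i) * d j + (if i = j then x else 0)
        - (if i = j then c j * d i * x else 0) - (if i = j then x * (c i * d j) else 0) := by
    intro i j
    have : d i * (c j * x * d j) * c i = (d i * c j) * x * (d j * c i) := by noncomm_ring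
    rw [this, hcd, hcd]
    by_cases h : i = j
    · subst h; simp only [if_true]; noncomm_ring
    · simp only [h, Ne.symm h, if_false]; noncomm_ring
  simp only [Lop_apply, Finset.mul_sum, Finset.sum_mul, key, Finset.sum_sub_distrib,
    Finset.sum_add_distrib]
  rw [Finset.sum_comm]
  simp only [Finset.sum_ite_eq, Finset.mem_univ, if_true, Nop, Finset.sum_mul, Finset.mul_sum,
    Finset.sum_const, Finset.card_univ, Fintype.card_fin, Nat.cast_smul_eq_nsmul]
  abel

theorem N_L (hc : ∀ i j, c i * c j = - (c j * c i)) (x : A) :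
    Nop c d * Lop k c d x = Lop k c d (Nop c d * x) + Lop k c d x := by
  simp only [Lop_apply, Finset.mul_sum, ← mul_assoc, Nop_c c d hcd hc, add_mul,
    Finset.sum_add_distrib]

theorem L_N (hd : ∀ i j, d i * d j = - (d j * d i)) (x : A) :
    Lop k c d x * Nop c d = Lop k c d (x * Nop c d) + Lop k c d x := by
  have h : ∀ j, d j * Nop c d = Nop c d * d j + d j := fun j => by rw [Nop_d c d hcd hd]; abel
  simp only [Lop_apply, Finset.sum_mul, mul_assoc, h, mul_add, Finset.sum_add_distrib]

theorem N_D (hd : ∀ i j, d i * d j = - (d j * d i)) (x : A) :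
    Nop c d * Lop k d c x = Lop k d c (Nop c d * x) - Lop k d c x := by
  simp only [Lop_apply, Finset.mul_sum, ← mul_assoc, Nop_d c d hcd hd, sub_mul,
    Finset.sum_sub_distrib]

theorem D_N (hc : ∀ i j, c i * c j = - (c j * c i)) (x : A) :
    Lop k d c x * Nop c d = Lop k d c (x * Nop c d) - Lop k d c x := by
  have h : ∀ j, c j * Nop c d = Nop c d * c j - c j := fun j => by rw [Nop_c c d hcd hc]; abel
  simp only [Lop_apply, Finset.sum_mul, mul_assoc, h, mul_sub, Finset.sum_sub_distrib]

theorem car_inj [CharZero k] (hc : ∀ i j, c i * c j = - (c j * c i))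
    (hd : ∀ i j, d i * d j = - (d j * d i)) 
    (hN : ∀ x : A, x * Nop c d = - x → x = 0)
    (a p r : ℕ) (hn : a + p + r ≤ n) (x : A) (hr : Nop c d * x = (r : k) • x)
    (hp : x * Nop c d = (p : k) • x) (hx : (Lop k c d ^ a) x = 0) : x = 0 := by
  have hD : ∀ m : ℕ, ((Lop k d c) ^ m) x * Nop c d = ((p : k) - m) • ((Lop k d c) ^ m) x := by
    intro m
    induction m with
    | zero => simp [hp]
    | succ m ih =>
      rw [pow_succ', Module.End.mul_apply, D_N c d hcd hc, ih, map_smul]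
      push_cast; module
  refine sl2_inj (Lop k c d) (Lop k d c)
    ((n : k) • 1 - LinearMap.mulLeft k (Nop c d) - LinearMap.mulRight k (Nop c d))
    ?_ ?_ ?_ (p + 1) (n - p - r) a x ?_ (by omega) ?_ hx
  · intro x; simpa using DL_comm c d hcd x
  · intro x
    simp only [LinearMap.sub_apply, LinearMap.smul_apply, Module.End.one_apply,
      LinearMap.mulLeft_apply, LinearMap.mulRight_apply, N_L c d hcd hc, L_N c d hcd hd, map_sub,
      map_smul]
    module
  · intro x
    simp only [LinearMap.sub_apply, LinearMap.smul_apply, Module.End.one_apply,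
      LinearMap.mulLeft_apply, LinearMap.mulRight_apply, N_D c d hcd hd, D_N c d hcd hc, map_sub,
      map_smul]
    module
  · simp only [LinearMap.sub_apply, LinearMap.smul_apply, Module.End.one_apply,
      LinearMap.mulLeft_apply, LinearMap.mulRight_apply, hr, hp]
    rw [Nat.sub_sub, Nat.cast_sub (by omega)]
    push_cast; module
  · apply hN
    rw [hD]; push_cast; module

end car

section car2
variable {k A : Type*} [Field k] [Ring A] [Algebra k A] {n : ℕ} (c d : Fin n → A)
variable (u : A) (s : Fin n → k) (hdu : ∀ i, d i * u = s i • (1 : A) - u * d i)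
  (hcu : ∀ i, c i * u = - (u * c i)) (hsc : ∑ i, s i • c i = u)
include hdu hsc

theorem Lop_mul (x : A) : Lop k c d x * u = u * x - Lop k c d (x * u) := by
  have h : u * x = ∑ i, (s i • c i) * x := by rw [← Finset.sum_mul, hsc]
  rw [h]
  simp only [Lop_apply, Finset.sum_mul, mul_assoc, hdu, mul_sub, Finset.sum_sub_distrib]
  simp

include hcu

omit hdu hsc in
theorem mul_Lop (x : A) : Lop k c d (u * x) = - (u * Lop k c d x) := by
  simp only [Lop_apply, Finset.mul_sum, ← mul_assoc, hcu, neg_mul, Finset.sum_neg_distrib]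

theorem Lop_pow_mul (x : A) (a : ℕ) :
    (Lop k c d ^ (a + 1)) x * u = ((a : k) + 1) • (u * (Lop k c d ^ a) x)
      + ((-1 : k) ^ (a + 1)) • (Lop k c d ^ (a + 1)) (x * u) := by
  induction a with
  | zero => simp [Lop_mul c d u s hdu hsc, sub_eq_add_neg]
  | succ a ih =>
    rw [pow_succ' (Lop k c d) (a + 1), Module.End.mul_apply, Lop_mul c d u s hdu hsc, ih, map_add,
      map_smul, map_smul, mul_Lop c d u hcu, ← Module.End.mul_apply,
      ← Module.End.mul_apply, ← pow_succ', ← pow_succ']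
    push_cast
    rw [pow_succ (-1 : k) (a + 1)]
    module

theorem Nop_mul : Nop c d * u = u * Nop c d + u := by
  have h := Lop_mul c d u s hdu hsc 1
  have h2 := mul_Lop (k := k) c d u hcu 1
  rw [one_mul] at h
  rw [mul_one] at h h2
  rw [h2] at h
  simp only [Lop_apply, mul_one] at h
  rw [Nop, h]; abel
end car2


section conc
variable {k V : Type} [Field k] [AddCommGroup V] [Module k V]

/-- creation -/
noncomputable def Cr (v : V) : Module.End k (ExteriorAlgebra k V) :=
  LinearMap.mulLeft k (ExteriorAlgebra.ι k v)
/-- annihilation -/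
noncomputable def An (f : Module.Dual k V) : Module.End k (ExteriorAlgebra k V) :=
  CliffordAlgebra.contractLeft (Q := (0 : QuadraticForm k V)) f

theorem Cr_apply (v : V) (x : ExteriorAlgebra k V) : Cr v x = ExteriorAlgebra.ι k v * x := rfl

theorem An_Cr (f : Module.Dual k V) (v : V) :
    An f * Cr v = f v • (1 : Module.End k (ExteriorAlgebra k V)) - Cr v * An f := by
  apply LinearMap.ext
  intro x
  exact CliffordAlgebra.contractLeft_ι_mul (Q := (0 : QuadraticForm k V)) f v x

theorem An_one (f : Module.Dual k V) : An f (1 : ExteriorAlgebra k V) = 0 :=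
  CliffordAlgebra.contractLeft_one (Q := (0 : QuadraticForm k V)) f

theorem An_An (f g : Module.Dual k V) : (An f * An g : Module.End k (ExteriorAlgebra k V)) =
    - (An g * An f) := by
  apply LinearMap.ext
  intro x
  exact CliffordAlgebra.contractLeft_comm (Q := (0 : QuadraticForm k V)) f g x

theorem Cr_Cr (v w : V) : (Cr v * Cr w : Module.End k (ExteriorAlgebra k V)) =
    - (Cr w * Cr v) := by
  apply LinearMap.ext
  intro x
  have := ExteriorAlgebra.ι_add_mul_swap (R := k) v w
  simp only [Module.End.mul_apply, Cr_apply, LinearMap.neg_apply, ← mul_assoc]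
  rw [eq_neg_of_add_eq_zero_left this, neg_mul]

theorem sum_coord {n : ℕ} (b : Module.Basis (Fin n) k V) (v : V) :
    ∑ i, b.coord i v • (Cr (b i) : Module.End k (ExteriorAlgebra k V)) = Cr v := by
  apply LinearMap.ext
  intro x
  conv_rhs => rw [← b.sum_repr v]
  simp only [Cr_apply, LinearMap.sum_apply, LinearMap.smul_apply, map_sum, map_smul,
    Finset.sum_mul, smul_mul_assoc, Module.Basis.coord_apply]

variable {n : ℕ} (b : Module.Basis (Fin n) k V)

/-- the operator -/
noncomputable abbrev LL :=
  Lop k (fun i => Cr (b i)) (fun i => An (b.coord i))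

/-- number operator -/
noncomputable abbrev NN : Module.End k (ExteriorAlgebra k V) :=
  Nop (fun i => Cr (b i)) (fun i => An (b.coord i))

theorem LL_pow_Cr (φ : Module.End k (ExteriorAlgebra k V)) (v : V) (a : ℕ) :
    (LL b ^ (a + 1)) φ * Cr v = ((a : k) + 1) • (Cr v * (LL b ^ a) φ)
      + ((-1 : k) ^ (a + 1)) • (LL b ^ (a + 1)) (φ * Cr v) := by
  have h := Lop_pow_mul (k := k) (A := Module.End k (ExteriorAlgebra k V))
    (fun i => Cr (b i)) (fun i => An (b.coord i)) (Cr v) (fun i => b.coord i v)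
  have h1 := h (fun _ => An_Cr _ _) (fun _ => Cr_Cr _ _)
  have h2 := h1 (sum_coord b v) 
  have h3 := h2 φ a
  exact h3

theorem NN_Cr (v : V) : NN b * Cr v = Cr v * NN b + Cr v :=
  Nop_mul (k := k) _ _ (Cr v) (fun i => b.coord i v) (fun _ => An_Cr _ _) (fun _ => Cr_Cr _ _)
    (sum_coord b v)

theorem NN_ιMulti (m : ℕ) (v : Fin m → V) :
    NN b (ExteriorAlgebra.ιMulti k m v) = (m : k) • ExteriorAlgebra.ιMulti k m v := by
  induction m with
  | zero => simp [NN, Nop, An_one, LinearMap.sum_apply]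
  | succ m ih =>
    rw [ExteriorAlgebra.ιMulti_succ_apply, ← Cr_apply, ← Module.End.mul_apply, NN_Cr,
      LinearMap.add_apply, Module.End.mul_apply, ih, map_smul]
    push_cast; module

theorem NN_mem (r : ℕ) (x : ExteriorAlgebra k V) (hx : x ∈ ⋀[k]^r V) :
    NN b x = (r : k) • x := by
  rw [← ExteriorAlgebra.ιMulti_span_fixedDegree] at hx
  induction hx using Submodule.span_induction with
  | mem x h => obtain ⟨v, rfl⟩ := h; exact NN_ιMulti b r v
  | zero => simp
  | add x y _ _ hx hy => rw [map_add, hx, hy, smul_add]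
  | smul a x _ hx => rw [map_smul, hx, smul_comm]

theorem ext_ιMulti (f g : Module.End k (ExteriorAlgebra k V))
    (h : ∀ m (v : Fin m → V), f (ExteriorAlgebra.ιMulti k m v) = g (ExteriorAlgebra.ιMulti k m v)) :
    f = g := by
  apply ExteriorAlgebra.lhom_ext
  intro m
  apply AlternatingMap.ext
  intro v
  exact h m v

theorem NN_neg [CharZero k] (x : Module.End k (ExteriorAlgebra k V)) (h : x * NN b = - x) :
    x = 0 := by
  apply ext_ιMulti
  intro m v
  have := congrArg (fun f => f (ExteriorAlgebra.ιMulti k m v)) h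
  simp only [Module.End.mul_apply, NN_ιMulti, map_smul, LinearMap.neg_apply] at this
  have h3 : ((m : k) + 1) • x (ExteriorAlgebra.ιMulti k m v) = 0 := by
    rw [add_smul, this]; simp
  rw [smul_eq_zero] at h3
  refine h3.resolve_left ?_
  exact_mod_cast Nat.succ_ne_zero m

theorem conc_inj [CharZero k] (a p r : ℕ) (hn : a + p + r ≤ n)
    (x : Module.End k (ExteriorAlgebra k V)) (hr : NN b * x = (r : k) • x)
    (hp : x * NN b = (p : k) • x) (hx : (LL b ^ a) x = 0) : x = 0 := by
  refine car_inj _ _ ?_ (fun i j => Cr_Cr _ _) (fun i j => An_An _ _) (NN_neg b) a p r hn x hr hp hx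
  intro i j
  rw [An_Cr]
  congr 1
  by_cases h : i = j
  · subst h; simp
  · simp [h]

/-- ordered wedge over a finset -/
noncomputable def wd {N : ℕ} (v : Fin N → V) (P : Finset (Fin N)) : ExteriorAlgebra k V :=
  (P.sort.map (fun i => ExteriorAlgebra.ι k (v i))).prod

theorem wd_eq {N m : ℕ} (v : Fin N → V) (P : Finset (Fin N)) (h : P.card = m) :
    wd v P = ExteriorAlgebra.ιMulti k m (fun t => v (P.orderIsoOfFin h t)) := by
  rw [ExteriorAlgebra.ιMulti_apply, wd, ← P.listMap_orderEmbOfFin_finRange h, List.ofFn_eq_map,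
    List.map_map]
  rfl

theorem wd_map {N : ℕ} (v : Fin (N + 1) → V) (P : Finset (Fin N)) :
    (wd v (P.map (Fin.succEmb N)) : ExteriorAlgebra k V) = wd (Matrix.vecTail v) P := by
  have := StrictMonoOn.map_finsetSort (Fin.succEmb N) P
    (StrictMono.strictMonoOn (Fin.strictMono_succ (n := N)) (P : Set (Fin N)))
  rw [wd, ← this, wd, List.map_map]
  rfl

theorem wd_insert {N : ℕ} (v : Fin (N + 1) → V) (P : Finset (Fin N)) :
    (wd v (insert 0 (P.map (Fin.succEmb N))) : ExteriorAlgebra k V) =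
      ExteriorAlgebra.ι k (v 0) * wd (Matrix.vecTail v) P := by
  rw [← wd_map, wd, Finset.sort_insert _ (by simp) (by simp)]
  simp [wd]

theorem sum_finset_succ {N : ℕ} {M : Type*} [AddCommMonoid M] (f : Finset (Fin (N + 1)) → M) :
    ∑ P, f P = ∑ P : Finset (Fin N), f (P.map (Fin.succEmb N)) +
      ∑ P : Finset (Fin N), f (insert 0 (P.map (Fin.succEmb N))) := by
  classical
  have h0 : (0 : Fin (N + 1)) ∉ (Finset.univ : Finset (Fin N)).image Fin.succ := by simp
  have h1 : (Finset.univ : Finset (Finset (Fin (N + 1)))) =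
      (insert 0 ((Finset.univ : Finset (Fin N)).image Fin.succ)).powerset := by
    rw [← Finset.powerset_univ, Fin.univ_succ]
    simp [Finset.map_eq_image]
  rw [h1, Finset.sum_powerset_insert h0, Finset.powerset_image,
    Finset.sum_image (Finset.image_injective (Fin.succ_injective N)).injOn,
    Finset.sum_image (Finset.image_injective (Fin.succ_injective N)).injOn, Finset.powerset_univ]
  simp only [Finset.map_eq_image]
  rfl

theorem compl_map {N : ℕ} (P : Finset (Fin N)) :
    (P.map (Fin.succEmb N))ᶜ = insert 0 (Pᶜ.map (Fin.succEmb N)) := by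
  ext i
  refine Fin.cases ?_ (fun j => ?_) i <;> simp [Fin.succ_ne_zero]

theorem compl_insert {N : ℕ} (P : Finset (Fin N)) :
    (insert 0 (P.map (Fin.succEmb N)))ᶜ = Pᶜ.map (Fin.succEmb N) := by
  ext i
  refine Fin.cases ?_ (fun j => ?_) i <;> simp [Fin.succ_ne_zero]

/-- coefficient -/
def cf (k : Type) [Field k] {N : ℕ} (a : ℕ) (P : Finset (Fin N)) : k :=
  (-1 : k) ^ (a * P.card + P.card.choose 2 + ∑ i ∈ P, (i : ℕ))

theorem sgn_congr {m n : ℕ} (h : m % 2 = n % 2) : (-1 : k) ^ m = (-1) ^ n := by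
  rw [neg_one_pow_eq_pow_mod_two, h, ← neg_one_pow_eq_pow_mod_two]

theorem cf_map {N : ℕ} (a : ℕ) (P : Finset (Fin N)) :
    cf k (a + 1) (P.map (Fin.succEmb N)) = cf k a P := by
  unfold cf
  simp only [Finset.card_map, Finset.sum_map, Fin.coe_succEmb, Fin.val_succ,
    Finset.sum_add_distrib, Finset.sum_const, smul_eq_mul, mul_one]
  apply sgn_congr
  rw [add_mul]; omega

theorem cf_insert {N : ℕ} (a : ℕ) (P : Finset (Fin N)) :
    cf k a (insert 0 (P.map (Fin.succEmb N))) = (-1) ^ a * cf k a P := by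
  unfold cf
  rw [Finset.card_insert_of_notMem (by simp), Finset.sum_insert (by simp), ← pow_add]
  simp only [Finset.card_map, Finset.sum_map, Fin.coe_succEmb, Fin.val_succ,
    Finset.sum_add_distrib, Finset.sum_const, smul_eq_mul, mul_one, Fin.val_zero]
  apply sgn_congr
  rw [mul_add, Nat.choose_succ_succ' _ 1]; simp; omega

theorem LL_pow_ιMulti (N : ℕ) : ∀ (a : ℕ) (φ : Module.End k (ExteriorAlgebra k V)) (v : Fin N → V),
    (LL b ^ a) φ (ExteriorAlgebra.ιMulti k N v) = (a.factorial : k) •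
      ∑ P : Finset (Fin N), if P.card + a = N then cf k a P • (wd v Pᶜ * φ (wd v P)) else 0 := by
  induction N with
  | zero =>
    intro a φ v
    rw [Fintype.sum_eq_single ∅ (fun P h => absurd (Subsingleton.elim _ _) h)]
    cases a with
    | zero => simp [cf, wd]
    | succ a => 
      rw [pow_succ', Module.End.mul_apply, LL, Lop_apply]
      simp [LinearMap.sum_apply, An_one]
  | succ N ih =>
    intro a φ v
    rw [ExteriorAlgebra.ιMulti_succ_apply, ← Cr_apply, ← Module.End.mul_apply, sum_finset_succ]
    simp only [compl_map, compl_insert, wd_map, wd_insert, cf_insert, Finset.card_map,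
      Finset.card_insert_of_notMem (show (0 : Fin (N + 1)) ∉ Finset.map (Fin.succEmb N) _ by simp)]
    have e2 : ∀ P : Finset (Fin N), P.card + 1 + a = N + 1 ↔ P.card + a = N := by
      intro P; omega
    simp only [e2]
    have key := ih a (φ * Cr (v 0)) (Matrix.vecTail v)
    cases a with
    | zero =>
      simp only [pow_zero, Module.End.one_apply] at key ⊢
      have hz : ∀ P : Finset (Fin N), ¬ (P.card + 0 = N + 1) := by
        intro P
        have := P.card_le_univ
        rw [Fintype.card_fin] at this
        omega
      rw [key]
      simp only [hz, if_false, Finset.sum_const_zero, zero_add, one_mul]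
      rfl
    | succ a =>
      have e1 : ∀ P : Finset (Fin N), P.card + (a + 1) = N + 1 ↔ P.card + a = N := by
        intro P; omega
      simp only [e1, cf_map]
      rw [LL_pow_Cr, LinearMap.add_apply, LinearMap.smul_apply, LinearMap.smul_apply,
        Module.End.mul_apply, key, ih, Cr_apply, smul_add, Nat.factorial_succ]
      congr 1
      · rw [mul_smul_comm, smul_smul, Finset.mul_sum]
        push_cast
        congr 1
        apply Finset.sum_congr rfl
        intro P _
        split_ifs
        · rw [mul_smul_comm, mul_assoc]
        · simp
      · rw [smul_comm, Finset.smul_sum]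
        congr 1
        apply Finset.sum_congr rfl
        intro P _
        split_ifs
        · rw [smul_smul]; rfl
        · simp

end conc

section conc2
variable {k V : Type} [Field k] [CharZero k] [AddCommGroup V] [Module k V]

theorem TaEval_sub (a p : ℕ) (φ ψ : AlternatingMap k V (ExteriorAlgebra k V) (Fin p))
    (v : Fin (a + p) → V) :
    TaEval k V a p (φ - ψ) v = TaEval k V a p φ v - TaEval k V a p ψ v := by
  simp only [TaEval, AlternatingMap.sub_apply, mul_sub, smul_sub, Finset.sum_sub_distrib]

/-- extension by zero -/
noncomputable def extZ (p : ℕ) (χ : AlternatingMap k V (ExteriorAlgebra k V) (Fin p)) :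
    Module.End k (ExteriorAlgebra k V) :=
  ExteriorAlgebra.liftAlternating (R := k) (M := V) (N := ExteriorAlgebra k V) (Pi.single p χ)

theorem extZ_same (p : ℕ) (χ : AlternatingMap k V (ExteriorAlgebra k V) (Fin p)) (v : Fin p → V) :
    extZ p χ (ExteriorAlgebra.ιMulti k p v) = χ v := by
  rw [extZ, ExteriorAlgebra.liftAlternating_apply_ιMulti, Pi.single_eq_same]

theorem extZ_ne (p m : ℕ) (h : m ≠ p) (χ : AlternatingMap k V (ExteriorAlgebra k V) (Fin p))
    (v : Fin m → V) : extZ p χ (ExteriorAlgebra.ιMulti k m v) = 0 := by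
  rw [extZ, ExteriorAlgebra.liftAlternating_apply_ιMulti, Pi.single_eq_of_ne h]
  rfl

theorem TaEval_eq (a p : ℕ) (χ : AlternatingMap k V (ExteriorAlgebra k V) (Fin p))
    (v : Fin (a + p) → V) :
    ∑ P : Finset (Fin (a + p)),
      (if P.card + a = a + p then cf k a P • (wd v Pᶜ * extZ p χ (wd v P)) else 0) =
    ((-1 : k) ^ (a * p + p.choose 2)) • TaEval k V a p χ v := by
  have e : ∀ P : Finset (Fin (a + p)), P.card + a = a + p ↔
      P ∈ Finset.powersetCard p (Finset.univ : Finset (Fin (a + p))) := by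
    intro P
    rw [Finset.mem_powersetCard]
    simp only [Finset.subset_univ, true_and]
    omega
  simp only [e]
  rw [← Finset.sum_filter, Finset.filter_mem_eq_inter, Finset.univ_inter, TaEval,
    ← Finset.sum_attach, Finset.smul_sum]
  apply Finset.sum_congr rfl
  intro P _
  have h := (Finset.mem_powersetCard.mp P.2).2
  have h' : (P.1ᶜ).card = a := by
    rw [Finset.card_compl, h, Fintype.card_fin]; omega
  rw [wd_eq v P.1 h, wd_eq v _ h', extZ_same, smul_smul, cf, h, pow_add]

end conc2

variable (k V : Type) [Field k] [CharZero k] [AddCommGroup V] [Module k V]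

/-- Let `V` be a finite-dimensional vector space over a field `k` of
characteristic zero with `dim V = v`, and let `a, p, r ≥ 0` satisfy `v ≥ a + p + r`.  The
linear map `T_a : Hom(∧^p V, ∧^r V) → Hom(∧^{a+p} V, ∧^{a+r} V)` given by
`T_a(φ)(v_I) = ∑_{I = A ∪ P} ± v_A ∧ φ(v_P)` is injective.  (Linear maps `∧^p V → ∧^r V` are
encoded as alternating maps `V^p → ExteriorAlgebra k V` taking values in the `r`-th exterior
power `⋀[k]^r V`, and two maps `T_a φ`, `T_a ψ` are equal iff they agree on all wedges
`v_0 ∧ ⋯ ∧ v_{a+p-1}`.) -/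
theorem stmt0 [FiniteDimensional k V] (a p r : ℕ)
    (hdim : a + p + r ≤ Module.finrank k V)
    (φ ψ : AlternatingMap k V (ExteriorAlgebra k V) (Fin p))
    (hφ : ∀ x : Fin p → V, φ x ∈ ⋀[k]^r V)
    (hψ : ∀ x : Fin p → V, ψ x ∈ ⋀[k]^r V)
    (heq : ∀ v : Fin (a + p) → V, TaEval k V a p φ v = TaEval k V a p ψ v) :
    φ = ψ := by
  have hTa : ∀ v, TaEval k V a p (φ - ψ) v = 0 := by
    intro v
    rw [TaEval_sub, heq, sub_self]
  have hmem : ∀ x, (φ - ψ) x ∈ ⋀[k]^r V := by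
    intro x
    rw [AlternatingMap.sub_apply]
    exact Submodule.sub_mem _ (hφ x) (hψ x)
  rw [← sub_eq_zero]
  generalize φ - ψ = χ at hTa hmem
  let b := Module.finBasis k V
  have hX : extZ p χ = 0 := by
    refine conc_inj b a p r hdim (extZ p χ) ?_ ?_ ?_
    · apply ext_ιMulti
      intro m v
      rw [Module.End.mul_apply, LinearMap.smul_apply]
      by_cases h : m = p
      · subst h
        rw [extZ_same]
        exact NN_mem b r _ (hmem v)
      · rw [extZ_ne p m h, map_zero, smul_zero]
    · apply ext_ιMulti
      intro m v
      rw [Module.End.mul_apply, LinearMap.smul_apply, NN_ιMulti, map_smul]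
      by_cases h : m = p
      · subst h
        rfl
      · rw [extZ_ne p m h, smul_zero, smul_zero]
    · apply ext_ιMulti
      intro m v
      rw [LL_pow_ιMulti, LinearMap.zero_apply]
      by_cases h : m = a + p
      · subst h
        rw [TaEval_eq, hTa, smul_zero, smul_zero]
      · rw [Finset.sum_eq_zero, smul_zero]
        intro P _
        split_ifs with hP
        · rw [wd_eq v P rfl, extZ_ne p _ (by omega), mul_zero, smul_zero]
        · rfl
  apply AlternatingMap.ext
  intro v
  rw [← extZ_same p χ v, hX]
  rfl

end PBW0
end

section
/- Let $V$ be a vector space over a field of characteristic zero with $\dim V \geq N+2$, and embed $\wedge^N V \subseteq V^{\otimes N}$ via total antisymmetrization $x_1 \wedge \cdots \wedge x_N \mapsto \sum_{\sigma \in S_N} (-1)^{\mathrm{sgn}(\sigma)} x_{\sigma(1)} \otimes \cdots \otimes x_{\sigma(N)}$. Let $\alpha : \wedge^N V \to V^{\otimes N-s}$ be a linear map. Then the image of the composite $\wedge^{N+1} V \hookrightarrow V \otimes \wedge^N V \xrightarrow{1 \otimes \alpha} V^{\otimes N+1-s}$ is contained in $\wedge^{N+1-s} V$ if and only if $\alpha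 = \mathbf{1}^{\otimes N-s} \otimes \Phi$ for some alternating form $\Phi : \wedge^s V \to k$. -/
open scoped TensorProduct
open PiTensorProduct

namespace PBW2


variable (k V : Type) [Field k] [CharZero k] [AddCommGroup V] [Module k V]

/-- The pure tensor `x 0 ⊗ ⋯ ⊗ x (n-1)` in `V^{⊗n}`. -/
noncomputable def tpN (n : ℕ) (x : ℕ → V) : ⨂[k]^n V := tprod k fun i : Fin n => x i

/-- The total antisymmetrization `∑_{σ ∈ S_n} sgn σ • x_{σ(0)} ⊗ ⋯ ⊗ x_{σ(n-1)}`,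
the image of `x 0 ∧ ⋯ ∧ x (n-1)` under the embedding `∧ⁿ V ⊆ V^{⊗n}`. -/
noncomputable def asymN (n : ℕ) (x : ℕ → V) : ⨂[k]^n V :=
  ∑ σ : Equiv.Perm (Fin n), (Equiv.Perm.sign σ : ℤ) • tprod k (fun i : Fin n => x (σ i))

/-- The image of `∧ⁿ V` in `V^{⊗n}` under total antisymmetrization. -/
noncomputable def wedgeIm (n : ℕ) : Submodule k (⨂[k]^n V) :=
  Submodule.span k (Set.range (asymN k V n))

/-- `x 0 ∧ ⋯ ∧ x (n-1)` as an element of the subspace `∧ⁿ V ⊆ V^{⊗n}`. -/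
noncomputable def wdgN (n : ℕ) (x : ℕ → V) : wedgeIm k V n :=
  ⟨asymN k V n x, Submodule.subset_span ⟨x, rfl⟩⟩

/-- Permute the first `n` entries of the sequence `x` by `σ`. -/
def permt {n : ℕ} (σ : Equiv.Perm (Fin n)) (x : ℕ → V) : ℕ → V :=
  fun m => if h : m < n then x (σ ⟨m, h⟩) else x m

/-- Remove the `j`-th entry of the sequence `x`. -/
def removeN (j : ℕ) (x : ℕ → V) : ℕ → V := fun m => if m < j then x m else x (m + 1)

/-- Prepend the entry `v` at the front of the sequence `x`. -/
def consT (v : V) (x : ℕ → V) : ℕ → V := fun m => if m = 0 then v else x (m - 1)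

/-- Replace the `p`-th entry of the sequence `x` by `v`. -/
def putAt (p : ℕ) (x : ℕ → V) (v : V) : ℕ → V := fun m => if m = p then v else x m


/-- The map `V^{⊗m} → V^{⊗(m+1)}`, `t ↦ v ⊗ t`. -/
noncomputable def prepend (m : ℕ) (v : V) : ⨂[k]^m V →ₗ[k] ⨂[k]^(m+1) V :=
  (TensorPower.cast k V (Nat.add_comm 1 m)).toLinearMap ∘ₗ
    (TensorPower.mulEquiv (R := k) (M := V) (n := 1) (m := m)).toLinearMap ∘ₗ
      TensorProduct.mk k (⨂[k]^1 V) (⨂[k]^m V) (tprod k fun _ : Fin 1 => v)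

/-- The map `V^{⊗m} → V^{⊗(m+1)}`, `t ↦ t ⊗ v`. -/
noncomputable def append (m : ℕ) (v : V) : ⨂[k]^m V →ₗ[k] ⨂[k]^(m+1) V :=
  (TensorPower.mulEquiv (R := k) (M := V) (n := m) (m := 1)).toLinearMap ∘ₗ
    (TensorProduct.mk k (⨂[k]^m V) (⨂[k]^1 V)).flip (tprod k fun _ : Fin 1 => v)


/-- `(𝟙 ⊗ α)` applied to the antisymmetrization of `x_0, …, x_{m+s}`, via the expansion
`∧^{N+1} V ⊆ V ⊗ ∧^N V` (where `N = m + s` and `α : ∧^N V → V^{⊗m}`). -/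
noncomputable def oneTA (m s : ℕ) (α : wedgeIm k V (m + s) →ₗ[k] ⨂[k]^m V) (x : ℕ → V) :
    ⨂[k]^(m+1) V :=
  ∑ j ∈ Finset.range (m + s + 1),
    ((-1 : ℤ) ^ j) • prepend k V m (x j) (α (wdgN k V (m + s) (removeN V j x)))

/-- `(α ⊗ 𝟙)` applied to the antisymmetrization of `x_0, …, x_{m+s}`, via the expansion
`∧^{N+1} V ⊆ ∧^N V ⊗ V`. -/
noncomputable def taOne (m s : ℕ) (α : wedgeIm k V (m + s) →ₗ[k] ⨂[k]^m V) (x : ℕ → V) :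
    ⨂[k]^(m+1) V :=
  ∑ j ∈ Finset.range (m + s + 1),
    ((-1 : ℤ) ^ (m + s - j)) • append k V m (x j) (α (wdgN k V (m + s) (removeN V j x)))


section helpers

set_option linter.unusedSectionVars false

lemma zs_sum {W ι : Type*} [AddCommGroup W] (z : ℤ) (t : Finset ι) (f : ι → W) :
    z • ∑ i ∈ t, f i = ∑ i ∈ t, z • f i := Finset.smul_sum

lemma altsum_apply {W ι : Type} [AddCommGroup W] [Module k W] {n : ℕ} (t : Finset ι)
    (f : ι → V [⋀^Fin n]→ₗ[k] W) (x : Fin n → V) : (∑ i ∈ t, f i) x = ∑ i ∈ t, f i x := by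
  classical
  induction t using Finset.induction_on with
  | empty => simp
  | insert a t ha ih => rw [Finset.sum_insert ha, Finset.sum_insert ha, AlternatingMap.add_apply, ih]

lemma prepend_tprod (m : ℕ) (v : V) (x : Fin m → V) :
    prepend k V m v (tprod k x) = tprod k (Fin.cons v x : Fin (m + 1) → V) := by
  have h := TensorPower.tprod_mul_tprod (R := k) (fun _ : Fin 1 => v) x
  rw [TensorPower.gMul_def] at h
  simp only [prepend, LinearMap.comp_apply, LinearEquiv.coe_coe, TensorProduct.mk_apply]
  rw [h, TensorPower.cast_tprod]
  congr 1
  funext i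
  refine Fin.cases ?_ (fun j => ?_) i
  · simp [Fin.append, Fin.addCases]
  · simp [Fin.append, Fin.addCases]
    congr 1

lemma tensor_induction {n : ℕ} {P : (⨂[k]^n V) → Prop} (t : ⨂[k]^n V)
    (h0 : P 0) (ht : ∀ x : Fin n → V, P (tprod k x))
    (ha : ∀ a b, P a → P b → P (a + b)) (hs : ∀ (c : k) a, P a → P (c • a)) : P t := by
  have : t ∈ Submodule.span k (Set.range (tprod k (s := fun _ : Fin n => V))) := by
    rw [PiTensorProduct.span_tprod_eq_top]; trivial
  induction this using Submodule.span_induction with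
  | mem x hx => obtain ⟨y, rfl⟩ := hx; exact ht y
  | zero => exact h0
  | add a b _ _ h1 h2 => exact ha _ _ h1 h2
  | smul c a _ h => exact hs _ _ h

lemma prepend_add (m : ℕ) (v w : V) : prepend k V m (v + w) = prepend k V m v + prepend k V m w := by
  apply PiTensorProduct.ext
  ext x
  have := (tprod k (s := fun _ : Fin (m + 1) => V)).cons_add x v w
  simpa [prepend_tprod] using this

lemma prepend_smul (m : ℕ) (c : k) (v : V) : prepend k V m (c • v) = c • prepend k V m v := by
  apply PiTensorProduct.ext
  ext x
  have := (tprod k (s := fun _ : Fin (m + 1) => V)).cons_smul x c v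
  simpa [prepend_tprod] using this

/-- `prepend` as a bilinear map. -/
noncomputable def prep (m : ℕ) : V →ₗ[k] (⨂[k]^m V) →ₗ[k] (⨂[k]^(m+1) V) where
  toFun v := prepend k V m v
  map_add' := prepend_add k V m
  map_smul' := prepend_smul k V m

lemma prep_tprod (m : ℕ) (v : V) (x : Fin m → V) :
    prep k V m v (tprod k x) = tprod k (Fin.cons v x : Fin (m + 1) → V) := prepend_tprod k V m v x

/-- Every statement linear on tensors may be checked on `v ⊗ t`. -/
lemma ext_prep {W : Type} [AddCommGroup W] [Module k W] {n : ℕ} {f g : (⨂[k]^(n+1) V) →ₗ[k] W}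
    (h : ∀ v t, f (prep k V n v t) = g (prep k V n v t)) : f = g := by
  apply PiTensorProduct.ext
  ext x
  have := h (x 0) (tprod k (Fin.tail x))
  rw [prep_tprod, Fin.cons_self_tail] at this
  exact this

/-- Contraction of the first slot with a functional. -/
noncomputable def ctr (n : ℕ) (f : V →ₗ[k] k) : (⨂[k]^(n+1) V) →ₗ[k] (⨂[k]^n V) :=
  PiTensorProduct.lift
    (LinearMap.uncurryLeft (M := fun _ : Fin (n+1) => V)
      (f.smulRight (tprod k (s := fun _ : Fin n => V))))

lemma ctr_prep (n : ℕ) (f : V →ₗ[k] k) (v : V) (t : ⨂[k]^n V) :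
    ctr k V n f (prep k V n v t) = f v • t := by
  have : (ctr k V n f) ∘ₗ (prep k V n v) = f v • LinearMap.id := by
    apply PiTensorProduct.ext
    ext x
    simp only [LinearMap.compMultilinearMap_apply, LinearMap.comp_apply, prep_tprod, ctr,
      PiTensorProduct.lift.tprod, LinearMap.uncurryLeft_apply]
    simp
  exact LinearMap.congr_fun this t

/-- Swap the first two slots. -/
noncomputable def swp (n : ℕ) : (⨂[k]^(n+1+1) V) →ₗ[k] (⨂[k]^(n+1+1) V) :=
  (PiTensorProduct.reindex k (fun _ : Fin (n+1+1) => V) (Equiv.swap 0 1)).toLinearMap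

lemma swp_tprod (n : ℕ) (x : Fin (n+1+1) → V) :
    swp k V n (tprod k x) = tprod k (fun i => x (Equiv.swap 0 1 i)) := by
  simp [swp, PiTensorProduct.reindex_tprod]

lemma swp_prep (n : ℕ) (v w : V) (t : ⨂[k]^n V) :
    swp k V n (prep k V (n+1) v (prep k V n w t)) = prep k V (n+1) w (prep k V n v t) := by
  have : (swp k V n) ∘ₗ (prep k V (n+1) v) ∘ₗ (prep k V n w)
      = (prep k V (n+1) w) ∘ₗ (prep k V n v) := by
    apply PiTensorProduct.ext
    ext x
    simp only [LinearMap.compMultilinearMap_apply, LinearMap.comp_apply, prep_tprod, swp_tprod]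
    congr 1
    funext i
    refine Fin.cases ?_ (fun j => ?_) i
    · simp
    · refine Fin.cases ?_ (fun l => ?_) j
      · simp
      · rw [Equiv.swap_apply_of_ne_of_ne]
        · simp
        · exact Fin.succ_ne_zero _
        · intro h
          exact Fin.succ_ne_zero l (Fin.succ_injective _ h)
  exact LinearMap.congr_fun this t

lemma ctr_swp_prep (n : ℕ) (f : V →ₗ[k] k) (v : V) (T : ⨂[k]^(n+1) V) :
    ctr k V (n+1) f (swp k V n (prep k V (n+1) v T)) = prep k V n v (ctr k V n f T) := by
  have : (ctr k V (n+1) f) ∘ₗ (swp k V n) ∘ₗ (prep k V (n+1) v)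
      = (prep k V n v) ∘ₗ (ctr k V n f) := by
    apply ext_prep
    intro w t
    simp only [LinearMap.comp_apply, swp_prep, ctr_prep, map_smul]
  exact LinearMap.congr_fun this T

lemma sum_prep_ctr {ι : Type} [Fintype ι] (b : Module.Basis ι k V) (n : ℕ) (T : ⨂[k]^(n+1) V) :
    ∑ i, prep k V n (b i) (ctr k V n (b.coord i) T) = T := by
  have : (∑ i, (prep k V n (b i)) ∘ₗ (ctr k V n (b.coord i))) = LinearMap.id := by
    apply ext_prep
    intro w t
    simp only [LinearMap.sum_apply, LinearMap.comp_apply, ctr_prep, map_smul, LinearMap.id_apply]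
    conv_rhs => rw [← b.sum_repr w]
    simp only [map_sum, LinearMap.sum_apply, map_smul, LinearMap.smul_apply, Module.Basis.coord_apply]
  have := LinearMap.congr_fun this T
  simpa using this

/-- Expansion of an alternatization along the first argument. -/
lemma alternatization_uncurryLeft {W : Type} [AddCommGroup W] [Module k W] {n : ℕ}
    (H : V →ₗ[k] MultilinearMap k (fun _ : Fin n => V) W) (x : Fin (n+1) → V) :
    MultilinearMap.alternatization
        (LinearMap.uncurryLeft (M := fun _ : Fin (n+1) => V) H) x
      = ∑ j : Fin (n+1), (-1 : ℤ) ^ (j : ℕ) •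
          MultilinearMap.alternatization (H (x j)) (j.removeNth x) := by
  rw [MultilinearMap.alternatization_apply,
    ← (Equiv.Perm.decomposeFin (n := n)).symm.sum_comp, Fintype.sum_prod_type]
  refine Finset.sum_congr rfl fun p _ => ?_
  refine Fin.cases ?_ (fun i => ?_) p
  · rw [MultilinearMap.alternatization_apply]
    simp only [Fin.val_zero, pow_zero, one_smul]
    refine Finset.sum_congr rfl fun e _ => ?_
    simp [Fin.removeNth, Fin.tail_def]
  · have h1 : (-1 : ℤ) ^ ((i.succ : Fin (n+1)) : ℕ) •
          MultilinearMap.alternatization (H (x i.succ)) (i.succ.removeNth x)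
        = (-1 : ℤ) • MultilinearMap.alternatization (H (x i.succ))
            (fun l => x (Equiv.swap 0 i.succ l.succ)) := by
      have h2 : (fun l => x (Equiv.swap 0 i.succ l.succ))
          = (i.succ.removeNth x) ∘ (i.cycleRange) := by
        funext l
        simp only [Function.comp, Fin.removeNth]
        rw [Fin.succAbove_cycleRange]
      rw [h2, AlternatingMap.map_perm, Fin.sign_cycleRange]
      rw [Fin.val_succ, pow_succ, mul_comm, mul_smul]
      simp [Units.smul_def]
    rw [h1, MultilinearMap.alternatization_apply, Finset.smul_sum]
    refine Finset.sum_congr rfl fun e _ => ?_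
    simp [Fin.tail_def, Units.smul_def, Fin.succ_ne_zero]

/-- `1 ⊗ A` evaluated on an antisymmetrized tensor. -/
noncomputable def oneT {N n : ℕ} (A : V [⋀^Fin N]→ₗ[k] (⨂[k]^n V)) (x : Fin (N+1) → V) :
    ⨂[k]^(n+1) V :=
  ∑ j : Fin (N+1), (-1 : ℤ) ^ (j : ℕ) • prep k V n (x j) (A (j.removeNth x))

/-- Prepend the first argument to a tensor-valued multilinear map. -/
noncomputable def consM {N n : ℕ} (G : MultilinearMap k (fun _ : Fin N => V) (⨂[k]^n V)) :
    MultilinearMap k (fun _ : Fin (N+1) => V) (⨂[k]^(n+1) V) :=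
  LinearMap.uncurryLeft (M := fun _ : Fin (N+1) => V)
    { toFun := fun v => (prep k V n v).compMultilinearMap G
      map_add' := by intro v w; ext x; simp
      map_smul' := by intro c w; ext x; simp }

lemma consM_apply {N n : ℕ} (G : MultilinearMap k (fun _ : Fin N => V) (⨂[k]^n V))
    (x : Fin (N+1) → V) : consM k V G x = prep k V n (x 0) (G (Fin.tail x)) := rfl

lemma alt_consM {N n : ℕ} (G : MultilinearMap k (fun _ : Fin N => V) (⨂[k]^n V))
    (x : Fin (N+1) → V) :
    MultilinearMap.alternatization (consM k V G) x
      = oneT k V (MultilinearMap.alternatization G) x := by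
  rw [consM, alternatization_uncurryLeft, oneT]
  refine Finset.sum_congr rfl fun j _ => ?_
  congr 1
  change MultilinearMap.alternatization ((prep k V n (x j)).compMultilinearMap G) _ = _
  rw [LinearMap.compMultilinearMap_alternatization]
  rfl

/-- `Φ` tensored with identities, before antisymmetrization. -/
noncomputable def GG {s : ℕ} (Φ : V [⋀^Fin s]→ₗ[k] k) :
    ∀ n : ℕ, MultilinearMap k (fun _ : Fin (s + n) => V) (⨂[k]^n V)
  | 0 => (LinearMap.toSpanSingleton k (⨂[k]^0 V) (tprod k Fin.elim0)).compMultilinearMap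
      Φ.toMultilinearMap
  | n + 1 => consM k V (GG Φ n)

lemma GG_apply {s : ℕ} (Φ : V [⋀^Fin s]→ₗ[k] k) (n : ℕ) (x : Fin (s + n) → V) :
    GG k V Φ n x = Φ (fun i => x ⟨n + i, by omega⟩) • tprod k (fun i : Fin n => x ⟨i, by omega⟩) := by
  induction n with
  | zero =>
    simp only [GG, LinearMap.compMultilinearMap_apply, LinearMap.toSpanSingleton_apply]
    congr 1
    · change Φ x = _
      congr 1
      funext i
      congr 1
      ext
      simp
    · congr 1
      funext i
      exact i.elim0
  | succ n ih =>
    change consM k V (GG k V Φ n) x = _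
    rw [consM_apply, ih, map_smul, prep_tprod]
    congr 1
    · congr 1
      funext i
      simp only [Fin.tail]
      congr 1
      ext
      simp
      omega
    · congr 1
      funext i
      refine Fin.cases ?_ (fun j => ?_) i
      · rfl
      · rfl

lemma asymN_eq (n : ℕ) (x : ℕ → V) :
    asymN k V n x = MultilinearMap.alternatization (tprod k (s := fun _ : Fin n => V))
      (fun i => x i) := by
  rw [MultilinearMap.alternatization_apply, asymN]
  rfl

/-- Extend a finite tuple by zero. -/
def extd {n : ℕ} (x : Fin n → V) : ℕ → V := fun i => if h : i < n then x ⟨i, h⟩ else 0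

lemma extd_fin {n : ℕ} (x : Fin n → V) : (fun i : Fin n => extd V x i) = x := by
  funext i; simp [extd]

lemma alt_mem (n : ℕ) (x : Fin n → V) :
    MultilinearMap.alternatization (tprod k (s := fun _ : Fin n => V)) x ∈ wedgeIm k V n := by
  have := asymN_eq k V n (extd V x)
  rw [extd_fin] at this
  rw [← this]
  exact Submodule.subset_span ⟨_, rfl⟩

lemma tprod_succ (n : ℕ) : (tprod k (s := fun _ : Fin (n+1) => V))
    = consM k V (tprod k (s := fun _ : Fin n => V)) := by
  ext x
  rw [consM_apply, prep_tprod, Fin.cons_self_tail]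

lemma ctr_mem (n : ℕ) (f : V →ₗ[k] k) (T : ⨂[k]^(n+1) V) (hT : T ∈ wedgeIm k V (n+1)) :
    ctr k V n f T ∈ wedgeIm k V n := by
  induction hT using Submodule.span_induction with
  | mem t ht =>
    obtain ⟨x, rfl⟩ := ht
    rw [asymN_eq, tprod_succ, alt_consM, oneT, map_sum]
    refine Submodule.sum_mem _ fun j _ => ?_
    rw [map_zsmul, ctr_prep]
    exact zsmul_mem (Submodule.smul_mem _ _ (alt_mem k V n _)) _
  | zero => simp
  | add a b _ _ h1 h2 => rw [map_add]; exact Submodule.add_mem _ h1 h2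
  | smul c a _ h => rw [map_smul]; exact Submodule.smul_mem _ _ h

lemma swp_mem (n : ℕ) (T : ⨂[k]^(n+1+1) V) (hT : T ∈ wedgeIm k V (n+1+1)) :
    swp k V n T = -T := by
  induction hT using Submodule.span_induction with
  | mem t ht =>
    obtain ⟨x, rfl⟩ := ht
    have hne : (0 : Fin (n+1+1)) ≠ 1 := by
      intro h; exact absurd (congrArg Fin.val h) (by simp)
    rw [asymN, map_sum, ← Equiv.sum_comp (Equiv.mulRight (Equiv.swap (0 : Fin (n+1+1)) 1)),
      ← Finset.sum_neg_distrib]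
    refine Finset.sum_congr rfl fun σ _ => ?_
    rw [map_zsmul, swp_tprod]
    simp [Equiv.Perm.sign_mul, Equiv.Perm.sign_swap hne]
  | zero => simp
  | add a b _ _ h1 h2 => rw [map_add, h1, h2]; abel
  | smul c a _ h => rw [map_smul, h, smul_neg]

lemma alt_GG_mem {s : ℕ} (Φ : V [⋀^Fin s]→ₗ[k] k) (n : ℕ) (x : Fin (s + n) → V) :
    MultilinearMap.alternatization (GG k V Φ n) x ∈ wedgeIm k V n := by
  have key : ∀ π : Equiv.Perm (Fin n), MultilinearMap.alternatization (GG k V Φ n) x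
      = ∑ τ : Equiv.Perm (Fin (s+n)), (Equiv.Perm.sign τ : ℤ) •
        Φ (fun i => x (τ ⟨n + i, by omega⟩)) • ((Equiv.Perm.sign π : ℤ) •
          tprod k (fun i : Fin n => x (τ (Fin.castLE (by omega) (π i))))) := by
    intro π
    have hle : n ≤ s + n := by omega
    let f : Fin n ↪ Fin (s + n) := (Fin.castLEEmb hle)
    let e : Equiv.Perm (Fin (s+n)) := π.viaFintypeEmbedding f
    rw [MultilinearMap.alternatization_apply, ← Equiv.sum_comp (Equiv.mulRight e)]
    refine Finset.sum_congr rfl fun τ _ => ?_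
    have hsig : Equiv.Perm.sign e = Equiv.Perm.sign π := Equiv.Perm.viaFintypeEmbedding_sign _ _
    have he1 : ∀ i : Fin n, e ⟨i, by omega⟩ = Fin.castLE hle (π i) := fun i =>
      Equiv.Perm.viaFintypeEmbedding_apply_image π f i
    have he2 : ∀ i : Fin s, e ⟨n + i, by omega⟩ = ⟨n + i, by omega⟩ := fun i => by
      apply Equiv.Perm.viaFintypeEmbedding_apply_notMem_range
      rintro ⟨j, hj⟩
      have := congrArg Fin.val hj
      simp [f] at this
      omega
    rw [MultilinearMap.domDomCongr_apply, GG_apply]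
    simp only [Equiv.coe_mulRight, Equiv.Perm.mul_apply, he1, he2, Equiv.Perm.sign_mul, hsig]
    rw [smul_comm (Φ _) (_ : ℤ), smul_smul, Units.smul_def, Units.val_mul]
  have hsum : (Fintype.card (Equiv.Perm (Fin n))) •
      MultilinearMap.alternatization (GG k V Φ n) x
      = ∑ τ : Equiv.Perm (Fin (s+n)), (Equiv.Perm.sign τ : ℤ) •
        Φ (fun i => x (τ ⟨n + i, by omega⟩)) •
          MultilinearMap.alternatization (tprod k (s := fun _ : Fin n => V))
            (fun i : Fin n => x (τ (Fin.castLE (by omega) i))) := by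
    rw [← Finset.card_univ, ← Finset.sum_const, Finset.sum_congr rfl (fun π _ => key π),
      Finset.sum_comm]
    refine Finset.sum_congr rfl fun τ _ => ?_
    rw [MultilinearMap.alternatization_apply, Finset.smul_sum, zs_sum]
    rfl
  have hmem : (Fintype.card (Equiv.Perm (Fin n))) •
      MultilinearMap.alternatization (GG k V Φ n) x ∈ wedgeIm k V n := by
    rw [hsum]
    exact Submodule.sum_mem _ fun τ _ =>
      zsmul_mem (Submodule.smul_mem _ _ (alt_mem k V n _)) _
  rw [← Nat.cast_smul_eq_nsmul k] at hmem
  exact (Submodule.smul_mem_iff _ (by simp [Fintype.card_ne_zero])).1 hmem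

/-- Expansion of `oneT` along the first argument. -/
lemma oneT_cons {N n : ℕ} (A : V [⋀^Fin (N+1)]→ₗ[k] (⨂[k]^n V)) (v : V) (x : Fin (N+1) → V) :
    oneT k V A (Fin.cons v x : Fin (N+1+1) → V) = prep k V n v (A x)
      - ∑ j : Fin (N+1), (-1 : ℤ) ^ (j : ℕ) •
        prep k V n (x j) (A (Fin.cons v (j.removeNth x) : Fin (N+1) → V)) := by
  rw [oneT, Fin.sum_univ_succ, sub_eq_add_neg, ← Finset.sum_neg_distrib]
  congr 1
  · simp [Fin.removeNth]
  · refine Finset.sum_congr rfl fun j _ => ?_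
    have : (j.succ.removeNth (Fin.cons v x : Fin (N+1+1) → V))
        = (Fin.cons v (j.removeNth x) : Fin (N+1) → V) := by
      funext i
      refine Fin.cases ?_ (fun l => ?_) i
      · simp [Fin.removeNth]
      · simp [Fin.removeNth]
    rw [this, Fin.cons_succ, Fin.val_succ, pow_succ]
    simp

lemma A_cons {N n : ℕ} (A : V [⋀^Fin (N+1)]→ₗ[k] (⨂[k]^n V)) (x : Fin (N+1) → V)
    (j : Fin (N+1)) : (-1 : ℤ) ^ (j : ℕ) • A (Fin.cons (x j) (j.removeNth x) : Fin (N+1) → V) = A x := by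
  have := A.map_insertNth j (x j) (j.removeNth x)
  rw [Fin.insertNth_self_removeNth] at this
  rw [this]
  rfl

lemma trace_one {ι : Type} [Fintype ι] (b : Module.Basis ι k V) {N n : ℕ}
    (A : V [⋀^Fin (N+1)]→ₗ[k] (⨂[k]^n V)) (x : Fin (N+1) → V) :
    ∑ i, ctr k V n (b.coord i) (oneT k V A (Fin.cons (b i) x : Fin (N+1+1) → V))
      = ((Fintype.card ι : k) - (N + 1 : ℕ)) • A x := by
  simp only [oneT_cons, map_sub, map_sum, map_zsmul, ctr_prep, Finset.sum_sub_distrib, sub_smul]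
  congr 1
  · simp [Module.Basis.coord_apply, Nat.cast_smul_eq_nsmul]
  · rw [Finset.sum_comm]
    have : ∀ j : Fin (N+1), ∑ i, (-1 : ℤ) ^ (j : ℕ) • (b.coord i (x j)) •
        A (Fin.cons (b i) (j.removeNth x) : Fin (N+1) → V) = A x := by
      intro j
      rw [← A_cons k V A x j, ← zs_sum]
      congr 1
      have h := congrArg (fun v => A.curryLeft v (j.removeNth x)) (b.sum_repr (x j))
      simp only [map_sum, map_smul, altsum_apply, AlternatingMap.smul_apply] at h
      exact h
    rw [Finset.sum_congr rfl fun j _ => this j]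
    rw [Finset.sum_const, Nat.cast_smul_eq_nsmul]
    simp

/-- Partial trace of `A`. -/
noncomputable def ptr {ι : Type} [Fintype ι] (b : Module.Basis ι k V) {N n : ℕ}
    (A : V [⋀^Fin (N+1)]→ₗ[k] (⨂[k]^(n+1) V)) : V [⋀^Fin N]→ₗ[k] (⨂[k]^n V) :=
  ∑ i, (ctr k V n (b.coord i)).compAlternatingMap (A.curryLeft (b i))

lemma ptr_apply {ι : Type} [Fintype ι] (b : Module.Basis ι k V) {N n : ℕ}
    (A : V [⋀^Fin (N+1)]→ₗ[k] (⨂[k]^(n+1) V)) (x : Fin N → V) :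
    ptr k V b A x = ∑ i, ctr k V n (b.coord i) (A (Fin.cons (b i) x : Fin (N+1) → V)) := by
  simp only [ptr, altsum_apply]
  rfl

lemma trace_two {ι : Type} [Fintype ι] (b : Module.Basis ι k V) {N n : ℕ}
    (A : V [⋀^Fin (N+1)]→ₗ[k] (⨂[k]^(n+1) V)) (x : Fin (N+1) → V) :
    ∑ i, ctr k V (n+1) (b.coord i)
        (swp k V n (oneT k V A (Fin.cons (b i) x : Fin (N+1+1) → V)))
      = A x - oneT k V (ptr k V b A) x := by
  simp only [oneT_cons, map_sub, map_sum, map_zsmul, ctr_swp_prep, Finset.sum_sub_distrib,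
    sum_prep_ctr]
  congr 1
  rw [Finset.sum_comm, oneT]
  refine Finset.sum_congr rfl fun j _ => ?_
  rw [ptr_apply, map_sum, zs_sum]

lemma GG_smul {s : ℕ} (c : k) (Φ : V [⋀^Fin s]→ₗ[k] k) (n : ℕ) (x : Fin (s+n) → V) :
    MultilinearMap.alternatization (GG k V (c • Φ) n) x
      = c • MultilinearMap.alternatization (GG k V Φ n) x := by
  simp only [MultilinearMap.alternatization_apply, MultilinearMap.domDomCongr_apply, GG_apply,
    Finset.smul_sum, AlternatingMap.smul_apply]
  refine Finset.sum_congr rfl fun τ _ => ?_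
  rw [smul_assoc, smul_comm c (Equiv.Perm.sign τ)]

lemma oneT_smul_of {N n : ℕ} (A B : V [⋀^Fin N]→ₗ[k] (⨂[k]^n V)) (h : ∀ x, A x = B x)
    (x : Fin (N+1) → V) : oneT k V A x = oneT k V B x := by
  simp only [oneT, h]

lemma main_ind [FiniteDimensional k V] (s n : ℕ) (hdim : s + n < Module.finrank k V)
    (A : V [⋀^Fin (s+n)]→ₗ[k] (⨂[k]^n V))
    (hA : ∀ x, oneT k V A x ∈ wedgeIm k V (n+1)) :
    ∃ Φ : V [⋀^Fin s]→ₗ[k] k, ∀ x, A x = MultilinearMap.alternatization (GG k V Φ n) x := by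
  induction n with
  | zero =>
    let E : (⨂[k]^0 V) ≃ₗ[k] k := PiTensorProduct.isEmptyEquiv (Fin 0)
    let Ψ : V [⋀^Fin s]→ₗ[k] k := E.toLinearMap.compAlternatingMap A
    refine ⟨((s.factorial : k)⁻¹) • Ψ, fun x => ?_⟩
    rw [GG_smul]
    change _ = _ • MultilinearMap.alternatization ((LinearMap.toSpanSingleton k (⨂[k]^0 V)
      (tprod k Fin.elim0)).compMultilinearMap Ψ.toMultilinearMap) x
    rw [LinearMap.compMultilinearMap_alternatization]
    have h1 : MultilinearMap.alternatization Ψ.toMultilinearMap = s.factorial • Ψ := by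
      have := AlternatingMap.coe_alternatization Ψ
      rwa [Fintype.card_fin] at this
    rw [LinearMap.compAlternatingMap_apply, h1, AlternatingMap.smul_apply, map_nsmul,
      ← Nat.cast_smul_eq_nsmul k, smul_smul,
      inv_mul_cancel₀ (Nat.cast_ne_zero.2 s.factorial_ne_zero), one_smul,
      LinearMap.toSpanSingleton_apply]
    apply E.injective
    rw [map_smul]
    have : E (tprod k Fin.elim0) = 1 := PiTensorProduct.isEmptyEquiv_apply_tprod _ _
    rw [this]
    simp [Ψ]
  | succ n ih =>
    let b := Module.finBasis k V
    set d := Module.finrank k V with hd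
    have hAx : ∀ x : Fin (s+n+1) → V, A x ∈ wedgeIm k V (n+1) := by
      intro x
      have h := trace_one k V b (N := s+n) A x
      have hc : ((Fintype.card (Fin d) : k) - (s + n + 1 : ℕ)) ≠ 0 := by
        rw [Fintype.card_fin, sub_ne_zero]
        intro h; have := Nat.cast_injective h; omega
      rw [← Submodule.smul_mem_iff _ hc, ← h]
      exact Submodule.sum_mem _ fun i _ => ctr_mem k V _ _ _ (hA _)
    have h2 : ∀ x : Fin (s+n+1) → V, ((d - (s+n) : ℕ) : k) • A x = oneT k V (ptr k V b (N := s+n) A) x := by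
      intro x
      have h := trace_one k V b (N := s+n) A x
      have h' := trace_two k V b (N := s+n) A x
      rw [Finset.sum_congr rfl (fun i _ => by rw [swp_mem k V n _ (hA _), map_neg]),
        Finset.sum_neg_distrib, h, Fintype.card_fin] at h'
      have h3 : oneT k V (ptr k V b (N := s+n) A) x = A x + ((d : k) - (s+n+1 : ℕ)) • A x := by
        rw [eq_sub_iff_add_eq] at h'
        have h'' := h'
        rw [neg_add_eq_iff_eq_add] at h''
        exact h''.trans (add_comm _ _)
      rw [h3, Nat.cast_sub (by omega)]
      push_cast
      module
    have hc : ((d - (s+n) : ℕ) : k) ≠ 0 := Nat.cast_ne_zero.2 (by omega)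
    obtain ⟨Φ, hΦ⟩ := ih (by omega) (ptr k V b (N := s+n) A) (fun x => by
      rw [← h2]; exact Submodule.smul_mem _ _ (hAx x))
    refine ⟨((d - (s+n) : ℕ) : k)⁻¹ • Φ, fun x => ?_⟩
    rw [GG_smul, eq_inv_smul_iff₀ hc]
    refine (h2 x).trans ?_
    rw [oneT_smul_of k V _ _ hΦ]
    exact (alt_consM k V (GG k V Φ n) x).symm

/-- The alternating map attached to `α`. -/
noncomputable def altOf (m s : ℕ) (α : wedgeIm k V (m + s) →ₗ[k] ⨂[k]^m V) :
    V [⋀^Fin (s+m)]→ₗ[k] (⨂[k]^m V) :=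
  (α.compAlternatingMap
    ((MultilinearMap.alternatization (tprod k (s := fun _ : Fin (m+s) => V))).codRestrict
      (wedgeIm k V (m+s)) (alt_mem k V (m+s)))).domDomCongr (finCongr (Nat.add_comm m s))

lemma altOf_apply (m s : ℕ) (α : wedgeIm k V (m + s) →ₗ[k] ⨂[k]^m V) (x : ℕ → V) :
    altOf k V m s α (fun i => x i) = α (wdgN k V (m+s) x) := by
  simp only [altOf, AlternatingMap.domDomCongr_apply, LinearMap.compAlternatingMap_apply]
  congr 1
  apply Subtype.ext
  change _ = asymN k V (m+s) x
  rw [asymN_eq]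
  rfl

lemma oneTA_eq (m s : ℕ) (α : wedgeIm k V (m + s) →ₗ[k] ⨂[k]^m V) (x : ℕ → V) :
    oneTA k V m s α x = oneT k V (altOf k V m s α) (fun i => x i) := by
  have hr : Finset.range (m + s + 1) = Finset.range (s + m + 1) := by rw [Nat.add_comm m s]
  rw [oneTA, oneT, hr, Finset.sum_range]
  refine Finset.sum_congr rfl fun j _ => ?_
  rw [← altOf_apply]
  congr 3
  congr 1
  funext i
  simp only [Fin.removeNth, removeN, Fin.succAbove, Fin.lt_def]
  split_ifs <;> simp_all <;> omega

lemma rhs_eq (m s : ℕ) (Φ : V [⋀^Fin s]→ₗ[k] k) (x : ℕ → V) :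
    ∑ σ : Equiv.Perm (Fin (m + s)), (Equiv.Perm.sign σ : ℤ) •
            Φ (fun i : Fin s => permt V σ x (m + i)) • tpN k V m (permt V σ x)
      = MultilinearMap.alternatization (GG k V Φ m) (fun i => x i) := by
  rw [MultilinearMap.alternatization_apply,
    ← (Equiv.permCongr (finCongr (Nat.add_comm m s))).sum_comp]
  refine Finset.sum_congr rfl fun σ _ => ?_
  rw [Equiv.Perm.sign_permCongr, MultilinearMap.domDomCongr_apply, GG_apply, Units.smul_def]
  congr 2
  · congr 1
    funext i
    simp [permt]
  · rw [tpN]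
    congr 1
    funext i
    have : (i : ℕ) < m + s := by omega
    simp [permt, this]

end helpers

/-- Let `V` be a vector space over a field of characteristic zero with
`dim V ≥ N + 2`, and embed `∧^n V ⊆ V^{⊗n}` via total antisymmetrization.  Let
`α : ∧^N V → V^{⊗(N-s)}` be a linear map (we write `m = N - s`, so `N = m + s`).  Then the
image of the composite `∧^{N+1} V ↪ V ⊗ ∧^N V → V^{⊗(N+1-s)}` (given by `𝟙 ⊗ α`) is
contained in `∧^{N+1-s} V` if and only if `α = 𝟙^{⊗(N-s)} ⊗ Φ` for some alternating form
`Φ : ∧^s V → k`. -/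
theorem stmt2 [FiniteDimensional k V] (m s : ℕ)
    (hdim : m + s + 2 ≤ Module.finrank k V)
    (α : wedgeIm k V (m + s) →ₗ[k] ⨂[k]^m V) :
    (∀ x : ℕ → V, oneTA k V m s α x ∈ wedgeIm k V (m + 1)) ↔
      ∃ Φ : AlternatingMap k V k (Fin s), ∀ x : ℕ → V,
        α (wdgN k V (m + s) x) =
          ∑ σ : Equiv.Perm (Fin (m + s)), (Equiv.Perm.sign σ : ℤ) •
            Φ (fun i : Fin s => permt V σ x (m + i)) • tpN k V m (permt V σ x) := by
  have e1 : ∀ y : Fin (s + m) → V, ∃ x : ℕ → V, (fun i : Fin (s+m) => x i) = y :=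
    fun y => ⟨extd V y, extd_fin V y⟩
  constructor
  · intro h
    obtain ⟨Φ, hΦ⟩ := main_ind k V s m (by omega) (altOf k V m s α) (fun y => by
      have := h (extd V y)
      rwa [oneTA_eq, extd_fin] at this)
    refine ⟨Φ, fun x => ?_⟩
    rw [rhs_eq, ← hΦ, altOf_apply]
  · rintro ⟨Φ, hΦ⟩ x
    rw [oneTA_eq]
    have h : ∀ y, altOf k V m s α y = MultilinearMap.alternatization (GG k V Φ m) y := by
      intro y
      obtain ⟨z, rfl⟩ := e1 y
      rw [altOf_apply, hΦ, rhs_eq]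
    rw [oneT_smul_of k V _ _ h, ← alt_consM]
    exact alt_GG_mem k V Φ (m+1) _

end PBW2
end

section
/- Let $V$ be a vector space over a field of characteristic zero with $\dim V = v$. Consider the map from $\mathrm{Hom}(\wedge^N V, V^{\otimes N-s})$ to $\mathrm{Hom}(\wedge^{N+1} V, V^{\otimes N+1-s})$ sending $\alpha \mapsto \mathbf{1} \otimes \alpha + (-1)^s \cdot \alpha \otimes \mathbf{1}$ (with exterior powers embedded in tensor powers by antisymmetrization). If either $v \geq N+2$, or $v = N+1$ and $N - s$ is even, then this map is injective. -/
open scoped TensorProduct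
open PiTensorProduct

namespace PBW3


variable (k V : Type) [Field k] [CharZero k] [AddCommGroup V] [Module k V]

/-- The pure tensor `x 0 ⊗ ⋯ ⊗ x (n-1)` in `V^{⊗n}`. -/
noncomputable def tpN (n : ℕ) (x : ℕ → V) : ⨂[k]^n V := tprod k fun i : Fin n => x i

/-- The total antisymmetrization `∑_{σ ∈ S_n} sgn σ • x_{σ(0)} ⊗ ⋯ ⊗ x_{σ(n-1)}`,
the image of `x 0 ∧ ⋯ ∧ x (n-1)` under the embedding `∧ⁿ V ⊆ V^{⊗n}`. -/
noncomputable def asymN (n : ℕ) (x : ℕ → V) : ⨂[k]^n V :=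
  ∑ σ : Equiv.Perm (Fin n), (Equiv.Perm.sign σ : ℤ) • tprod k (fun i : Fin n => x (σ i))

/-- The image of `∧ⁿ V` in `V^{⊗n}` under total antisymmetrization. -/
noncomputable def wedgeIm (n : ℕ) : Submodule k (⨂[k]^n V) :=
  Submodule.span k (Set.range (asymN k V n))

/-- `x 0 ∧ ⋯ ∧ x (n-1)` as an element of the subspace `∧ⁿ V ⊆ V^{⊗n}`. -/
noncomputable def wdgN (n : ℕ) (x : ℕ → V) : wedgeIm k V n :=
  ⟨asymN k V n x, Submodule.subset_span ⟨x, rfl⟩⟩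

/-- Permute the first `n` entries of the sequence `x` by `σ`. -/
def permt {n : ℕ} (σ : Equiv.Perm (Fin n)) (x : ℕ → V) : ℕ → V :=
  fun m => if h : m < n then x (σ ⟨m, h⟩) else x m

/-- Remove the `j`-th entry of the sequence `x`. -/
def removeN (j : ℕ) (x : ℕ → V) : ℕ → V := fun m => if m < j then x m else x (m + 1)

/-- Prepend the entry `v` at the front of the sequence `x`. -/
def consT (v : V) (x : ℕ → V) : ℕ → V := fun m => if m = 0 then v else x (m - 1)

/-- Replace the `p`-th entry of the sequence `x` by `v`. -/
def putAt (p : ℕ) (x : ℕ → V) (v : V) : ℕ → V := fun m => if m = p then v else x m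


/-- The map `V^{⊗m} → V^{⊗(m+1)}`, `t ↦ v ⊗ t`. -/
noncomputable def prepend (m : ℕ) (v : V) : ⨂[k]^m V →ₗ[k] ⨂[k]^(m+1) V :=
  (TensorPower.cast k V (Nat.add_comm 1 m)).toLinearMap ∘ₗ
    (TensorPower.mulEquiv (R := k) (M := V) (n := 1) (m := m)).toLinearMap ∘ₗ
      TensorProduct.mk k (⨂[k]^1 V) (⨂[k]^m V) (tprod k fun _ : Fin 1 => v)

/-- The map `V^{⊗m} → V^{⊗(m+1)}`, `t ↦ t ⊗ v`. -/
noncomputable def append (m : ℕ) (v : V) : ⨂[k]^m V →ₗ[k] ⨂[k]^(m+1) V :=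
  (TensorPower.mulEquiv (R := k) (M := V) (n := m) (m := 1)).toLinearMap ∘ₗ
    (TensorProduct.mk k (⨂[k]^m V) (⨂[k]^1 V)).flip (tprod k fun _ : Fin 1 => v)


/-- `(𝟙 ⊗ α)` applied to the antisymmetrization of `x_0, …, x_{m+s}`, via the expansion
`∧^{N+1} V ⊆ V ⊗ ∧^N V` (where `N = m + s` and `α : ∧^N V → V^{⊗m}`). -/
noncomputable def oneTA (m s : ℕ) (α : wedgeIm k V (m + s) →ₗ[k] ⨂[k]^m V) (x : ℕ → V) :
    ⨂[k]^(m+1) V :=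
  ∑ j ∈ Finset.range (m + s + 1),
    ((-1 : ℤ) ^ j) • prepend k V m (x j) (α (wdgN k V (m + s) (removeN V j x)))

/-- `(α ⊗ 𝟙)` applied to the antisymmetrization of `x_0, …, x_{m+s}`, via the expansion
`∧^{N+1} V ⊆ ∧^N V ⊗ V`. -/
noncomputable def taOne (m s : ℕ) (α : wedgeIm k V (m + s) →ₗ[k] ⨂[k]^m V) (x : ℕ → V) :
    ⨂[k]^(m+1) V :=
  ∑ j ∈ Finset.range (m + s + 1),
    ((-1 : ℤ) ^ (m + s - j)) • append k V m (x j) (α (wdgN k V (m + s) (removeN V j x)))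

section helpers

set_option linter.unusedSectionVars false

variable {k V}

/-- Wedge product of a functional with an alternating form. -/
noncomputable def fw {n : ℕ} (a : V →ₗ[k] k) (η : V [⋀^Fin n]→ₗ[k] k) : V [⋀^Fin (n+1)]→ₗ[k] k :=
  AlternatingMap.alternatizeUncurryFin (LinearMap.smulRight a η)

theorem fw_apply {n : ℕ} (a : V →ₗ[k] k) (η : V [⋀^Fin n]→ₗ[k] k) (x : Fin (n+1) → V) :
    fw a η x = ∑ i : Fin (n+1), (-1) ^ (i : ℕ) * (a (x i) * η (i.removeNth x)) := by
  simp [fw, AlternatingMap.alternatizeUncurryFin_apply, zsmul_eq_mul]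

theorem fw_smul {n : ℕ} (a : V →ₗ[k] k) (c : k) (η : V [⋀^Fin n]→ₗ[k] k) :
    fw a (c • η) = c • fw a η := by
  ext x
  simp only [fw_apply, AlternatingMap.smul_apply, smul_eq_mul, Finset.mul_sum]
  refine Finset.sum_congr rfl fun i _ => by ring

theorem fw_sub {n : ℕ} (a : V →ₗ[k] k) (η ζ : V [⋀^Fin n]→ₗ[k] k) :
    fw a (η - ζ) = fw a η - fw a ζ := by
  ext x
  simp only [fw_apply, AlternatingMap.sub_apply, ← Finset.sum_sub_distrib]
  refine Finset.sum_congr rfl fun i _ => by ring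

theorem fw_swap {n : ℕ} (a b : V →ₗ[k] k) (η : V [⋀^Fin n]→ₗ[k] k) :
    fw a (fw b η) = - fw b (fw a η) := by
  have key := AlternatingMap.alternatizeUncurryFin_alternatizeUncurryFinLM_comp_of_symmetric
    (f := LinearMap.smulRight a (LinearMap.smulRight b η) +
      LinearMap.smulRight b (LinearMap.smulRight a η)) (by
        intro x y
        ext v
        simp
        ring)
  rw [eq_neg_iff_add_eq_zero, ← key]
  ext x
  simp only [fw_apply, AlternatingMap.add_apply, AlternatingMap.alternatizeUncurryFin_apply]
  rw [← Finset.sum_add_distrib]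
  refine Finset.sum_congr rfl fun i _ => ?_
  simp [fw_apply, AlternatingMap.alternatizeUncurryFin_apply, zsmul_eq_mul, Finset.mul_sum,
    Finset.sum_add_distrib, mul_add]

theorem eq_zero_of_fw [FiniteDimensional k V] {n : ℕ} (hn : n + 1 ≤ Module.finrank k V)
    (η : V [⋀^Fin n]→ₗ[k] k) (h : ∀ a : V →ₗ[k] k, fw a η = 0) : η = 0 := by
  classical
  let b := Module.finBasis k V
  refine b.ext_alternating fun f hf => ?_
  obtain ⟨p, hp⟩ : ∃ p, p ∉ Set.range f := by
    by_contra hcon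
    push Not at hcon
    have hs : Function.Surjective f := hcon
    have := Fintype.card_le_of_surjective f hs
    simp at this
    omega
  have h1 := DFunLike.congr_fun (h (b.coord p)) (Fin.cons (b p) (fun i => b (f i)))
  rw [fw_apply, Fin.sum_univ_succ] at h1
  simp only [Fin.cons_zero, Fin.cons_succ] at h1
  rw [Finset.sum_eq_zero] at h1
  · have h2 : (Fin.removeNth (0 : Fin (n+1)) (Fin.cons (b p) (fun i => b (f i)) : Fin (n+1) → V))
        = fun i => b (f i) := by
      ext i; simp [Fin.removeNth]
    rw [h2] at h1
    simpa using h1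
  · intro i _
    have : f i ≠ p := fun hh => hp ⟨i, hh⟩
    simp [Finsupp.single_apply, this]

/-- Evaluation of a word of functionals on a tensor. -/
noncomputable def ev {m : ℕ} (φ : Fin m → (V →ₗ[k] k)) : ⨂[k]^m V →ₗ[k] k :=
  lift ((MultilinearMap.mkPiAlgebra k (Fin m) k).compLinearMap φ)

theorem ev_tprod {m : ℕ} (φ : Fin m → (V →ₗ[k] k)) (x : Fin m → V) :
    ev φ (tprod k x) = ∏ i, φ i (x i) := by
  simp [ev]

theorem ev_sep [FiniteDimensional k V] {m : ℕ} (t : ⨂[k]^m V)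
    (h : ∀ φ : Fin m → (V →ₗ[k] k), ev φ t = 0) : t = 0 := by
  let b := Module.finBasis k V
  let B := Basis.piTensorProduct (R := k) (fun _ : Fin m => b)
  refine B.ext_elem fun w => ?_
  have hB : B.coord w = ev (fun i => b.coord (w i)) := by
    refine PiTensorProduct.ext ?_
    ext x
    simp only [LinearMap.compMultilinearMap_apply, ev_tprod]
    simp [B, Basis.piTensorProduct_repr_tprod_apply]
  have := h (fun i => b.coord (w i))
  rw [← hB] at this
  simpa using this

theorem prepend_tprod (m : ℕ) (v : V) (x : Fin m → V) :
    prepend k V m v (tprod k x) = tprod k (Fin.cons v x : Fin (m+1) → V) := by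
  have := TensorPower.tprod_mul_tprod k (fun _ : Fin 1 => v) x
  rw [TensorPower.gMul_def] at this
  simp only [prepend, LinearMap.comp_apply, TensorProduct.mk_apply, LinearEquiv.coe_coe]
  rw [this, TensorPower.cast_tprod]
  congr 1
  rw [Fin.append_left_eq_cons]
  ext i
  simp [Function.comp_def]

theorem append_tprod (m : ℕ) (v : V) (x : Fin m → V) :
    append k V m v (tprod k x) = tprod k (Fin.snoc x v : Fin (m+1) → V) := by
  have := TensorPower.tprod_mul_tprod k x (fun _ : Fin 1 => v)
  rw [TensorPower.gMul_def] at this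
  simp only [append, LinearMap.comp_apply, TensorProduct.mk_apply, LinearEquiv.coe_coe,
    LinearMap.flip_apply]
  rw [this]
  congr 1
  rw [Fin.append_right_eq_snoc]

theorem ev_prepend {m : ℕ} (φ : Fin (m+1) → (V →ₗ[k] k)) (v : V) (t : ⨂[k]^m V) :
    ev φ (prepend k V m v t) = φ 0 v * ev (fun i => φ i.succ) t := by
  have : ev φ ∘ₗ prepend k V m v = φ 0 v • ev (fun i => φ i.succ) := by
    refine PiTensorProduct.ext ?_
    ext x
    simp [prepend_tprod, ev_tprod, Fin.prod_univ_succ]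
  simpa using LinearMap.congr_fun this t

theorem ev_append {m : ℕ} (φ : Fin (m+1) → (V →ₗ[k] k)) (v : V) (t : ⨂[k]^m V) :
    ev φ (append k V m v t) = φ (Fin.last m) v * ev (fun i => φ i.castSucc) t := by
  have : ev φ ∘ₗ append k V m v = φ (Fin.last m) v • ev (fun i => φ i.castSucc) := by
    refine PiTensorProduct.ext ?_
    ext x
    simp [append_tprod, ev_tprod, Fin.prod_univ_castSucc, mul_comm]
  simpa using LinearMap.congr_fun this t

theorem asymN_eq (n : ℕ) (x : ℕ → V) :
    asymN k V n x = MultilinearMap.alternatization (tprod k) (fun i : Fin n => x i) := by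
  simp [asymN, MultilinearMap.alternatization_apply, Units.smul_def]

/-- The antisymmetrization as an alternating map. -/
noncomputable def altT (n : ℕ) : V [⋀^Fin n]→ₗ[k] (⨂[k]^n V) :=
  MultilinearMap.alternatization (tprod k)

theorem alt_mem (n : ℕ) (x : Fin n → V) :
    altT (k := k) n x ∈ wedgeIm k V n := by
  refine Submodule.subset_span ⟨fun i => if h : i < n then x ⟨i, h⟩ else 0, ?_⟩
  rw [asymN_eq]
  simp [altT]

/-- The antisymmetrization, landing in the image of the exterior power. -/
noncomputable def altW (n : ℕ) : V [⋀^Fin n]→ₗ[k] (wedgeIm k V n) :=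
  (altT n).codRestrict (wedgeIm k V n) (alt_mem n)

/-- The alternating map attached to a linear map on the image of the exterior power. -/
noncomputable def altOf {n : ℕ} {W : Type} [AddCommGroup W] [Module k W]
    (γ : wedgeIm k V n →ₗ[k] W) : V [⋀^Fin n]→ₗ[k] W :=
  γ.compAlternatingMap (altW n)

theorem altOf_apply {n : ℕ} {W : Type} [AddCommGroup W] [Module k W]
    (γ : wedgeIm k V n →ₗ[k] W) (x : ℕ → V) :
    γ (wdgN k V n x) = altOf γ (fun i : Fin n => x i) := by
  change _ = γ _
  congr 1
  exact Subtype.ext (asymN_eq n x)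

open Fin.NatCast Fin.CommRing in
theorem rot_eq_zero {n : ℕ} {X W : Type} [AddCommGroup W] [Module k W]
    (F : (Fin (n+1) → X) → W) (c : k) (hc : c ^ (n+1) = -1)
    (h : ∀ u, F u = c • F (fun i => u (i + 1))) (u : Fin (n+1) → X) : F u = 0 := by
  have step : ∀ r : ℕ, F u = c ^ r • F (fun i => u (i + (r : Fin (n+1)))) := by
    intro r
    induction r with
    | zero => simp
    | succ r ih =>
      rw [ih, h, smul_smul, pow_succ]
      congr 2
      funext i
      congr 1
      push_cast
      ring
  have := step (n+1)
  rw [hc] at this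
  simp only [Fin.natCast_self, add_zero, neg_smul, one_smul] at this
  have h2 : (2 : k) • F u = 0 := by
    rw [two_smul]
    nth_rewrite 1 [this]
    exact neg_add_cancel _
  exact (smul_eq_zero.mp h2).resolve_left two_ne_zero

theorem core [FiniteDimensional k V] (m n : ℕ)
    (hdim : n + 2 ≤ Module.finrank k V ∨ (n + 1 = Module.finrank k V ∧ Even m))
    (η : (Fin m → (V →ₗ[k] k)) → V [⋀^Fin n]→ₗ[k] k)
    (hrot : ∀ u : Fin (m+1) → (V →ₗ[k] k),
      fw (u 0) (η fun i => u i.succ) =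
        ((-1 : k) ^ (m+1)) • fw (u (Fin.last m)) (η fun i => u i.castSucc))
    (w : Fin m → (V →ₗ[k] k)) : η w = 0 := by
  have hsq : ((-1 : k) ^ (m+1)) * ((-1 : k) ^ (m+1)) = 1 := by
    rw [← mul_pow]; simp
  have hΨ : ∀ u : Fin (m+1) → (V →ₗ[k] k), fw (u 0) (η fun i => u i.succ) =
      ((-1 : k) ^ (m+1)) • fw (u (0 + 1)) (η fun i => u (i.succ + 1)) := by
    intro u
    have := hrot (fun i => u (i + 1))
    simp only [Fin.last_add_one, Fin.coeSucc_eq_succ] at this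
    rw [this, smul_smul, hsq, one_smul]
  rcases Nat.even_or_odd m with he | ho
  · refine eq_zero_of_fw (by omega) _ fun a => ?_
    have := rot_eq_zero (fun u : Fin (m+1) → (V →ₗ[k] k) => fw (u 0) (η fun i => u i.succ))
      ((-1 : k) ^ (m+1)) (by
        rw [← pow_mul]
        exact Odd.neg_one_pow (he.add_one.mul he.add_one)) hΨ (Fin.cons a w)
    simpa using this
  · have hd : n + 2 ≤ Module.finrank k V := by
      rcases hdim with h | h
      · exact h
      · exact absurd h.2 (Nat.not_even_iff_odd.mpr ho)
    refine eq_zero_of_fw (by omega) _ fun a => ?_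
    refine eq_zero_of_fw hd _ fun b => ?_
    have hone : (-1 : k) ^ (m+1) = 1 := Even.neg_one_pow ho.add_one
    have := rot_eq_zero (fun u : Fin (m+2) → (V →ₗ[k] k) =>
        fw (u 0) (fw (u 1) (η fun i => u i.succ.succ))) (-1 : k) (by
        exact Odd.neg_one_pow (ho.add_even even_two)) (by
        intro u
        have h1 := hΨ (Fin.cons (u 0) (fun i => u i.succ.succ))
        have h2 : ∀ i : Fin (m+1), (Fin.cons (u 0) (fun i => u i.succ.succ) :
            Fin (m+1) → (V →ₗ[k] k)) (i + 1) = u (i.succ + 1) := by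
          intro i
          induction i using Fin.lastCases with
          | last => simp
          | cast j =>
            rw [Fin.coeSucc_eq_succ, Fin.cons_succ, ← Fin.castSucc_succ, Fin.coeSucc_eq_succ]
        simp only [h2, hone, one_smul, Fin.cons_zero, Fin.cons_succ] at h1
        simp only [neg_smul, one_smul]
        rw [fw_swap, h1]
        simp) (Fin.cons b (Fin.cons a w))
    simpa using this

theorem removeN_fin {n : ℕ} (x : ℕ → V) (j : Fin (n+1)) :
    (fun i : Fin n => removeN V j x i) = j.removeNth (fun i : Fin (n+1) => x i) := by
  funext i
  simp only [removeN, Fin.removeNth, Fin.succAbove, Fin.lt_def, Fin.val_castSucc]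
  split_ifs <;> simp

theorem ev_oneTA (m s : ℕ) (α : wedgeIm k V (m + s) →ₗ[k] ⨂[k]^m V) (x : ℕ → V)
    (φ : Fin (m+1) → (V →ₗ[k] k)) :
    ev φ (oneTA k V m s α x) =
      fw (φ 0) ((ev fun i => φ i.succ).compAlternatingMap (altOf α)) (fun i => x i) := by
  rw [oneTA, Finset.sum_range, map_sum, fw_apply]
  refine Finset.sum_congr rfl fun j _ => ?_
  rw [map_zsmul, ev_prepend, altOf_apply, removeN_fin]
  simp [zsmul_eq_mul]

theorem ev_taOne (m s : ℕ) (α : wedgeIm k V (m + s) →ₗ[k] ⨂[k]^m V) (x : ℕ → V)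
    (φ : Fin (m+1) → (V →ₗ[k] k)) :
    ev φ (((-1 : ℤ) ^ s) • taOne k V m s α x) = (-1) ^ m *
      fw (φ (Fin.last m)) ((ev fun i => φ i.castSucc).compAlternatingMap (altOf α))
        (fun i => x i) := by
  rw [taOne, Finset.sum_range, map_zsmul, map_sum, fw_apply, Finset.smul_sum, Finset.mul_sum]
  refine Finset.sum_congr rfl fun j _ => ?_
  rw [map_zsmul, ev_append, altOf_apply, removeN_fin, smul_smul]
  have hs : ((-1 : ℤ) ^ s) * (-1) ^ (m + s - (j : ℕ)) = (-1) ^ m * (-1) ^ (j : ℕ) := by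
    rw [← pow_add, ← pow_add]
    have hj := j.isLt
    rcases Nat.even_or_odd (m + j) with h | h
    · rw [h.neg_one_pow, Even.neg_one_pow]
      grind
    · rw [h.neg_one_pow, Odd.neg_one_pow]
      grind
  rw [hs]
  simp [zsmul_eq_mul, mul_assoc]

end helpers

/-- Let `V` be a vector space over a field of characteristic zero of
dimension `v`.  Consider the map `Hom(∧^N V, V^{⊗(N-s)}) → Hom(∧^{N+1} V, V^{⊗(N+1-s)})`
sending `α ↦ 𝟙 ⊗ α + (-1)^s • α ⊗ 𝟙` (with exterior powers embedded in tensor powers by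
antisymmetrization; we write `m = N - s`, so `N = m + s`).  If either `v ≥ N + 2`, or
`v = N + 1` and `N - s` is even, this map is injective. -/
theorem stmt3 [FiniteDimensional k V] (m s : ℕ)
    (hdim : m + s + 2 ≤ Module.finrank k V ∨
      (m + s + 1 = Module.finrank k V ∧ Even m))
    (α β : wedgeIm k V (m + s) →ₗ[k] ⨂[k]^m V)
    (h : ∀ x : ℕ → V,
      oneTA k V m s α x + ((-1 : ℤ) ^ s) • taOne k V m s α x =
        oneTA k V m s β x + ((-1 : ℤ) ^ s) • taOne k V m s β x) :
    α = β := by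
  have hG : altOf α = altOf β := by
    rw [← sub_eq_zero]
    have hη : ∀ w : Fin m → (V →ₗ[k] k),
        (ev w).compAlternatingMap (altOf α) - (ev w).compAlternatingMap (altOf β) = 0 := by
      refine core m (m + s) hdim (fun w =>
        (ev w).compAlternatingMap (altOf α) - (ev w).compAlternatingMap (altOf β)) ?_
      intro u
      ext x
      have h1 := congrArg (ev u) (h (fun i => if hi : i < m + s + 1 then x ⟨i, hi⟩ else 0))
      simp only [map_add, ev_oneTA, ev_taOne] at h1
      simp only [Fin.is_lt, dite_true, Fin.eta] at h1
      rw [fw_sub, fw_sub, AlternatingMap.smul_apply, AlternatingMap.sub_apply,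
        AlternatingMap.sub_apply, smul_eq_mul, pow_succ]
      linear_combination h1
    ext x
    refine ev_sep _ fun w => ?_
    simpa using DFunLike.congr_fun (hη w) x
  refine LinearMap.ext_on_range (v := wdgN k V (m + s)) ?_ ?_
  · rw [eq_top_iff]
    rintro ⟨y, hy⟩ -
    refine Submodule.span_induction
      (p := fun y hy => (⟨y, hy⟩ : wedgeIm k V (m + s)) ∈
        Submodule.span k (Set.range (wdgN k V (m + s)))) ?_ ?_ ?_ ?_ hy
    · rintro _ ⟨x, rfl⟩
      exact Submodule.subset_span ⟨x, rfl⟩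
    · exact Submodule.zero_mem _
    · intro a b ha hb h1 h2
      exact Submodule.add_mem _ h1 h2
    · intro c a ha h1
      exact Submodule.smul_mem _ c h1
  · intro x
    rw [altOf_apply, altOf_apply, hG]

end PBW3
end

section
/- Let $V$ be a vector space over a field of characteristic zero with $\dim V \geq N+2$. For $\alpha \in \mathrm{Hom}(\wedge^N V, V^{\otimes N-s})$, the map $\mathbf{1} \otimes \alpha + (-1)^{s-1} \cdot \alpha \otimes \mathbf{1} : \wedge^{N+1} V \to V^{\otimes N+1-s}$ is zero if and only if $\alpha = \mathbf{1}^{\otimes N-s} \otimes \Phi$ for some alternating form $\Phi : \wedge^s V \to k$. -/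
open scoped TensorProduct
open PiTensorProduct

namespace PBW4


variable (k V : Type) [Field k] [CharZero k] [AddCommGroup V] [Module k V]

/-- The pure tensor `x 0 ⊗ ⋯ ⊗ x (n-1)` in `V^{⊗n}`. -/
noncomputable def tpN (n : ℕ) (x : ℕ → V) : ⨂[k]^n V := tprod k fun i : Fin n => x i

/-- The total antisymmetrization `∑_{σ ∈ S_n} sgn σ • x_{σ(0)} ⊗ ⋯ ⊗ x_{σ(n-1)}`,
the image of `x 0 ∧ ⋯ ∧ x (n-1)` under the embedding `∧ⁿ V ⊆ V^{⊗n}`. -/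
noncomputable def asymN (n : ℕ) (x : ℕ → V) : ⨂[k]^n V :=
  ∑ σ : Equiv.Perm (Fin n), (Equiv.Perm.sign σ : ℤ) • tprod k (fun i : Fin n => x (σ i))

/-- The image of `∧ⁿ V` in `V^{⊗n}` under total antisymmetrization. -/
noncomputable def wedgeIm (n : ℕ) : Submodule k (⨂[k]^n V) :=
  Submodule.span k (Set.range (asymN k V n))

/-- `x 0 ∧ ⋯ ∧ x (n-1)` as an element of the subspace `∧ⁿ V ⊆ V^{⊗n}`. -/
noncomputable def wdgN (n : ℕ) (x : ℕ → V) : wedgeIm k V n :=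
  ⟨asymN k V n x, Submodule.subset_span ⟨x, rfl⟩⟩

/-- Permute the first `n` entries of the sequence `x` by `σ`. -/
def permt {n : ℕ} (σ : Equiv.Perm (Fin n)) (x : ℕ → V) : ℕ → V :=
  fun m => if h : m < n then x (σ ⟨m, h⟩) else x m

/-- Remove the `j`-th entry of the sequence `x`. -/
def removeN (j : ℕ) (x : ℕ → V) : ℕ → V := fun m => if m < j then x m else x (m + 1)

/-- Prepend the entry `v` at the front of the sequence `x`. -/
def consT (v : V) (x : ℕ → V) : ℕ → V := fun m => if m = 0 then v else x (m - 1)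

/-- Replace the `p`-th entry of the sequence `x` by `v`. -/
def putAt (p : ℕ) (x : ℕ → V) (v : V) : ℕ → V := fun m => if m = p then v else x m


/-- The map `V^{⊗m} → V^{⊗(m+1)}`, `t ↦ v ⊗ t`. -/
noncomputable def prepend (m : ℕ) (v : V) : ⨂[k]^m V →ₗ[k] ⨂[k]^(m+1) V :=
  (TensorPower.cast k V (Nat.add_comm 1 m)).toLinearMap ∘ₗ
    (TensorPower.mulEquiv (R := k) (M := V) (n := 1) (m := m)).toLinearMap ∘ₗ
      TensorProduct.mk k (⨂[k]^1 V) (⨂[k]^m V) (tprod k fun _ : Fin 1 => v)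

/-- The map `V^{⊗m} → V^{⊗(m+1)}`, `t ↦ t ⊗ v`. -/
noncomputable def append (m : ℕ) (v : V) : ⨂[k]^m V →ₗ[k] ⨂[k]^(m+1) V :=
  (TensorPower.mulEquiv (R := k) (M := V) (n := m) (m := 1)).toLinearMap ∘ₗ
    (TensorProduct.mk k (⨂[k]^m V) (⨂[k]^1 V)).flip (tprod k fun _ : Fin 1 => v)


/-- `(𝟙 ⊗ α)` applied to the antisymmetrization of `x_0, …, x_{m+s}`, via the expansion
`∧^{N+1} V ⊆ V ⊗ ∧^N V` (where `N = m + s` and `α : ∧^N V → V^{⊗m}`). -/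
noncomputable def oneTA (m s : ℕ) (α : wedgeIm k V (m + s) →ₗ[k] ⨂[k]^m V) (x : ℕ → V) :
    ⨂[k]^(m+1) V :=
  ∑ j ∈ Finset.range (m + s + 1),
    ((-1 : ℤ) ^ j) • prepend k V m (x j) (α (wdgN k V (m + s) (removeN V j x)))

/-- `(α ⊗ 𝟙)` applied to the antisymmetrization of `x_0, …, x_{m+s}`, via the expansion
`∧^{N+1} V ⊆ ∧^N V ⊗ V`. -/
noncomputable def taOne (m s : ℕ) (α : wedgeIm k V (m + s) →ₗ[k] ⨂[k]^m V) (x : ℕ → V) :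
    ⨂[k]^(m+1) V :=
  ∑ j ∈ Finset.range (m + s + 1),
    ((-1 : ℤ) ^ (m + s - j)) • append k V m (x j) (α (wdgN k V (m + s) (removeN V j x)))

/-! ### Basic computations -/

set_option linter.unusedSectionVars false

theorem zsmul_eq (n : ℕ) (c : ℤ) (t : ⨂[k]^n V) : c • t = (c : k) • t := 
  (Int.cast_smul_eq_zsmul k c t).symm

theorem prepend_tprod (m : ℕ) (v : V) (y : Fin m → V) :
    prepend k V m v (tprod k y) = tprod k (Fin.cons v y : Fin (m + 1) → V) := by
  have h : TensorPower.mulEquiv (R := k) (M := V) (n := 1) (m := m)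
      ((tprod k fun _ : Fin 1 => v) ⊗ₜ[k] tprod k y)
      = tprod k (Fin.append (fun _ : Fin 1 => v) y) :=
    TensorPower.tprod_mul_tprod k _ _
  have h2 : prepend k V m v (tprod k y) = TensorPower.cast k V (Nat.add_comm 1 m)
      (TensorPower.mulEquiv (R := k) (M := V) (n := 1) (m := m)
      ((tprod k fun _ : Fin 1 => v) ⊗ₜ[k] tprod k y)) := rfl
  rw [h2, h, TensorPower.cast_tprod]
  congr 1
  funext i
  refine Fin.cases ?_ (fun j => ?_) i
  · simp only [Function.comp_apply, Fin.cons_zero]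
    exact Fin.append_left (fun _ : Fin 1 => v) y 0
  · simp only [Function.comp_apply, Fin.cons_succ]
    have : Fin.cast (Nat.add_comm 1 m).symm j.succ = Fin.natAdd 1 j := by
      ext; simp [Nat.add_comm]
    rw [this, Fin.append_right]

theorem append_tprod (m : ℕ) (v : V) (y : Fin m → V) :
    append k V m v (tprod k y) = tprod k (Fin.snoc y v : Fin (m + 1) → V) := by
  have h : TensorPower.mulEquiv (R := k) (M := V) (n := m) (m := 1)
      (tprod k y ⊗ₜ[k] (tprod k fun _ : Fin 1 => v))
      = tprod k (Fin.append y (fun _ : Fin 1 => v)) :=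
    TensorPower.tprod_mul_tprod k _ _
  have h2 : append k V m v (tprod k y) = 
      (TensorPower.mulEquiv (R := k) (M := V) (n := m) (m := 1)
      (tprod k y ⊗ₜ[k] (tprod k fun _ : Fin 1 => v))) := rfl
  rw [h2, h]
  congr 1
  funext i
  refine Fin.lastCases ?_ (fun j => ?_) i
  · rw [Fin.snoc_last]
    exact Fin.append_right y (fun _ : Fin 1 => v) 0
  · rw [Fin.snoc_castSucc]
    exact Fin.append_left y (fun _ : Fin 1 => v) j

section coords

variable {ι : Type} [Fintype ι] [DecidableEq ι] (b : Module.Basis ι k V)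

/-- The coordinate functional of the tensor power indexed by `J`. -/
noncomputable def tcoord {m : ℕ} (J : Fin m → ι) : ⨂[k]^m V →ₗ[k] k :=
  (Basis.piTensorProduct (fun _ : Fin m => b)).coord J

theorem tcoord_tprod {m : ℕ} (J : Fin m → ι) (y : Fin m → V) :
    tcoord k V b J (tprod k y) = ∏ i, b.repr (y i) (J i) := by
  simp only [tcoord, Module.Basis.coord_apply]
  exact Basis.piTensorProduct_repr_tprod_apply (fun _ : Fin m => b) y J

theorem tcoord_ext {m : ℕ} (t : ⨂[k]^m V) (h : ∀ J : Fin m → ι, tcoord k V b J t = 0) :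
    t = 0 :=
  (Basis.piTensorProduct (fun _ : Fin m => b)).ext_elem fun J => by
    have := h J
    simp only [tcoord, Module.Basis.coord_apply] at this
    simp [this]

theorem tcoord_prepend {m : ℕ} (J : Fin (m + 1) → ι) (v : V) (t : ⨂[k]^m V) :
    tcoord k V b J (prepend k V m v t) = b.repr v (J 0) * tcoord k V b (Fin.tail J) t := by
  induction t using PiTensorProduct.induction_on with
  | smul_tprod r y =>
    rw [map_smul, map_smul, map_smul, prepend_tprod, tcoord_tprod, tcoord_tprod,
      Fin.prod_univ_succ]
    simp only [Fin.cons_zero, Fin.cons_succ, Fin.tail, smul_eq_mul]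
    ring
  | add x y hx hy => rw [map_add, map_add, map_add, hx, hy]; ring

theorem tcoord_append {m : ℕ} (J : Fin (m + 1) → ι) (v : V) (t : ⨂[k]^m V) :
    tcoord k V b J (append k V m v t)
      = b.repr v (J (Fin.last m)) * tcoord k V b (Fin.init J) t := by
  induction t using PiTensorProduct.induction_on with
  | smul_tprod r y =>
    rw [map_smul, map_smul, map_smul, append_tprod, tcoord_tprod, tcoord_tprod,
      Fin.prod_univ_castSucc]
    simp only [Fin.snoc_castSucc, Fin.snoc_last, Fin.init, smul_eq_mul]
    ring
  | add x y hx hy => rw [map_add, map_add, map_add, hx, hy]; ring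

end coords

/-- The expression `𝟙 ⊗ a - (-1)^m a ⊗ 𝟙` evaluated on a tuple. -/
noncomputable def idE {N m : ℕ} (a : V [⋀^Fin N]→ₗ[k] ⨂[k]^m V) (x : Fin (N + 1) → V) :
    ⨂[k]^(m + 1) V :=
  ∑ j : Fin (N + 1), (-1 : k) ^ (j : ℕ) • (prepend k V m (x j) (a fun i => x (j.succAbove i))
    - (-1 : k) ^ m • append k V m (x j) (a fun i => x (j.succAbove i)))

theorem idE_sub {N m : ℕ} (a a' : V [⋀^Fin N]→ₗ[k] ⨂[k]^m V) (x : Fin (N + 1) → V) :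
    idE k V (a - a') x = idE k V a x - idE k V a' x := by
  simp only [idE, ← Finset.sum_sub_distrib, ← smul_sub]
  refine Finset.sum_congr rfl fun j _ => ?_
  congr 1
  simp only [AlternatingMap.sub_apply, map_sub, smul_sub]
  abel

/-- The alternating map underlying `α`. -/
noncomputable def altOf {N m : ℕ} (α : wedgeIm k V N →ₗ[k] ⨂[k]^m V) :
    V [⋀^Fin N]→ₗ[k] ⨂[k]^m V :=
  α.compAlternatingMap
    ((MultilinearMap.alternatization (tprod k (s := fun _ : Fin N => V))).codRestrict
      (wedgeIm k V N) (fun v => by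
        have : (MultilinearMap.alternatization (tprod k (s := fun _ : Fin N => V))) v
            = asymN k V N (fun n => if h : n < N then v ⟨n, h⟩ else 0) := by
          simp only [MultilinearMap.alternatization_apply, asymN]
          refine Finset.sum_congr rfl fun σ _ => ?_
          simp [MultilinearMap.domDomCongr_apply, Units.smul_def]
        rw [this]
        exact Submodule.subset_span ⟨_, rfl⟩))

theorem altOf_apply {N m : ℕ} (α : wedgeIm k V N →ₗ[k] ⨂[k]^m V) (x : ℕ → V) :
    α (wdgN k V N x) = altOf k V α (fun i => x i) := by
  simp only [altOf, LinearMap.compAlternatingMap_apply]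
  congr 1
  apply Subtype.ext
  simp only [wdgN, asymN, AlternatingMap.codRestrict_apply_coe,
    MultilinearMap.alternatization_apply]
  refine Finset.sum_congr rfl fun σ _ => ?_
  simp [MultilinearMap.domDomCongr_apply, Units.smul_def]

theorem removeN_eq {N : ℕ} (j : Fin (N + 1)) (x : ℕ → V) (i : Fin N) :
    removeN V j x i = x (j.succAbove i) := by
  unfold removeN
  by_cases h : (i : ℕ) < j
  · rw [if_pos h, Fin.succAbove_of_castSucc_lt _ _ h]; rfl
  · rw [if_neg h, Fin.succAbove_of_le_castSucc _ _ (not_lt.mp h)]; rfl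

theorem idE_eq (m s : ℕ) (α : wedgeIm k V (m + s) →ₗ[k] ⨂[k]^m V) (x : ℕ → V) :
    oneTA k V m s α x + ((-1 : ℤ) ^ (s + 1)) • taOne k V m s α x
      = idE k V (altOf k V α) (fun i => x i) := by
  unfold oneTA taOne idE
  simp only [zsmul_eq]
  rw [Finset.sum_range, Finset.sum_range, Finset.smul_sum, ← Finset.sum_add_distrib]
  refine Finset.sum_congr rfl fun j _ => ?_
  rw [altOf_apply]
  simp only [removeN_eq]
  generalize prepend k V m (x j) _ = p
  generalize append k V m (x j) _ = q
  have hs : ((-1 : ℤ) ^ (s + 1)) * (-1) ^ (m + s - (j : ℕ)) = - ((-1) ^ (j : ℕ) * (-1) ^ m) := by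
    have hj : (j : ℕ) ≤ m + s := Nat.lt_succ_iff.mp j.2
    obtain ⟨c, hc⟩ := Nat.exists_eq_add_of_le hj
    have h1 : m + s - (j : ℕ) = c := by omega
    rw [h1]
    have h2 : (-1 : ℤ) ^ (m + s) = (-1) ^ ((j : ℕ) + c) := congrArg _ hc
    have h3 : ∀ n : ℕ, (-1 : ℤ) ^ n * (-1) ^ n = 1 := fun n => by
      rw [← mul_pow]; simp
    have h4 : (-1 : ℤ) ^ m * (-1) ^ s = (-1) ^ (j : ℕ) * (-1) ^ c := by
      rw [← pow_add, ← pow_add, h2]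
    have h5 : (-1 : ℤ) ^ s * (-1) ^ c = (-1) ^ (j : ℕ) * (-1) ^ m := by
      calc (-1 : ℤ) ^ s * (-1) ^ c = ((-1 : ℤ) ^ m * (-1) ^ m) * ((-1 : ℤ) ^ (j:ℕ) * (-1) ^ (j:ℕ))
              * ((-1 : ℤ) ^ s * (-1) ^ c) := by rw [h3, h3]; ring
        _ = ((-1 : ℤ) ^ m * (-1) ^ s) * ((-1 : ℤ) ^ (j:ℕ) * (-1) ^ c)
              * ((-1) ^ (j : ℕ) * (-1) ^ m) := by ring
        _ = _ := by
          rw [h4]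
          have : ((-1 : ℤ) ^ (j:ℕ) * (-1) ^ c) * ((-1 : ℤ) ^ (j:ℕ) * (-1) ^ c) = 1 := by
            rw [← pow_add, h3]
          rw [this]; ring
    rw [pow_succ]
    linear_combination -h5
  have hs' : ((-1 : k) ^ (s + 1)) * (-1) ^ (m + s - (j : ℕ)) = - ((-1) ^ (j : ℕ) * (-1) ^ m) := by
    exact_mod_cast congrArg (Int.cast : ℤ → k) hs
  push_cast
  rw [smul_smul, hs', smul_sub, smul_smul, neg_smul, ← sub_eq_add_neg]

/-! ### Combinatorics of words -/

theorem exists_fresh {κ : Type} [Fintype κ] {n : ℕ} (w : Fin n → κ) (c : κ)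
    (h : n + 2 ≤ Fintype.card κ) : ∃ a, (∀ i, w i ≠ a) ∧ a ≠ c := by
  classical
  by_contra hcon
  push Not at hcon
  have : (Finset.univ : Finset κ) ⊆ insert c (Finset.univ.image w) := by
    intro a _
    by_cases hw : ∀ i, w i ≠ a
    · simp [hcon a hw]
    · push Not at hw
      obtain ⟨i, hi⟩ := hw
      simp only [Finset.mem_insert, Finset.mem_image, Finset.mem_univ, true_and]
      exact Or.inr ⟨i, hi⟩
  have h1 := Finset.card_le_card this
  have h2 := Finset.card_insert_le c (Finset.univ.image w)
  have h3 : (Finset.univ.image w).card ≤ n := by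
    simpa using (Finset.card_image_le (s := Finset.univ) (f := w))
  rw [Finset.card_univ] at h1
  omega

theorem exists_fresh' {κ : Type} [Fintype κ] {n : ℕ} (w : Fin n → κ)
    (h : n + 1 ≤ Fintype.card κ) : ∃ a, ∀ i, w i ≠ a := by
  classical
  by_contra hcon
  push Not at hcon
  have h1 : Function.Surjective w := hcon
  have := Fintype.card_le_of_surjective w h1
  simp at this
  omega

theorem update_inj {κ : Type} {n : ℕ} (w : Fin n → κ) (hw : Function.Injective w)
    (i : Fin n) (v : κ) (hv : ∀ j, j ≠ i → w j ≠ v) : Function.Injective (Function.update w i v) := by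
  intro a c hac
  by_cases ha : a = i <;> by_cases hc : c = i
  · rw [ha, hc]
  · subst ha; simp [Function.update_of_ne hc] at hac; exact absurd hac.symm (hv c hc)
  · subst hc; simp [Function.update_of_ne ha] at hac; exact absurd hac (hv a ha)
  · rw [Function.update_of_ne ha, Function.update_of_ne hc] at hac; exact hw hac

theorem const_of_update {κ β : Type} [Fintype κ] {n : ℕ} (f : (Fin n → κ) → β)
    (hcard : n + 1 ≤ Fintype.card κ)
    (hf : ∀ w i v, Function.Injective w → Function.Injective (Function.update w i v) →
      f (Function.update w i v) = f w) :
    ∀ u w, Function.Injective u → Function.Injective w → f w = f u := by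
  classical
  intro u
  suffices H : ∀ (c : ℕ) (w : Fin n → κ), (Finset.univ.filter fun i => w i ≠ u i).card = c →
      Function.Injective u → Function.Injective w → f w = f u from fun w hu hw => H _ w rfl hu hw
  intro c
  induction c using Nat.strong_induction_on with
  | _ c ih =>
  intro w hc hu hw
  by_cases hwu : w = u
  · rw [hwu]
  obtain ⟨i, hi⟩ : ∃ i, w i ≠ u i := by
    by_contra hcon
    push Not at hcon
    exact hwu (funext hcon)
  -- reduce to the case where `u i` is unused
  have key : ∀ w' : Fin n → κ, Function.Injective w' → (∀ j, w' j ≠ u i) →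
      (∀ j, w j = u j → w' j = u j) → f w' = f u := by
    intro w' hw' hfree hag
    have hinj : Function.Injective (Function.update w' i (u i)) :=
      update_inj w' hw' i (u i) fun j _ => hfree j
    rw [← hf w' i (u i) hw' hinj]
    refine ih _ ?_ _ rfl hu hinj
    rw [← hc]
    apply Finset.card_lt_card
    rw [Finset.ssubset_iff_of_subset]
    · refine ⟨i, by simp [hi], by simp⟩
    · intro j hj
      simp only [Finset.mem_filter, Finset.mem_univ, true_and] at hj ⊢
      intro hj'
      apply hj
      by_cases hji : j = i
      · subst hji; simp
      · rw [Function.update_of_ne hji]; exact hag j hj'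
  by_cases hused : ∀ j, w j ≠ u i
  · exact key w hw hused fun _ h => h
  · push Not at hused
    obtain ⟨j, hj⟩ := hused
    obtain ⟨z, hz⟩ := exists_fresh' w hcard
    have hinj : Function.Injective (Function.update w j z) :=
      update_inj w hw j z fun l _ => hz l
    rw [← hf w j z hw hinj]
    have hji : j ≠ i := by
      rintro rfl; exact hi hj
    refine key _ hinj (fun l => ?_) (fun l hl => ?_)
    · by_cases hlj : l = j
      · subst hlj
        rw [Function.update_self, ← hj]
        exact (hz l).symm
      · rw [Function.update_of_ne hlj, ← hj]
        exact fun h => hlj (hw h)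
    · by_cases hlj : l = j
      · subst hlj
        exact absurd (hu (hl.symm.trans hj)) hji
      · rw [Function.update_of_ne hlj]; exact hl

theorem word_const {κ β : Type} [Fintype κ] {m : ℕ} (B : (Fin m → κ) → β)
    (hcard : m + 2 ≤ Fintype.card κ)
    (hB : ∀ w : Fin (m + 1) → κ, Function.Injective w → B (Fin.tail w) = B (Fin.init w)) :
    ∀ J J' : Fin m → κ, Function.Injective J → Function.Injective J' → B J = B J' := by
  have hrot : ∀ w : Fin (m + 1) → κ, Function.Injective w →
      B (Fin.tail (fun i => w (finRotate (m + 1) i))) = B (Fin.tail w) := by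
    intro w hw
    refine (hB (fun i => w (finRotate (m + 1) i)) (hw.comp (finRotate (m + 1)).injective)).trans ?_
    congr 1
    funext i
    simp [Fin.init, Fin.tail]
  have hup : ∀ (c : ℕ) (i : Fin (m + 1)), (i : ℕ) = c → ∀ (w : Fin (m + 1) → κ) (v : κ),
      Function.Injective w → Function.Injective (Function.update w i v) →
      B (Fin.tail (Function.update w i v)) = B (Fin.tail w) := by
    intro c
    induction c with
    | zero =>
      intro i hi w v hw hu
      have : i = 0 := Fin.ext hi
      subst this
      rw [Fin.tail_update_zero]
    | succ c ih =>
      intro i hi w v hw hu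
      have hc : c < m := by omega
      have hrc : finRotate (m + 1) ⟨c, by omega⟩ = i := by
        rw [finRotate_of_lt hc]; ext; simp [hi]
      rw [← hrot _ hu, ← hrot w hw]
      have : (fun j => Function.update w i v (finRotate (m + 1) j))
          = Function.update (fun j => w (finRotate (m + 1) j)) ⟨c, by omega⟩ v := by
        funext j
        by_cases hj : j = ⟨c, by omega⟩
        · subst hj; rw [hrc]; simp
        · rw [Function.update_of_ne hj, Function.update_of_ne]
          rw [← hrc]; exact fun h => hj ((finRotate (m + 1)).injective h)
      rw [this]
      refine ih ⟨c, by omega⟩ rfl _ v (hw.comp (finRotate (m + 1)).injective) ?_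
      rw [← this]
      exact hu.comp (finRotate (m + 1)).injective
  have hconst := const_of_update (fun w : Fin (m + 1) → κ => B (Fin.tail w)) hcard
    (fun w i v hw hu => hup _ i rfl w v hw hu)
  intro J J' hJ hJ'
  obtain ⟨a, ha⟩ := exists_fresh' J (by omega)
  obtain ⟨a', ha'⟩ := exists_fresh' J' (by omega)
  have h1 : Function.Injective (Fin.cons a J : Fin (m + 1) → κ) :=
    Fin.cons_injective_iff.mpr ⟨fun ⟨i, hi⟩ => ha i hi, hJ⟩
  have h2 : Function.Injective (Fin.cons a' J' : Fin (m + 1) → κ) :=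
    Fin.cons_injective_iff.mpr ⟨fun ⟨i, hi⟩ => ha' i hi, hJ'⟩
  have := hconst _ _ h2 h1
  simpa [Fin.tail_cons] using this

/-! ### The identity in coordinates -/

section ident

variable {ι : Type} [Fintype ι] [DecidableEq ι] (b : Module.Basis ι k V)
variable {N m : ℕ} (a : V [⋀^Fin N]→ₗ[k] ⨂[k]^m V)

/-- coordinates of an alternating map -/
noncomputable def cf (K : Fin N → ι) (J : Fin m → ι) : k :=
  tcoord k V b J (a fun i => b (K i))

theorem ident (ha : ∀ x, idE k V a x = 0) (I : Fin (N + 1) → ι) (J : Fin (m + 1) → ι) :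
    ∑ j : Fin (N + 1), (-1 : k) ^ (j : ℕ) *
      ((if I j = J 0 then cf k V b a (fun i => I (j.succAbove i)) (Fin.tail J) else 0)
      - (-1) ^ m * (if I j = J (Fin.last m) then
          cf k V b a (fun i => I (j.succAbove i)) (Fin.init J) else 0)) = 0 := by
  have h := congrArg (tcoord k V b J) (ha fun i => b (I i))
  rw [map_zero] at h
  rw [idE, map_sum] at h
  refine Eq.trans ?_ h
  refine Finset.sum_congr rfl fun j _ => ?_
  rw [map_smul, map_sub, map_smul, tcoord_prepend, tcoord_append]
  simp only [Module.Basis.repr_self, Finsupp.single_apply, smul_eq_mul, cf, ite_mul, one_mul,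
    zero_mul]

theorem ident1 (ha : ∀ x, idE k V a x = 0) (I : Fin (N + 1) → ι) (hI : Function.Injective I)
    (J : Fin (m + 1) → ι) (p : Fin (N + 1)) (hp : I p = J 0) (hJ : ∀ i, I i ≠ J (Fin.last m)) :
    cf k V b a (fun i => I (p.succAbove i)) (Fin.tail J) = 0 := by
  have h := ident k V b a ha I J
  rw [Finset.sum_eq_single p] at h
  · rw [if_pos hp, if_neg (hJ p)] at h
    simpa using h
  · intro j _ hj
    have : I j ≠ J 0 := by rw [← hp]; exact fun h => hj (hI h)
    simp [this, hJ j]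
  · simp

theorem ident2 (ha : ∀ x, idE k V a x = 0) (I : Fin (N + 1) → ι) (hI : Function.Injective I)
    (J : Fin (m + 1) → ι) (p q : Fin (N + 1)) (hp : I p = J 0) (hq : I q = J (Fin.last m)) :
    (-1) ^ (p : ℕ) * cf k V b a (fun i => I (p.succAbove i)) (Fin.tail J)
      = (-1) ^ m * ((-1) ^ (q : ℕ) * cf k V b a (fun i => I (q.succAbove i)) (Fin.init J)) := by
  have h := ident k V b a ha I J
  simp only [mul_sub, Finset.sum_sub_distrib] at h
  rw [Finset.sum_eq_single p, Finset.sum_eq_single q] at h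
  · rw [if_pos hp, if_pos hq] at h
    linear_combination h
  · intro j _ hj
    have : I j ≠ J (Fin.last m) := by rw [← hq]; exact fun h => hj (hI h)
    simp [this]
  · simp
  · intro j _ hj
    have : I j ≠ J 0 := by rw [← hp]; exact fun h => hj (hI h)
    simp [this]
  · simp

end ident

section vanish

variable {ι : Type} [Fintype ι] [DecidableEq ι] (b : Module.Basis ι k V)
variable {N m : ℕ} (a : V [⋀^Fin N]→ₗ[k] ⨂[k]^(m + 1) V)

theorem vanish_last (ha : ∀ x, idE k V a x = 0) (hd : N + 2 ≤ Fintype.card ι)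
    (K : Fin N → ι) (hK : Function.Injective K)
    (J : Fin (m + 1) → ι) (h : ∀ i, K i ≠ J (Fin.last m)) : cf k V b a K J = 0 := by
  obtain ⟨c, hc1, hc2⟩ := exists_fresh K (J (Fin.last m)) hd
  have hI : Function.Injective (Fin.cons c K : Fin (N + 1) → ι) :=
    Fin.cons_injective_iff.mpr ⟨fun ⟨i, hi⟩ => hc1 i hi, hK⟩
  have := ident1 k V b a ha (Fin.cons c K) hI (Fin.cons c J) 0 rfl (fun i => by
    rw [← Fin.succ_last, Fin.cons_succ]
    refine Fin.cases ?_ (fun i => ?_) i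
    · simpa using hc2
    · simpa using h i)
  simpa using this

theorem shift (ha : ∀ x, idE k V a x = 0) 
    (K : Fin N → ι) (hK : Function.Injective K) (c : ι) (hc : ∀ i, K i ≠ c)
    (J : Fin (m + 1) → ι) (q : Fin N) (hq : K q = J (Fin.last m)) :
    ∃ K' : Fin N → ι, Function.Injective K' ∧ (∀ i, K' i = c ∨ (∃ j, K' i = K j ∧ j ≠ q)) ∧
      (cf k V b a K' (Fin.init (Fin.cons c J : Fin (m + 2) → ι)) = 0 → cf k V b a K J = 0) := by
  have hI : Function.Injective (Fin.cons c K : Fin (N + 1) → ι) :=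
    Fin.cons_injective_iff.mpr ⟨fun ⟨i, hi⟩ => hc i hi, hK⟩
  refine ⟨fun i => (Fin.cons c K : Fin (N + 1) → ι) (q.succ.succAbove i),
    hI.comp Fin.succAbove_right_injective, fun i => ?_, fun h => ?_⟩
  · have hne : q.succ.succAbove i ≠ q.succ := Fin.succAbove_ne _ _
    change (Fin.cons c K : Fin (N + 1) → ι) (q.succ.succAbove i) = c ∨
      ∃ j, (Fin.cons c K : Fin (N + 1) → ι) (q.succ.succAbove i) = K j ∧ j ≠ q
    revert hne
    generalize q.succ.succAbove i = j
    refine Fin.cases ?_ (fun j => ?_) j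
    · intro _; left; rfl
    · intro hne
      right
      exact ⟨j, rfl, fun h => hne (by rw [h])⟩
  · have := ident2 k V b a ha (Fin.cons c K) hI (Fin.cons c J) 0 q.succ rfl
      (by rw [← Fin.succ_last, Fin.cons_succ, Fin.cons_succ, hq])
    rw [h] at this
    simpa using this

theorem init_cons_succ (c : ι) (J : Fin (m + 1) → ι) (p : ℕ) (hp : p + 1 < m + 1) :
    (Fin.init (Fin.cons c J : Fin (m + 2) → ι)) ⟨p + 1, hp⟩ = J ⟨p, by omega⟩ := rfl

theorem vanish_notin (ha : ∀ x, idE k V a x = 0) (hd : N + 2 ≤ Fintype.card ι) (r : ℕ) :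
    ∀ (p : ℕ) (hp : p < m + 1), p + r = m → ∀ (K : Fin N → ι), Function.Injective K →
    ∀ (J : Fin (m + 1) → ι), (∀ i, K i ≠ J ⟨p, hp⟩) → cf k V b a K J = 0 := by
  induction r with
  | zero =>
    intro p hp hpr K hK J h
    have : (⟨p, hp⟩ : Fin (m + 1)) = Fin.last m := Fin.ext hpr
    rw [this] at h
    exact vanish_last k V b a ha hd K hK J h
  | succ r ih =>
    intro p hp hpr K hK J h
    by_cases hl : ∀ i, K i ≠ J (Fin.last m)
    · exact vanish_last k V b a ha hd K hK J hl
    · push Not at hl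
      obtain ⟨q, hq⟩ := hl
      obtain ⟨c, hc1, hc2⟩ := exists_fresh K (J ⟨p, hp⟩) hd
      obtain ⟨K', hK', hr, himp⟩ := shift k V b a ha K hK c hc1 J q hq
      apply himp
      refine ih (p + 1) (by omega) (by omega) K' hK' _ (fun i => ?_)
      rw [init_cons_succ]
      rcases hr i with h1 | ⟨j, h1, _⟩
      · rw [h1]; exact hc2
      · rw [h1]; exact h j

theorem vanish_rep (ha : ∀ x, idE k V a x = 0) (hd : N + 2 ≤ Fintype.card ι) (r : ℕ) :
    ∀ (p q : ℕ) (hpq : p < q) (hq : q < m + 1), q + r = m →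
    ∀ (K : Fin N → ι), Function.Injective K →
    ∀ (J : Fin (m + 1) → ι), J ⟨p, by omega⟩ = J ⟨q, hq⟩ → cf k V b a K J = 0 := by
  induction r with
  | zero =>
    intro p q hpq hq hqr K hK J h
    by_cases hl : ∀ i, K i ≠ J (Fin.last m)
    · exact vanish_last k V b a ha hd K hK J hl
    · push Not at hl
      obtain ⟨q', hq'⟩ := hl
      obtain ⟨c, hc1, hc2⟩ := exists_fresh K (J (Fin.last m)) hd
      obtain ⟨K', hK', hr, himp⟩ := shift k V b a ha K hK c hc1 J q' hq'
      apply himp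
      refine vanish_notin k V b a ha hd (m - (p + 1)) (p + 1) (by omega) (by omega) K' hK' _
        (fun i => ?_)
      have : (⟨q, hq⟩ : Fin (m + 1)) = Fin.last m := Fin.ext hqr
      rw [init_cons_succ, h, this]
      rcases hr i with h1 | ⟨j, h1, h2⟩
      · rw [h1]; exact hc2
      · rw [h1, ← hq']; exact fun h => h2 (hK h)
  | succ r ih =>
    intro p q hpq hq hqr K hK J h
    by_cases hl : ∀ i, K i ≠ J (Fin.last m)
    · exact vanish_last k V b a ha hd K hK J hl
    · push Not at hl
      obtain ⟨q', hq'⟩ := hl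
      obtain ⟨c, hc1, -⟩ := exists_fresh K (J (Fin.last m)) hd
      obtain ⟨K', hK', hr, himp⟩ := shift k V b a ha K hK c hc1 J q' hq'
      apply himp
      refine ih (p + 1) (q + 1) (by omega) (by omega) (by omega) K' hK' _ ?_
      rw [init_cons_succ, init_cons_succ, h]

end vanish

theorem vanish {ι : Type} [Fintype ι] [DecidableEq ι] (b : Module.Basis ι k V) {N m : ℕ}
    (a : V [⋀^Fin N]→ₗ[k] ⨂[k]^m V) (ha : ∀ x, idE k V a x = 0) (hd : N + 2 ≤ Fintype.card ι)
    (K : Fin N → ι) (hK : Function.Injective K) (J : Fin m → ι) (h : cf k V b a K J ≠ 0) :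
    Function.Injective J ∧ ∀ p, ∃ i, K i = J p := by
  cases m with
  | zero => exact ⟨fun x => x.elim0, fun x => x.elim0⟩
  | succ m =>
    constructor
    · intro p q hpq
      by_contra hne
      apply h
      rcases lt_or_gt_of_ne hne with hlt | hlt
      · exact vanish_rep k V b a ha hd (m - q) p q hlt q.2 (by omega) K hK J hpq
      · exact vanish_rep k V b a ha hd (m - p) q p hlt p.2 (by omega) K hK J hpq.symm
    · intro p
      by_contra hcon
      push Not at hcon
      exact h (vanish_notin k V b a ha hd (m - p) p p.2 (by omega) K hK J hcon)

/-! ### The model solutions -/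

theorem sum_perm_succ {M : Type} [AddCommMonoid M] (n : ℕ) (g : Equiv.Perm (Fin (n + 1)) → M) :
    ∑ σ, g σ = ∑ j : Fin (n + 1), ∑ τ : Equiv.Perm (Fin n),
      g ((Fin.cycleRange j).symm * Equiv.Perm.decomposeFin.symm (0, τ)) := by
  rw [← Fintype.sum_prod_type']
  symm
  apply Function.Bijective.sum_comp (e := fun p : Fin (n + 1) × Equiv.Perm (Fin n) =>
    (Fin.cycleRange p.1).symm * Equiv.Perm.decomposeFin.symm (0, p.2))
  rw [Fintype.bijective_iff_injective_and_card]
  constructor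
  · rintro ⟨j, τ⟩ ⟨j', τ'⟩ h
    simp only at h
    have h0 := congrArg (fun σ : Equiv.Perm (Fin (n + 1)) => σ 0) h
    simp only [Equiv.Perm.mul_apply, Equiv.Perm.decomposeFin_symm_apply_zero,
      Fin.cycleRange_symm_zero] at h0
    subst h0
    have h1 := mul_left_cancel h
    have h2 := Equiv.Perm.decomposeFin.symm.injective h1
    rw [Prod.mk.injEq] at h2
    rw [h2.2]
  · rw [Fintype.card_prod, Fintype.card_perm, Fintype.card_perm, Fintype.card_fin,
      Fintype.card_fin, Nat.factorial_succ]

/-- The multilinear map `x ↦ Φ(x_m, …) • x_0 ⊗ ⋯ ⊗ x_{m-1}`. -/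
noncomputable def modelM (m s : ℕ) (Φ : AlternatingMap k V k (Fin s)) :
    MultilinearMap k (fun _ : Fin (m + s) => V) (⨂[k]^m V) :=
  (TensorProduct.rid k (⨂[k]^m V)).toLinearMap.compMultilinearMap
    (((tprod k (s := fun _ : Fin m => V)).domCoprod Φ.toMultilinearMap).domDomCongr finSumFinEquiv)

theorem modelM_apply (m s : ℕ) (Φ : AlternatingMap k V k (Fin s)) (x : Fin (m + s) → V) :
    modelM k V m s Φ x
      = Φ (fun i => x (Fin.natAdd m i)) • tprod k (fun i => x (Fin.castAdd s i)) := by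
  simp [modelM, MultilinearMap.domDomCongr_apply]

/-- The alternating map `𝟙^{⊗m} ⊗ Φ`. -/
noncomputable def modelA (m s : ℕ) (Φ : AlternatingMap k V k (Fin s)) :
    V [⋀^Fin (m + s)]→ₗ[k] ⨂[k]^m V :=
  MultilinearMap.alternatization (modelM k V m s Φ)

theorem modelA_apply (m s : ℕ) (Φ : AlternatingMap k V k (Fin s)) (x : Fin (m + s) → V) :
    modelA k V m s Φ x = ∑ σ : Equiv.Perm (Fin (m + s)), ((Equiv.Perm.sign σ : ℤ) : k) •
      Φ (fun i => x (σ (Fin.natAdd m i))) • tprod k (fun i => x (σ (Fin.castAdd s i))) := by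
  simp only [modelA, MultilinearMap.alternatization_apply]
  refine Finset.sum_congr rfl fun σ _ => ?_
  rw [MultilinearMap.domDomCongr_apply, modelM_apply, Units.smul_def, zsmul_eq]

theorem model_sum (m s : ℕ) (Φ : AlternatingMap k V k (Fin s)) (x : Fin (m + s + 1) → V)
    (F : V → ⨂[k]^m V →ₗ[k] ⨂[k]^(m + 1) V) :
    ∑ j : Fin (m + s + 1), (-1 : k) ^ (j : ℕ) •
        F (x j) (modelA k V m s Φ fun i => x (j.succAbove i))
      = ∑ σ : Equiv.Perm (Fin (m + s + 1)), ((Equiv.Perm.sign σ : ℤ) : k) •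
          Φ (fun i => x (σ (Fin.natAdd m i).succ)) •
            F (x (σ 0)) (tprod k (fun i => x (σ (Fin.castAdd s i).succ))) := by
  rw [sum_perm_succ]
  refine Finset.sum_congr rfl fun j _ => ?_
  rw [modelA_apply, map_sum, Finset.smul_sum]
  refine Finset.sum_congr rfl fun τ _ => ?_
  simp only [Equiv.Perm.mul_apply, Equiv.Perm.decomposeFin_symm_apply_zero,
    Fin.cycleRange_symm_zero, Equiv.Perm.decomposeFin_symm_apply_succ, Equiv.swap_self,
    Equiv.refl_apply, Fin.cycleRange_symm_succ, map_smul]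
  rw [smul_smul]
  congr 1
  rw [Equiv.Perm.sign_mul, Equiv.Perm.sign_symm, Fin.sign_cycleRange,
    Equiv.Perm.decomposeFin.symm_sign]
  simp

theorem idE_model (m s : ℕ) (Φ : AlternatingMap k V k (Fin s)) (x : Fin (m + s + 1) → V) :
    idE k V (modelA k V m s Φ) x = 0 := by
  have h1 : idE k V (modelA k V m s Φ) x
      = (∑ j : Fin (m + s + 1), (-1 : k) ^ (j : ℕ) •
        prepend k V m (x j) (modelA k V m s Φ fun i => x (j.succAbove i)))
      - (-1 : k) ^ m • (∑ j : Fin (m + s + 1), (-1 : k) ^ (j : ℕ) •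
        append k V m (x j) (modelA k V m s Φ fun i => x (j.succAbove i))) := by
    rw [Finset.smul_sum, ← Finset.sum_sub_distrib, idE]
    refine Finset.sum_congr rfl fun j _ => ?_
    rw [smul_sub, smul_comm]
  rw [h1, model_sum, model_sum, sub_eq_zero]
  set c : Equiv.Perm (Fin (m + s + 1)) := Fin.cycleRange ⟨m, by omega⟩ with hc
  rw [← Equiv.sum_comp (Equiv.mulRight c), Finset.smul_sum]
  refine Finset.sum_congr rfl fun σ _ => ?_
  have hsign : ((Equiv.Perm.sign (σ * c) : ℤ) : k)
      = (-1) ^ m * ((Equiv.Perm.sign σ : ℤ) : k) := by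
    rw [Equiv.Perm.sign_mul, hc, Fin.sign_cycleRange]
    push_cast
    ring
  rw [Equiv.coe_mulRight, hsign, mul_smul]
  congr 1
  have hc1 : ∀ i : Fin s, c (Fin.natAdd m i).succ = (Fin.natAdd m i).succ := fun i => by
    rw [hc]
    apply Fin.cycleRange_of_gt
    rw [Fin.lt_def]
    simp
  have hc2 : ∀ i : ℕ, ∀ h : i < m, c ⟨i, by omega⟩ = ⟨i + 1, by omega⟩ := fun i h => by
    rw [hc, Fin.cycleRange_of_lt (by rw [Fin.lt_def]; exact h)]
    ext
    rw [Fin.val_add_one_of_lt' (by simp; omega)]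
  have hc3 : c ⟨m, by omega⟩ = 0 := by rw [hc, Fin.cycleRange_self]
  simp only [Equiv.Perm.mul_apply, hc1]
  congr 2
  rw [prepend_tprod, append_tprod]
  congr 1
  have e1 : ∀ y : Fin (m + s + 1) → V, (Fin.cons (y 0) (fun i => y (Fin.castAdd s i).succ) :
      Fin (m + 1) → V) = fun i : Fin (m + 1) => y ⟨i, by omega⟩ := fun y => by
    funext i
    refine Fin.cases ?_ (fun i => ?_) i
    · rfl
    · rfl
  rw [e1 fun i => x (σ (c i))]
  funext i
  refine Fin.lastCases ?_ (fun i => ?_) i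
  · rw [Fin.snoc_last]
    exact congrArg (fun z => x (σ z)) hc3
  · rw [Fin.snoc_castSucc]
    exact congrArg (fun z => x (σ z)) (hc2 i i.2)

/-! ### The converse -/

section converse

variable {ι : Type} [Fintype ι] [DecidableEq ι] (b : Module.Basis ι k V)
variable {m s : ℕ} (a : V [⋀^Fin (m + s)]→ₗ[k] ⨂[k]^m V)

theorem shift_B (ha : ∀ x, idE k V a x = 0) (w : Fin (m + 1) → ι) (S : Fin s → ι)
    (hw : Function.Injective w) (hS : Function.Injective S) (hwS : ∀ i j, w i ≠ S j) :
    cf k V b a (Fin.append (Fin.tail w) S) (Fin.tail w)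
      = cf k V b a (Fin.append (Fin.init w) S) (Fin.init w) := by
  set I : Fin (m + s + 1) → ι := Fin.cons (w 0) (Fin.append (Fin.tail w) S) with hIdef
  have hI : Function.Injective I := by
    rw [hIdef, Fin.cons_injective_iff]
    refine ⟨?_, Fin.append_injective_iff.mpr ⟨hw.comp (Fin.succ_injective _), hS,
      fun i j => hwS _ _⟩⟩
    rintro ⟨i, hi⟩
    revert hi
    refine Fin.addCases (fun i => ?_) (fun i => ?_) i
    · rw [Fin.append_left]
      intro h
      exact (Fin.succ_ne_zero i) (hw h)
    · rw [Fin.append_right]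
      intro h
      exact hwS _ _ h.symm
  have hI1 : ∀ i : Fin (m + 1), I ⟨i, by omega⟩ = w i := by
    intro i
    refine Fin.cases ?_ (fun i => ?_) i
    · rfl
    · exact Fin.append_left (Fin.tail w) S i
  have hI2 : ∀ i : Fin s, I (Fin.natAdd m i).succ = S i := fun i =>
    Fin.append_right (Fin.tail w) S i
  have h := ident2 k V b a ha I hI w 0 ⟨m, by omega⟩ rfl (hI1 (Fin.last m))
  have hK1 : (fun i => I ((0 : Fin (m + s + 1)).succAbove i)) = Fin.append (Fin.tail w) S := by
    funext i
    simp [hIdef]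
  have hK2 : (fun i => I ((⟨m, by omega⟩ : Fin (m + s + 1)).succAbove i))
      = Fin.append (Fin.init w) S := by
    funext i
    refine Fin.addCases (fun i => ?_) (fun i => ?_) i
    · rw [Fin.append_left, Fin.succAbove_of_castSucc_lt _ _ (by rw [Fin.lt_def]; simp)]
      exact hI1 i.castSucc
    · rw [Fin.append_right, Fin.succAbove_of_le_castSucc _ _ (by rw [Fin.le_def]; simp)]
      exact hI2 i
  rw [hK1, hK2, ← mul_assoc, ← mul_pow] at h
  simpa using h

/-- the complement of `S` -/
abbrev Cpl (S : Fin s → ι) : Type := {x : ι // ∀ j, x ≠ S j}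

theorem card_Cpl (S : Fin s → ι) (hS : Function.Injective S) :
    Fintype.card (Cpl S) = Fintype.card ι - s := by
  have h1 : Fintype.card (Cpl S) = (Finset.univ \ Finset.univ.image S).card := by
    rw [Fintype.card_subtype]
    congr 1
    ext x
    simp [eq_comm]
  rw [h1, Finset.card_sdiff_of_subset (Finset.subset_univ _), Finset.card_image_of_injective _ hS]
  simp

theorem append_inj_val (S : Fin s → ι) (hS : Function.Injective S) (J : Fin m → Cpl S)
    (hJ : Function.Injective J) :
    Function.Injective (Fin.append (fun i => (J i : ι)) S) :=
  Fin.append_injective_iff.mpr ⟨Subtype.val_injective.comp hJ, hS, fun i j => (J i).2 j⟩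

theorem B_const (ha : ∀ x, idE k V a x = 0) (hd : m + s + 2 ≤ Fintype.card ι)
    (S : Fin s → ι) (J J' : Fin m → ι) (hJ : Function.Injective (Fin.append J S))
    (hJ' : Function.Injective (Fin.append J' S)) :
    cf k V b a (Fin.append J S) J = cf k V b a (Fin.append J' S) J' := by
  rw [Fin.append_injective_iff] at hJ hJ'
  have hS := hJ.2.1
  have := word_const (κ := Cpl S)
    (fun J : Fin m → Cpl S => cf k V b a (Fin.append (fun i => (J i : ι)) S) (fun i => (J i : ι)))
    (by rw [card_Cpl S hS]; omega)
    (fun w hw => shift_B k V b a ha (fun i => (w i : ι)) S (Subtype.val_injective.comp hw) hS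
      (fun i j => (w i).2 j))
    (fun i => ⟨J i, fun j => hJ.2.2 i j⟩) (fun i => ⟨J' i, fun j => hJ'.2.2 i j⟩)
    (fun i j h => hJ.1 (congrArg Subtype.val h)) (fun i j h => hJ'.1 (congrArg Subtype.val h))
  exact this

theorem count (S : Fin s → ι) (hS : Function.Injective S) :
    (Finset.univ.filter fun J : Fin m → ι => Function.Injective (Fin.append J S)).card
      = (Fintype.card ι - s).descFactorial m := by
  have h := Fintype.card_embedding_eq (α := Fin m) (β := Cpl S)
  rw [card_Cpl S hS, Fintype.card_fin] at h
  rw [← h, ← Fintype.card_subtype]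
  refine Fintype.card_congr
    { toFun := fun J => ⟨fun i => ⟨J.1 i, fun j => (Fin.append_injective_iff.mp J.2).2.2 i j⟩,
        fun i j h => (Fin.append_injective_iff.mp J.2).1 (congrArg Subtype.val h)⟩
      invFun := fun f => ⟨fun i => (f i : ι), append_inj_val S hS f f.injective⟩
      left_inv := fun J => rfl
      right_inv := fun f => rfl }

/-- Contraction of `a` -/
noncomputable def contr (f : ⨂[k]^m V →ₗ[k] k) (u : Fin m → V) : AlternatingMap k V k (Fin s) :=
  { (f.compMultilinearMap (a.toMultilinearMap.domDomCongr finSumFinEquiv.symm)).currySum u with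
    map_eq_zero_of_eq' := fun v i j hv hij => by
      simp only [MultilinearMap.toFun_eq_coe, MultilinearMap.currySum_apply',
        LinearMap.compMultilinearMap_apply, MultilinearMap.domDomCongr_apply]
      refine (congrArg f ?_).trans (map_zero f)
      refine a.map_eq_zero_of_eq _ (i := Fin.natAdd m i) (j := Fin.natAdd m j) ?_ ?_
      · simpa using hv
      · intro h
        exact hij (Fin.natAdd_injective _ _ h) }

theorem contr_apply (f : ⨂[k]^m V →ₗ[k] k) (u : Fin m → V) (y : Fin s → V) :
    contr k V a f u y = f (a (Fin.append u y)) := by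
  change f (a fun i => Sum.elim u y (finSumFinEquiv.symm i)) = _
  congr 2
  funext i
  refine Fin.addCases (fun i => ?_) (fun i => ?_) i <;> simp

theorem append_basis (J : Fin m → ι) (S : Fin s → ι) :
    Fin.append (fun i => b (J i)) (fun i => b (S i)) = fun i => b (Fin.append J S i) := by
  funext i
  refine Fin.addCases (fun i => ?_) (fun i => ?_) i <;> simp

theorem alt_sum_apply {κ : Type} (t : Finset κ) (F : κ → AlternatingMap k V k (Fin s))
    (y : Fin s → V) : (∑ i ∈ t, F i) y = ∑ i ∈ t, F i y := by
  classical
  induction t using Finset.induction_on with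
  | empty => simp
  | insert i t hi ih => rw [Finset.sum_insert hi, Finset.sum_insert hi, AlternatingMap.add_apply, ih]

/-- full contraction -/
noncomputable def contrAll : AlternatingMap k V k (Fin s) :=
  ∑ J : Fin m → ι, contr k V a (tcoord k V b J) (fun i => b (J i))

theorem contrAll_basis (ha : ∀ x, idE k V a x = 0) (hd : m + s + 2 ≤ Fintype.card ι)
    (S : Fin s → ι) (J : Fin m → ι) (hJ : Function.Injective (Fin.append J S)) :
    contrAll k V b a (fun i => b (S i))
      = ((Fintype.card ι - s).descFactorial m : k) * cf k V b a (Fin.append J S) J := by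
  have hS := (Fin.append_injective_iff.mp hJ).2.1
  rw [contrAll, alt_sum_apply]
  simp only [contr_apply, append_basis]
  rw [← Finset.sum_filter_add_sum_filter_not Finset.univ
    (fun J' : Fin m → ι => Function.Injective (Fin.append J' S))]
  rw [Finset.sum_congr rfl (g := fun _ => cf k V b a (Fin.append J S) J)]
  · rw [Finset.sum_const, count S hS, Finset.sum_eq_zero, add_zero, nsmul_eq_mul]
    intro J' hJ'
    rw [Finset.mem_filter] at hJ'
    have h2 := hJ'.2
    simp only [Function.Injective, not_forall] at h2
    obtain ⟨i, j, hij, hne⟩ := h2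
    rw [a.map_eq_zero_of_eq _ (i := i) (j := j) (by simp only [hij]) hne, map_zero]
  · intro J' hJ'
    rw [Finset.mem_filter] at hJ'
    exact B_const k V b a ha hd S J' J hJ'.2 hJ

/-- permutations fixing the first `m` letters -/
def FixP (m s : ℕ) (σ : Equiv.Perm (Fin (m + s))) : Prop :=
  ∀ i : Fin m, σ (Fin.castAdd s i) = Fin.castAdd s i

theorem FixP_natAdd {σ : Equiv.Perm (Fin (m + s))} (h : FixP m s σ) :
    ∃ τ : Equiv.Perm (Fin s), (∀ i, σ (Fin.natAdd m i) = Fin.natAdd m (τ i)) ∧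
      Equiv.Perm.sign τ = Equiv.Perm.sign σ := by
  have hex : ∀ i : Fin s, ∃ j : Fin s, σ (Fin.natAdd m i) = Fin.natAdd m j := by
    intro i
    have key : ∀ z, σ (Fin.natAdd m i) = z → ∃ j : Fin s, z = Fin.natAdd m j := by
      intro z
      refine Fin.addCases (fun l => ?_) (fun l => ?_) z
      · intro hz
        rw [← h l] at hz
        have h1 := congrArg Fin.val (σ.injective hz)
        simp at h1
        omega
      · intro _; exact ⟨l, rfl⟩
    exact key _ rfl
  choose f hf using hex
  have hinj : Function.Injective f := by
    intro i j hij
    have : σ (Fin.natAdd m i) = σ (Fin.natAdd m j) := by rw [hf, hf, hij]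
    exact Fin.natAdd_injective _ _ (σ.injective this)
  let τ : Equiv.Perm (Fin s) := Equiv.ofBijective f (Finite.injective_iff_bijective.mp hinj)
  refine ⟨τ, hf, ?_⟩
  have hσ : σ = (finSumFinEquiv.permCongr (Equiv.Perm.sumCongr (1 : Equiv.Perm (Fin m)) τ)) := by
    ext z
    refine Fin.addCases (fun l => ?_) (fun l => ?_) z
    · simp [h l, Equiv.permCongr_apply]
    · simp [hf l, Equiv.permCongr_apply, τ]
  rw [hσ, Equiv.Perm.sign_permCongr, Equiv.Perm.sign_sumCongr]
  simp

open Classical in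
theorem model_basis (Φ : AlternatingMap k V k (Fin s)) (S : Fin s → ι) (J : Fin m → ι)
    (hJ : Function.Injective (Fin.append J S)) :
    cf k V b (modelA k V m s Φ) (Fin.append J S) J
      = ((Finset.univ.filter (FixP m s)).card : k) * Φ (fun i => b (S i)) := by
  rw [cf, modelA_apply, map_sum]
  rw [← Finset.sum_filter_add_sum_filter_not Finset.univ (FixP m s)]
  rw [Finset.sum_congr rfl (g := fun _ => Φ (fun i => b (S i)))]
  · rw [Finset.sum_const, Finset.sum_eq_zero, add_zero, nsmul_eq_mul]
    intro σ hσ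
    rw [Finset.mem_filter] at hσ
    have h2 := hσ.2
    simp only [FixP, not_forall] at h2
    obtain ⟨i, hi⟩ := h2
    rw [map_smul, map_smul, tcoord_tprod, Finset.prod_eq_zero (Finset.mem_univ i)]
    · simp
    · rw [Module.Basis.repr_self, Finsupp.single_apply, if_neg]
      intro h
      apply hi
      apply hJ
      rw [h, Fin.append_left]
  · intro σ hσ
    rw [Finset.mem_filter] at hσ
    obtain ⟨τ, hτ, hs⟩ := FixP_natAdd hσ.2
    have hfix : ∀ i : Fin m, σ (Fin.castAdd s i) = Fin.castAdd s i := hσ.2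
    simp only [hτ, hfix, Fin.append_left, Fin.append_right]
    rw [map_smul, map_smul, tcoord_tprod]
    have hperm := Φ.map_perm (fun i => b (S i)) τ
    have hperm' : (Φ fun i => b (S (τ i)))
        = ((Equiv.Perm.sign σ : ℤ) : k) * Φ fun i => b (S i) := by
      rw [← hs]
      refine Eq.trans hperm ?_
      rw [Units.smul_def, zsmul_eq_mul]
    rw [hperm']
    have hsq : ((Equiv.Perm.sign σ : ℤ) : k) * ((Equiv.Perm.sign σ : ℤ) : k) = 1 := by
      rw [← Int.cast_mul, ← Units.val_mul, Int.units_mul_self]; simp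
    simp only [Module.Basis.repr_self, Finsupp.single_eq_same, Finset.prod_const_one, smul_eq_mul]
    linear_combination (Φ fun i => b (S i)) * hsq

theorem eq_zero_of_B (ha : ∀ x, idE k V a x = 0) (hd : m + s + 2 ≤ Fintype.card ι)
    (hB : ∀ (S : Fin s → ι) (J : Fin m → ι), Function.Injective (Fin.append J S) →
      cf k V b a (Fin.append J S) J = 0) : a = 0 := by
  refine Module.Basis.ext_alternating b fun K hK => ?_
  rw [AlternatingMap.zero_apply]
  refine tcoord_ext k V b _ fun J => ?_
  by_contra hne
  obtain ⟨hJ, hsub⟩ := vanish k V b a ha hd K hK J hne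
  choose p hp using hsub
  have hpinj : Function.Injective p := fun i j h => hJ (by rw [← hp, ← hp, h])
  obtain ⟨g, hg⟩ := Finset.exists_equiv_extend_of_card_eq (α := Fin (m + s)) (β := Fin (m + s))
    (t := Finset.univ) (by simp) (s := Finset.univ.image (Fin.castAdd s))
    (f := fun z => if h : (z : ℕ) < m then p ⟨z, h⟩ else z) (Finset.subset_univ _) (by
      intro x hx y hy hxy
      simp only [Finset.coe_image, Finset.coe_univ, Set.image_univ, Set.mem_range] at hx hy
      obtain ⟨i, rfl⟩ := hx
      obtain ⟨j, rfl⟩ := hy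
      simp at hxy
      rw [hpinj hxy])
  let π : Equiv.Perm (Fin (m + s)) := g.trans (Equiv.subtypeUnivEquiv (by simp))
  have hπ : ∀ i : Fin m, π (Fin.castAdd s i) = p i := by
    intro i
    have := hg (Fin.castAdd s i) (by simp)
    rw [dif_pos (show ((Fin.castAdd s i : Fin (m + s)) : ℕ) < m from i.2)] at this
    exact this
  have hKπ : (fun z => K (π z)) = Fin.append J (fun i => K (π (Fin.natAdd m i))) := by
    funext z
    refine Fin.addCases (fun l => ?_) (fun l => ?_) z
    · rw [Fin.append_left, hπ, hp]
    · rw [Fin.append_right]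
  have h0 := hB (fun i => K (π (Fin.natAdd m i))) J (by
    rw [← hKπ]; exact hK.comp π.injective)
  rw [← hKπ, cf] at h0
  have hperm := a.map_perm (fun i => b (K i)) π
  have h1 : (a fun i => b (K (π i))) = ((Equiv.Perm.sign π : ℤ) : k) • a fun i => b (K i) := by
    refine Eq.trans hperm ?_
    rw [Units.smul_def, zsmul_eq]
  rw [h1, map_smul, smul_eq_mul] at h0
  rcases mul_eq_zero.mp h0 with h2 | h2
  · have : (Equiv.Perm.sign π : ℤ) = 0 := by exact_mod_cast h2
    exact (Equiv.Perm.sign π).ne_zero this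
  · exact hne h2

end converse

theorem exists_form {ι : Type} [Fintype ι] [DecidableEq ι] (b : Module.Basis ι k V)
    {m s : ℕ} (a : V [⋀^Fin (m + s)]→ₗ[k] ⨂[k]^m V) (ha : ∀ x, idE k V a x = 0) (hd : m + s + 2 ≤ Fintype.card ι) :
    ∃ Φ : AlternatingMap k V k (Fin s), a = modelA k V m s Φ := by
  classical
  set M : k := ((Fintype.card ι - s).descFactorial m : k) with hM
  set C : k := ((Finset.univ.filter (FixP m s)).card : k) with hC
  have hM0 : M ≠ 0 := by
    rw [hM, Nat.cast_ne_zero, Ne, Nat.descFactorial_eq_zero_iff_lt]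
    omega
  have hC0 : C ≠ 0 := by
    rw [hC, Nat.cast_ne_zero]
    refine Finset.card_ne_zero_of_mem (a := 1) ?_
    rw [Finset.mem_filter]
    exact ⟨Finset.mem_univ _, fun i => rfl⟩
  refine ⟨(C * M)⁻¹ • contrAll k V b a, ?_⟩
  rw [← sub_eq_zero]
  refine eq_zero_of_B k V b _ (fun x => ?_) hd (fun S J hJ => ?_)
  · rw [idE_sub, ha, idE_model, sub_zero]
  · have h1 := model_basis k V b ((C * M)⁻¹ • contrAll k V b a) S J hJ
    have h2 := contrAll_basis k V b a ha hd S J hJ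
    rw [AlternatingMap.smul_apply, h2] at h1
    have h3 : cf k V b (a - modelA k V m s ((C * M)⁻¹ • contrAll k V b a)) (Fin.append J S) J
      = cf k V b a (Fin.append J S) J
        - cf k V b (modelA k V m s ((C * M)⁻¹ • contrAll k V b a)) (Fin.append J S) J := by
      simp only [cf, AlternatingMap.sub_apply, map_sub]
    rw [h3, h1, smul_eq_mul, ← hM]
    have : ((Finset.univ.filter (FixP m s)).card : k) = C := by rw [hC]
    rw [this]
    field_simp
    ring

theorem model_rhs (m s : ℕ) (Φ : AlternatingMap k V k (Fin s)) (x : ℕ → V) :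
    modelA k V m s Φ (fun i => x i) =
          ∑ σ : Equiv.Perm (Fin (m + s)), (Equiv.Perm.sign σ : ℤ) •
            Φ (fun i : Fin s => permt V σ x (m + i)) • tpN k V m (permt V σ x) := by
  rw [modelA_apply]
  refine Finset.sum_congr rfl fun σ _ => ?_
  rw [zsmul_eq]
  have h1 : ∀ i : Fin s, permt V σ x (m + i) = x (σ (Fin.natAdd m i)) := fun i => by
    rw [permt, dif_pos (show m + (i : ℕ) < m + s by omega)]
    rfl
  have h2 : ∀ i : Fin m, permt V σ x i = x (σ (Fin.castAdd s i)) := fun i => by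
    rw [permt, dif_pos (show (i : ℕ) < m + s by omega)]
    rfl
  simp only [tpN, h1, h2]

/-- Let `V` be a vector space over a field of characteristic zero with
`dim V ≥ N + 2`.  For a linear map `α : ∧^N V → V^{⊗(N-s)}` (we write `m = N - s`, so
`N = m + s`), the map `𝟙 ⊗ α + (-1)^{s-1} • α ⊗ 𝟙 : ∧^{N+1} V → V^{⊗(N+1-s)}` is zero if
and only if `α = 𝟙^{⊗(N-s)} ⊗ Φ` for some alternating form `Φ : ∧^s V → k`. -/
theorem stmt4 [FiniteDimensional k V] (m s : ℕ)
    (hdim : m + s + 2 ≤ Module.finrank k V)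
    (α : wedgeIm k V (m + s) →ₗ[k] ⨂[k]^m V) :
    (∀ x : ℕ → V,
        oneTA k V m s α x + ((-1 : ℤ) ^ (s + 1)) • taOne k V m s α x = 0) ↔
      ∃ Φ : AlternatingMap k V k (Fin s), ∀ x : ℕ → V,
        α (wdgN k V (m + s) x) =
          ∑ σ : Equiv.Perm (Fin (m + s)), (Equiv.Perm.sign σ : ℤ) •
            Φ (fun i : Fin s => permt V σ x (m + i)) • tpN k V m (permt V σ x) := by
  have hext : ∀ (n : ℕ) (y : Fin n → V), ∃ x : ℕ → V, y = fun i : Fin n => x i := fun n y =>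
    ⟨fun l => if h : l < n then y ⟨l, h⟩ else 0, by funext i; simp⟩
  constructor
  · intro h
    have ha : ∀ x, idE k V (altOf k V α) x = 0 := by
      intro y
      obtain ⟨x, rfl⟩ := hext _ y
      rw [← idE_eq, h]
    obtain ⟨Φ, hΦ⟩ := exists_form k V (Module.finBasis k V) (altOf k V α) ha
      (by rw [Fintype.card_fin]; exact hdim)
    refine ⟨Φ, fun x => ?_⟩
    rw [altOf_apply, hΦ, model_rhs]
  · rintro ⟨Φ, hΦ⟩ x
    have hα : altOf k V α = modelA k V m s Φ := by
      ext y
      obtain ⟨x, rfl⟩ := hext _ y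
      rw [← altOf_apply, hΦ, model_rhs]
    rw [idE_eq, hα, idE_model]

end PBW4
end

section
/- Let $V$ be a vector space over a field of characteristic zero and let $L : V \otimes V \to V$ be a Lie bracket (i.e., $L$ is alternating and satisfies the Jacobi identity, equivalently $L \circ (\mathbf{1} \otimes L - L \otimes \mathbf{1} )$ restricted appropriately, i.e., $L \circ [\mathbf{1}, L] = 0$ on $\wedge^3 V$). Define for $a, b \geq 0$ the map $\underline{\mathbf{1}^{2a} L^b} : V^{\otimes 2a+2b} \to V^{\otimes 2a+b}$ as the sum $\sum \mathbf{1}^{\otimes 2i_1} \otimes L^{\otimes j_1} \otimes \cdots \otimes \mathbf{1}^{\otimes 2i_s} \otimes L^{\otimes j_s}$ over all orderings with $\sum i_l = a$, $\sum j_l = b$, and define $[\mathbf{1}, \phi] = \mathbf{1} \otimes \phi - \phi \otimes \mathbf{1}$. Then $\underline{\mathbf{1}^{2a} L^b} \circ [\mathbf{1}, \underline{\mathbf{1}^{2(a+b-1)} L}] = [\mathbf{1}, \underline{\mathbf{1}^{2(a-1)} L^{b+1}}]$ as maps $V^{\otimes 2a+2b+1} \to V^{\otimes 2a+b+1}$ (restricted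 to the antisymmetrized subspace where needed). -/
open scoped TensorProduct
open PiTensorProduct

namespace PBW9


variable (k V : Type) [Field k] [CharZero k] [AddCommGroup V] [Module k V]

/-- The pure tensor `x 0 ⊗ ⋯ ⊗ x (n-1)` in `V^{⊗n}`. -/
noncomputable def tpN (n : ℕ) (x : ℕ → V) : ⨂[k]^n V := tprod k fun i : Fin n => x i

/-- The total antisymmetrization `∑_{σ ∈ S_n} sgn σ • x_{σ(0)} ⊗ ⋯ ⊗ x_{σ(n-1)}`,
the image of `x 0 ∧ ⋯ ∧ x (n-1)` under the embedding `∧ⁿ V ⊆ V^{⊗n}`. -/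
noncomputable def asymN (n : ℕ) (x : ℕ → V) : ⨂[k]^n V :=
  ∑ σ : Equiv.Perm (Fin n), (Equiv.Perm.sign σ : ℤ) • tprod k (fun i : Fin n => x (σ i))

/-- The image of `∧ⁿ V` in `V^{⊗n}` under total antisymmetrization. -/
noncomputable def wedgeIm (n : ℕ) : Submodule k (⨂[k]^n V) :=
  Submodule.span k (Set.range (asymN k V n))

/-- `x 0 ∧ ⋯ ∧ x (n-1)` as an element of the subspace `∧ⁿ V ⊆ V^{⊗n}`. -/
noncomputable def wdgN (n : ℕ) (x : ℕ → V) : wedgeIm k V n :=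
  ⟨asymN k V n x, Submodule.subset_span ⟨x, rfl⟩⟩

/-- Permute the first `n` entries of the sequence `x` by `σ`. -/
def permt {n : ℕ} (σ : Equiv.Perm (Fin n)) (x : ℕ → V) : ℕ → V :=
  fun m => if h : m < n then x (σ ⟨m, h⟩) else x m

/-- Remove the `j`-th entry of the sequence `x`. -/
def removeN (j : ℕ) (x : ℕ → V) : ℕ → V := fun m => if m < j then x m else x (m + 1)

/-- Prepend the entry `v` at the front of the sequence `x`. -/
def consT (v : V) (x : ℕ → V) : ℕ → V := fun m => if m = 0 then v else x (m - 1)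

/-- Replace the `p`-th entry of the sequence `x` by `v`. -/
def putAt (p : ℕ) (x : ℕ → V) (v : V) : ℕ → V := fun m => if m = p then v else x m


/-- The map `V^{⊗m} → V^{⊗(m+1)}`, `t ↦ v ⊗ t`. -/
noncomputable def prepend (m : ℕ) (v : V) : ⨂[k]^m V →ₗ[k] ⨂[k]^(m+1) V :=
  (TensorPower.cast k V (Nat.add_comm 1 m)).toLinearMap ∘ₗ
    (TensorPower.mulEquiv (R := k) (M := V) (n := 1) (m := m)).toLinearMap ∘ₗ
      TensorProduct.mk k (⨂[k]^1 V) (⨂[k]^m V) (tprod k fun _ : Fin 1 => v)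

/-- The map `V^{⊗m} → V^{⊗(m+1)}`, `t ↦ t ⊗ v`. -/
noncomputable def append (m : ℕ) (v : V) : ⨂[k]^m V →ₗ[k] ⨂[k]^(m+1) V :=
  (TensorPower.mulEquiv (R := k) (M := V) (n := m) (m := 1)).toLinearMap ∘ₗ
    (TensorProduct.mk k (⨂[k]^m V) (⨂[k]^1 V)).flip (tprod k fun _ : Fin 1 => v)


/-- The map `𝟙^{⊗p} ⊗ L ⊗ 𝟙^{⊗·}` applied to a sequence: `L` is applied to the entries in
positions `p, p+1` and the remaining entries are kept. -/
def insL (L : V →ₗ[k] V →ₗ[k] V) (p : ℕ) (x : ℕ → V) : ℕ → V :=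
  fun n => if n < p then x n else if n = p then L (x p) (x (p + 1)) else x (n + 1)

/-- Given a word `w` in the letters `𝟙⊗𝟙` (false) and `L` (true), apply it to the sequence
`x`, each letter consuming two consecutive entries; a letter `false` contributes the two
entries themselves and a letter `true` contributes `L` of them. -/
def blocksAux (L : V →ₗ[k] V →ₗ[k] V) : List Bool → (ℕ → V) → List V
  | [], _ => []
  | b :: t, x =>
      (if b then [L (x 0) (x 1)] else [x 0, x 1]) ++ blocksAux L t (fun n => x (n + 2))

/-- The pure tensor in `V^{⊗n}` whose entries are given by the list `l`. -/
noncomputable def tpOfList (n : ℕ) (l : List V) : ⨂[k]^n V :=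
  tprod k fun i : Fin n => l.getD i 0

/-- The map `𝟙^{2a} L^b : V^{⊗(2a+2b)} → V^{⊗(2a+b)}`, i.e. the sum over all interleavings
of `a` doubled identity factors `𝟙⊗𝟙` and `b` factors `L`, applied to the sequence `x`
(the target tensor power `n` is `2a + b`). -/
noncomputable def unders (L : V →ₗ[k] V →ₗ[k] V) (a b n : ℕ) (x : ℕ → V) : ⨂[k]^n V :=
  ∑ w ∈ Finset.univ.filter
      (fun w : Fin (a + b) → Bool => (Finset.univ.filter (fun t => w t = true)).card = b),
    tpOfList k V n (blocksAux k V L (List.ofFn w) x)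

set_option linter.unusedSectionVars false

theorem zsum {M ι : Type} [AddCommGroup M] (c : ℤ) (s : Finset ι) (f : ι → M) :
    c • ∑ i ∈ s, f i = ∑ i ∈ s, c • f i := Finset.smul_sum

theorem blocksAux_append (L : V →ₗ[k] V →ₗ[k] V) (u v : List Bool) (y : ℕ → V) :
    blocksAux k V L (u ++ v) y =
      blocksAux k V L u y ++ blocksAux k V L v (fun n => y (n + 2 * u.length)) := by
  induction u generalizing y with
  | nil => simp [blocksAux]
  | cons b t ih =>
    simp only [List.cons_append, blocksAux, ih, List.append_assoc, List.length_cons]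
    congr 3

theorem blocksAux_congr (L : V →ₗ[k] V →ₗ[k] V) (u : List Bool) (y z : ℕ → V)
    (h : ∀ i < 2 * u.length, y i = z i) :
    blocksAux k V L u y = blocksAux k V L u z := by
  induction u generalizing y z with
  | nil => simp [blocksAux]
  | cons b t ih =>
    simp only [List.length_cons] at h
    simp only [blocksAux]
    rw [h 0 (by omega), h 1 (by omega), ih _ (fun n => z (n + 2))]
    intro i hi
    exact h _ (by omega)

theorem blocksAux_length (L : V →ₗ[k] V →ₗ[k] V) (u : List Bool) (y : ℕ → V) :
    (blocksAux k V L u y).length + u.count true = 2 * u.length := by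
  induction u generalizing y with
  | nil => simp [blocksAux]
  | cons b t ih =>
    have := ih (fun n => y (n + 2))
    cases b <;> simp [blocksAux] <;> omega

theorem count_ofFn (n : ℕ) (w : Fin n → Bool) :
    (List.ofFn w).count true = (Finset.univ.filter (fun t => w t = true)).card := by
  induction n with
  | zero => simp
  | succ n ih =>
    rw [List.ofFn_succ, List.count_cons, ih, Fin.card_filter_univ_succ']
    cases h : w 0 <;> simp [add_comm]

theorem prepend_tpOfList (m : ℕ) (v : V) (l : List V) :
    prepend k V m v (tpOfList k V m l) = tpOfList k V (m + 1) (v :: l) := by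
  unfold prepend tpOfList
  have := TensorPower.tprod_mul_tprod (R := k) (fun _ : Fin 1 => v) (fun i : Fin m => l.getD i 0)
  rw [TensorPower.gMul_def] at this
  simp only [LinearMap.comp_apply, TensorProduct.mk_apply, LinearEquiv.coe_coe]
  rw [this, TensorPower.cast_tprod]
  congr 1
  funext i
  simp only [Function.comp]
  induction i using Fin.cases with
  | zero =>
    have : Fin.cast (Nat.add_comm 1 m).symm 0 = Fin.castAdd m (0 : Fin 1) := by ext; simp
    rw [this, Fin.append_left]; simp
  | succ i =>
    have : Fin.cast (Nat.add_comm 1 m).symm i.succ = Fin.natAdd 1 i := by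
      ext; simp [add_comm]
    rw [this, Fin.append_right]; simp

theorem append_tpOfList (m : ℕ) (v : V) (l : List V) (hl : l.length = m) :
    append k V m v (tpOfList k V m l) = tpOfList k V (m + 1) (l ++ [v]) := by
  unfold append tpOfList
  have := TensorPower.tprod_mul_tprod (R := k) (fun i : Fin m => l.getD i 0) (fun _ : Fin 1 => v)
  rw [TensorPower.gMul_def] at this
  simp only [LinearMap.comp_apply, TensorProduct.mk_apply, LinearEquiv.coe_coe,
    LinearMap.flip_apply]
  rw [this]
  congr 1
  funext i
  induction i using Fin.lastCases with
  | last =>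
    have : Fin.last m = Fin.natAdd m (0 : Fin 1) := by ext; simp
    rw [this, Fin.append_right]; simp [← hl]
  | cast i =>
    have : i.castSucc = Fin.castAdd 1 i := rfl
    rw [this, Fin.append_left]
    have hi : (i : ℕ) < l.length := by omega
    simp [List.getElem?_append_left hi]

theorem unders_eq (L : V →ₗ[k] V →ₗ[k] V) (a b n N : ℕ) (x : ℕ → V) (h : a + b = N) :
    unders k V L a b n x = ∑ w ∈ Finset.univ.filter
      (fun w : Fin N → Bool => (Finset.univ.filter (fun t => w t = true)).card = b),
    tpOfList k V n (blocksAux k V L (List.ofFn w) x) := by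
  subst h; rfl

/-- The word `u 𝟙 v` applied to `y`, where `u` is the first `i` letters of `w`. -/
def blocksOne (L : V →ₗ[k] V →ₗ[k] V) (w : List Bool) (i : ℕ) (y : ℕ → V) : List V :=
  blocksAux k V L (w.take i) y ++
    y (2 * i) :: blocksAux k V L (w.drop i) (fun n => y (n + (2 * i + 1)))

theorem blocksOne_split (L : V →ₗ[k] V →ₗ[k] V) (u v : List Bool) (c : Bool) (y : ℕ → V) :
    blocksOne k V L (u ++ c :: v) u.length y = blocksAux k V L u y ++
      y (2 * u.length) :: ((if c then [L (y (2 * u.length + 1)) (y (2 * u.length + 2))]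
        else [y (2 * u.length + 1), y (2 * u.length + 2)]) ++
        blocksAux k V L v (fun n => y (n + (2 * u.length + 3)))) := by
  simp only [blocksOne, List.take_left', List.drop_left', blocksAux]
  have e : ∀ n, n + 2 + (2 * u.length + 1) = n + (2 * u.length + 3) := by intro n; ring
  have e0 : 0 + (2 * u.length + 1) = 2 * u.length + 1 := by ring
  have e1 : 1 + (2 * u.length + 1) = 2 * u.length + 2 := by ring
  simp only [e, e0, e1]

theorem blocksOne_split' (L : V →ₗ[k] V →ₗ[k] V) (u v : List Bool) (c : Bool) (y : ℕ → V) :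
    blocksOne k V L (u ++ c :: v) (u.length + 1) y = blocksAux k V L u y ++
      ((if c then [L (y (2 * u.length)) (y (2 * u.length + 1))]
        else [y (2 * u.length), y (2 * u.length + 1)]) ++ y (2 * u.length + 2) ::
        blocksAux k V L v (fun n => y (n + (2 * u.length + 3)))) := by
  have h1 : (u ++ c :: v).take (u.length + 1) = u ++ [c] := by
    simp [List.take_append, List.take_of_length_le]
  have h2 : (u ++ c :: v).drop (u.length + 1) = v := by
    simp [List.drop_append]
  simp only [blocksOne, h1, h2, blocksAux_append, blocksAux]
  have e1 : 1 + (2 * u.length) = 2 * u.length + 1 := by ring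
  have e2 : 2 * (u.length + 1) = 2 * u.length + 2 := by ring
  simp only [e1, e2, zero_add, List.append_nil, List.append_assoc]

theorem ins_split (L : V →ₗ[k] V →ₗ[k] V) (u v : List Bool) (c : Bool) (y : ℕ → V) :
    blocksAux k V L (u ++ c :: v) (insL k V L (2 * u.length) y) = blocksAux k V L u y ++
      ((if c then [L (L (y (2 * u.length)) (y (2 * u.length + 1))) (y (2 * u.length + 2))]
        else [L (y (2 * u.length)) (y (2 * u.length + 1)), y (2 * u.length + 2)]) ++
        blocksAux k V L v (fun n => y (n + (2 * u.length + 3)))) := by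
  rw [blocksAux_append, blocksAux_congr k V L u (insL k V L (2 * u.length) y) y]
  · simp only [blocksAux]
    congr 2
    · simp [insL, add_comm 1]
    · congr 1
      funext n
      have h1 : ¬ (n + 2 + 2 * u.length < 2 * u.length) := by omega
      have h2 : ¬ (n + 2 + 2 * u.length = 2 * u.length) := by omega
      simp only [insL, h1, h2, if_false]
      congr 1; ring
  · intro i hi
    simp [insL, hi]

theorem ins_split' (L : V →ₗ[k] V →ₗ[k] V) (u v : List Bool) (c : Bool) (y : ℕ → V) :
    blocksAux k V L (u ++ c :: v) (insL k V L (2 * u.length + 1) y) = blocksAux k V L u y ++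
      ((if c then [L (y (2 * u.length)) (L (y (2 * u.length + 1)) (y (2 * u.length + 2)))]
        else [y (2 * u.length), L (y (2 * u.length + 1)) (y (2 * u.length + 2))]) ++
        blocksAux k V L v (fun n => y (n + (2 * u.length + 3)))) := by
  rw [blocksAux_append, blocksAux_congr k V L u (insL k V L (2 * u.length + 1) y) y]
  · simp only [blocksAux]
    congr 2
    · simp [insL, add_comm 1]
    · congr 1
      funext n
      have h1 : ¬ (n + 2 + 2 * u.length < 2 * u.length + 1) := by omega
      have h2 : ¬ (n + 2 + 2 * u.length = 2 * u.length + 1) := by omega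
      simp only [insL, h1, h2, if_false]
      congr 1; ring
  · intro i hi
    have : i < 2 * u.length + 1 := by omega
    simp [insL, this]

theorem ofFn_split {N : ℕ} (w : Fin N → Bool) (q : Fin N) :
    ∃ u v : List Bool, u.length = q ∧ u.length + v.length + 1 = N ∧
      List.ofFn w = u ++ w q :: v ∧
      ∀ c, List.ofFn (Function.update w q c) = u ++ c :: v := by
  have hq : (q : ℕ) < (List.ofFn w).length := by simp
  have key : List.ofFn w = (List.ofFn w).take q ++ w q :: (List.ofFn w).drop (q + 1) := by
    conv_lhs => rw [← List.take_append_drop q (List.ofFn w), List.drop_eq_getElem_cons hq]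
    simp
  refine ⟨(List.ofFn w).take q, (List.ofFn w).drop (q + 1), by simp, by simp; omega, key, ?_⟩
  intro c
  have : List.ofFn (Function.update w q c) = (List.ofFn w).set q c := by
    apply List.ext_getElem
    · simp
    · intro i h1 h2
      simp only [List.getElem_ofFn, List.getElem_set, Function.update_apply, Fin.ext_iff]
      simp only [eq_comm]
  rw [this, List.set_eq_take_append_cons_drop, if_pos hq]

/-- The difference of the two insertions of `L` in the `q`-th block. -/
noncomputable def insDiff (L : V →ₗ[k] V →ₗ[k] V) (n : ℕ) (w : List Bool) (q : ℕ) (y : ℕ → V) :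
    ⨂[k]^n V :=
  tpOfList k V n (blocksAux k V L w (insL k V L (2 * q + 1) y)) -
    tpOfList k V n (blocksAux k V L w (insL k V L (2 * q) y))

/-- The telescoping difference. -/
noncomputable def telDiff (L : V →ₗ[k] V →ₗ[k] V) (n : ℕ) (w : List Bool) (q : ℕ) (y : ℕ → V) :
    ⨂[k]^n V :=
  tpOfList k V n (blocksOne k V L w q y) - tpOfList k V n (blocksOne k V L w (q + 1) y)

theorem insDiff_false (L : V →ₗ[k] V →ₗ[k] V) (n N : ℕ) (w : Fin N → Bool) (q : Fin N)
    (y : ℕ → V) (h : w q = false) :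
    insDiff k V L n (List.ofFn w) q y =
      telDiff k V L n (List.ofFn (Function.update w q true)) q y := by
  obtain ⟨u, v, hu, -, hw, hc⟩ := ofFn_split w q
  rw [hw, hc, ← hu, h]
  simp [insDiff, telDiff, ins_split, ins_split', blocksOne_split, blocksOne_split']

theorem telDiff_false (L : V →ₗ[k] V →ₗ[k] V) (n N : ℕ) (w : Fin N → Bool) (q : Fin N)
    (y : ℕ → V) (h : w q = false) :
    telDiff k V L n (List.ofFn w) q y = 0 := by
  obtain ⟨u, v, hu, -, hw, hc⟩ := ofFn_split w q
  rw [hw, ← hu, h]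
  simp [telDiff, blocksOne_split, blocksOne_split']

theorem sum_telDiff (L : V →ₗ[k] V →ₗ[k] V) (n N : ℕ) (w : Fin N → Bool) (y : ℕ → V) :
    ∑ q : Fin N, telDiff k V L n (List.ofFn w) q y =
      tpOfList k V n (y 0 :: blocksAux k V L (List.ofFn w) (fun n => y (n + 1))) -
      tpOfList k V n (blocksAux k V L (List.ofFn w) y ++ [y (2 * N)]) := by
  rw [Fin.sum_univ_eq_sum_range (fun q => telDiff k V L n (List.ofFn w) q y)]
  unfold telDiff
  rw [Finset.sum_range_sub' (fun q => tpOfList k V n (blocksOne k V L (List.ofFn w) q y))]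
  simp [blocksOne, blocksAux, List.take_of_length_le, List.drop_of_length_le]

/-- The linear map `v ↦ l₁ ⊗ v ⊗ l₂`. -/
noncomputable def midMap (n : ℕ) (l₁ l₂ : List V) : V →ₗ[k] ⨂[k]^n V :=
  if h : l₁.length < n then
    (PiTensorProduct.tprod k).toLinearMap (fun i : Fin n => (l₁ ++ 0 :: l₂).getD i 0)
      ⟨l₁.length, h⟩
  else 0

theorem tpOfList_mid (n : ℕ) (l₁ l₂ : List V) (h : l₁.length < n) (v : V) :
    tpOfList k V n (l₁ ++ v :: l₂) =
      midMap k V n l₁ l₂ v := by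
  simp only [tpOfList, midMap, dif_pos h, MultilinearMap.toLinearMap_apply]
  congr 1
  funext i
  by_cases hi : i = ⟨l₁.length, h⟩
  · subst hi; simp
  · rw [Function.update_of_ne hi]
    have : (i : ℕ) ≠ l₁.length := fun h => hi (Fin.ext h)
    rcases lt_or_gt_of_ne this with h1 | h1
    · simp [List.getElem?_append_left h1]
    · obtain ⟨j, hj⟩ : ∃ j, (i : ℕ) = l₁.length + (j + 1) := ⟨i - l₁.length - 1, by omega⟩
      rw [hj]; simp [List.getElem?_append_right]

theorem tpOfList_mid_ge (n : ℕ) (l₁ l₂ : List V) (h : n ≤ l₁.length) (v v' : V) :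
    tpOfList k V n (l₁ ++ v :: l₂) = tpOfList k V n (l₁ ++ v' :: l₂) := by
  simp only [tpOfList]
  congr 1
  funext i
  have h1 : (i : ℕ) < l₁.length := by omega
  simp [List.getElem?_append_left h1]

theorem insDiff_true (L : V →ₗ[k] V →ₗ[k] V) (hJac : ∀ x : Fin 3 → V,
      (∑ σ : Equiv.Perm (Fin 3), (Equiv.Perm.sign σ : ℤ) •
          (L (x (σ 0)) (L (x (σ 1)) (x (σ 2))) - L (L (x (σ 0)) (x (σ 1))) (x (σ 2)))) = 0)
    (n N M : ℕ) (hM : M = 2 * N + 1) (w : Fin N → Bool) (q : Fin N)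
    (x : ℕ → V) (h : w q = true) :
    ∑ σ : Equiv.Perm (Fin M), (Equiv.Perm.sign σ : ℤ) •
      insDiff k V L n (List.ofFn w) q (permt V σ x) = 0 := by
  obtain ⟨u, v, hu, hlen, hw, hc⟩ := ofFn_split w q
  rw [hw, ← hu, h]
  simp only [insDiff, ins_split, ins_split', if_true, List.singleton_append]
  set Q := u.length with hQ
  by_cases hlt : ∀ y, (blocksAux k V L u y).length < n
  swap
  · have hge : ∀ y, n ≤ (blocksAux k V L u y).length := by
      push Not at hlt
      obtain ⟨y, hy⟩ := hlt
      intro z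
      have h1 := blocksAux_length k V L u y
      have h2 := blocksAux_length k V L u z
      omega
    apply Finset.sum_eq_zero
    intro σ _
    rw [tpOfList_mid_ge k V n _ _ (hge _) _ 0, tpOfList_mid_ge k V n _ _ (hge _) (L (L _ _) _) 0,
      sub_self, zsmul_zero]
  set f : Equiv.Perm (Fin M) → ⨂[k]^n V := fun σ =>
    midMap k V n (blocksAux k V L u (permt V σ x))
      (blocksAux k V L v (fun n => permt V σ x (n + (2 * Q + 3))))
      (L (permt V σ x (2 * Q)) (L (permt V σ x (2 * Q + 1)) (permt V σ x (2 * Q + 2))) -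
       L (L (permt V σ x (2 * Q)) (permt V σ x (2 * Q + 1))) (permt V σ x (2 * Q + 2))) with hf
  have hsum : ∑ σ : Equiv.Perm (Fin M), (Equiv.Perm.sign σ : ℤ) • f σ = 0 := by
    let e : Fin 3 ↪ Fin M := ⟨fun i => ⟨2 * Q + i, by omega⟩, fun i j hij => by
      simp only [Fin.mk.injEq] at hij; omega⟩
    have he : ∀ i, e i = ⟨2 * Q + i, by omega⟩ := fun i => rfl
    have hinv : ∀ τ : Equiv.Perm (Fin 3),
        ∑ σ : Equiv.Perm (Fin M), (Equiv.Perm.sign σ : ℤ) • f σ =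
        ∑ σ : Equiv.Perm (Fin M), (Equiv.Perm.sign σ : ℤ) • (Equiv.Perm.sign τ : ℤ) •
          f (σ * τ.viaFintypeEmbedding e) := by
      intro τ
      rw [← Equiv.sum_comp (Equiv.mulRight (τ.viaFintypeEmbedding e))]
      apply Finset.sum_congr rfl
      intro σ _
      simp only [Equiv.coe_mulRight, Equiv.Perm.sign_mul, Equiv.Perm.viaFintypeEmbedding_sign,
        Units.val_mul, mul_smul]
    have h6 : (Fintype.card (Equiv.Perm (Fin 3))) •
        ∑ σ : Equiv.Perm (Fin M), (Equiv.Perm.sign σ : ℤ) • f σ = 0 := by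
      rw [← Finset.card_univ, ← Finset.sum_const, Finset.sum_congr rfl (fun τ _ => hinv τ),
        Finset.sum_comm]
      apply Finset.sum_eq_zero
      intro σ _
      rw [← zsum]
      have hout : ∀ (τ : Equiv.Perm (Fin 3)) (m : ℕ), (m < 2 * Q ∨ 2 * Q + 3 ≤ m) →
          permt V (σ * τ.viaFintypeEmbedding e) x m = permt V σ x m := by
        intro τ m hm
        unfold permt
        by_cases hmM : m < M
        · simp only [hmM, dif_pos, Equiv.Perm.mul_apply]
          rw [Equiv.Perm.viaFintypeEmbedding_apply_notMem_range]
          rintro ⟨i, hi⟩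
          rw [he, Fin.mk.injEq] at hi
          omega
        · simp only [hmM, dif_neg, not_false_eq_true]
      have hin : ∀ (τ : Equiv.Perm (Fin 3)) (i : Fin 3),
          permt V (σ * τ.viaFintypeEmbedding e) x (2 * Q + i) = x (σ (e (τ i))) := by
        intro τ i
        unfold permt
        have hmM : 2 * Q + (i : ℕ) < M := by omega
        simp only [hmM, dif_pos, Equiv.Perm.mul_apply]
        rw [← he, Equiv.Perm.viaFintypeEmbedding_apply_image]
      have hb1 : ∀ τ : Equiv.Perm (Fin 3),
          blocksAux k V L u (permt V (σ * τ.viaFintypeEmbedding e) x) =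
          blocksAux k V L u (permt V σ x) := fun τ =>
        blocksAux_congr k V L u _ _ (fun i hi => hout τ i (Or.inl hi))
      have hb2 : ∀ τ : Equiv.Perm (Fin 3),
          (fun n => permt V (σ * τ.viaFintypeEmbedding e) x (n + (2 * Q + 3))) =
          (fun n => permt V σ x (n + (2 * Q + 3))) := fun τ => by
        funext n
        exact hout τ _ (Or.inr (by omega))
      have h0 := fun τ => hin τ 0
      have h1 := fun τ => hin τ 1
      have h2 := fun τ => hin τ 2
      simp only [Fin.val_zero, Fin.val_one, Fin.val_two, add_zero] at h0 h1 h2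
      simp only [hf, hb1, hb2, h0, h1, h2]
      simp only [← map_zsmul]
      rw [← map_sum, hJac (fun i => x (σ (e i))), map_zero, zsmul_zero]
    rw [← Nat.cast_smul_eq_nsmul k] at h6
    refine (smul_eq_zero.mp h6).resolve_left ?_
    exact Nat.cast_ne_zero.mpr Fintype.card_ne_zero
  rw [← hsum]
  apply Finset.sum_congr rfl
  intro σ _
  rw [hf, tpOfList_mid k V n _ _ (hlt _), tpOfList_mid k V n _ _ (hlt _), ← map_sub]

theorem sum_range_two_mul {M : Type} [AddCommGroup M] (N : ℕ) (f : ℕ → M) :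
    ∑ p ∈ Finset.range (2 * N), f p = ∑ q ∈ Finset.range N, (f (2 * q) + f (2 * q + 1)) := by
  induction N with
  | zero => simp
  | succ N ih =>
    rw [Finset.sum_range_succ, ← ih, show 2 * (N + 1) = 2 * N + 1 + 1 by ring,
      Finset.sum_range_succ, Finset.sum_range_succ, add_assoc]

theorem card_update {N : ℕ} (w : Fin N → Bool) (q : Fin N) (h : w q = false) :
    (Finset.univ.filter (fun t => Function.update w q true t = true)).card =
      (Finset.univ.filter (fun t => w t = true)).card + 1 := by
  have : Finset.univ.filter (fun t => Function.update w q true t = true) =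
      insert q (Finset.univ.filter (fun t => w t = true)) := by
    ext t
    by_cases ht : t = q
    · subst ht; simp
    · simp [Function.update_of_ne ht, ht]
  rw [this, Finset.card_insert_of_notMem (by simp [h])]

theorem sum_swap {M : Type} [AddCommGroup M] (N b : ℕ) (q : Fin N) (F : (Fin N → Bool) → M) :
    ∑ w ∈ Finset.univ.filter (fun w : Fin N → Bool =>
        (Finset.univ.filter (fun t => w t = true)).card = b) with w q = false,
      F (Function.update w q true) =
    ∑ w ∈ Finset.univ.filter (fun w : Fin N → Bool =>
        (Finset.univ.filter (fun t => w t = true)).card = b + 1) with w q = true, F w := by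
  refine Finset.sum_bij' (fun w _ => Function.update w q true)
    (fun w _ => Function.update w q false) ?_ ?_ ?_ ?_ ?_
  · intro w hw
    simp only [Finset.mem_filter, Finset.mem_univ, true_and] at hw ⊢
    rw [card_update w q hw.2, hw.1]
    simp
  · intro w hw
    simp only [Finset.mem_filter, Finset.mem_univ, true_and] at hw ⊢
    have h1 := card_update (Function.update w q false) q (by simp)
    have h2 : Function.update w q true = w := by rw [← hw.2]; simp
    simp only [Function.update_idem, h2, hw.1] at h1
    refine ⟨by omega, by simp⟩
  · intro w hw
    simp only [Finset.mem_filter, Finset.mem_univ, true_and] at hw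
    simp [← hw.2]
  · intro w hw
    simp only [Finset.mem_filter, Finset.mem_univ, true_and] at hw
    simp only [Function.update_idem]
    rw [← hw.2]; simp
  · intro w hw; rfl

theorem lhs_eq (L : V →ₗ[k] V →ₗ[k] V) (a b : ℕ) (y : ℕ → V) :
    ∑ pos ∈ Finset.range (2 * (a + b) + 2), ((-1 : ℤ) ^ (2 * (a + b) + 1 - pos)) •
      unders k V L (a + 1) b (2 * a + b + 2) (insL k V L pos y) =
    ∑ w ∈ Finset.univ.filter (fun w : Fin (a + b + 1) → Bool =>
        (Finset.univ.filter (fun t => w t = true)).card = b),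
      ∑ q : Fin (a + b + 1), insDiff k V L (2 * a + b + 2) (List.ofFn w) q y := by
  rw [show 2 * (a + b) + 2 = 2 * (a + b + 1) by ring, sum_range_two_mul, Finset.sum_comm,
    Fin.sum_univ_eq_sum_range (fun q => ∑ w ∈ Finset.univ.filter
      (fun w : Fin (a + b + 1) → Bool =>
        (Finset.univ.filter (fun t => w t = true)).card = b),
        insDiff k V L (2 * a + b + 2) (List.ofFn w) q y)]
  apply Finset.sum_congr rfl
  intro q hq
  rw [Finset.mem_range] at hq
  have e1 : (-1 : ℤ) ^ (2 * (a + b) + 1 - 2 * q) = -1 :=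
    Odd.neg_one_pow ⟨a + b - q, by omega⟩
  have e2 : (-1 : ℤ) ^ (2 * (a + b) + 1 - (2 * q + 1)) = 1 :=
    Even.neg_one_pow ⟨a + b - q, by omega⟩
  rw [e1, e2, unders_eq k V L (a + 1) b _ (a + b + 1) _ (by ring),
    unders_eq k V L (a + 1) b _ (a + b + 1) _ (by ring)]
  simp only [insDiff, Finset.sum_sub_distrib]
  rw [neg_smul, one_smul, one_smul, neg_add_eq_sub]

theorem rhs_eq (L : V →ₗ[k] V →ₗ[k] V) (a b : ℕ) (y : ℕ → V) :
    prepend k V (2 * a + b + 1) (y 0)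
        (unders k V L a (b + 1) (2 * a + b + 1) (fun n => y (n + 1))) -
      append k V (2 * a + b + 1) (y (2 * a + 2 * b + 2))
        (unders k V L a (b + 1) (2 * a + b + 1) y) =
    ∑ w ∈ Finset.univ.filter (fun w : Fin (a + b + 1) → Bool =>
        (Finset.univ.filter (fun t => w t = true)).card = b + 1),
      ∑ q : Fin (a + b + 1), telDiff k V L (2 * a + b + 2) (List.ofFn w) q y := by
  rw [unders_eq k V L a (b + 1) _ (a + b + 1) _ (by ring),
    unders_eq k V L a (b + 1) _ (a + b + 1) _ (by ring), map_sum, map_sum,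
    ← Finset.sum_sub_distrib]
  apply Finset.sum_congr rfl
  intro w hw
  simp only [Finset.mem_filter, Finset.mem_univ, true_and] at hw
  have hl := blocksAux_length k V L (List.ofFn w) y
  rw [count_ofFn, hw, List.length_ofFn] at hl
  rw [sum_telDiff, prepend_tpOfList, append_tpOfList k V _ _ _ (by omega),
    show 2 * (a + b + 1) = 2 * a + 2 * b + 2 by ring]

/-- Let `L : V ⊗ V → V` be a Lie bracket (alternating, satisfying the
Jacobi identity `L ∘ [𝟙, L] = 0` on `∧³ V`).  Writing `𝟙^{2a} L^b` for the sum of all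
interleavings of `a` doubled identities and `b` copies of `L`, and
`[𝟙, φ] = 𝟙 ⊗ φ - φ ⊗ 𝟙`, one has
`𝟙^{2a} L^b ∘ [𝟙, 𝟙^{2(a+b-1)} L] = [𝟙, 𝟙^{2(a-1)} L^{b+1}]`
as maps `V^{⊗(2a+2b+1)} → V^{⊗(2a+b+1)}` restricted to the antisymmetrized subspace
`∧^{2a+2b+1} V`.  (Here we write `a + 1` for the paper's `a`, so that `a ≥ 1` there.) -/
theorem stmt9 (a b : ℕ)
    (L : V →ₗ[k] V →ₗ[k] V) (hL : ∀ v : V, L v v = 0)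
    (hJac : ∀ x : Fin 3 → V,
      (∑ σ : Equiv.Perm (Fin 3), (Equiv.Perm.sign σ : ℤ) •
          (L (x (σ 0)) (L (x (σ 1)) (x (σ 2))) - L (L (x (σ 0)) (x (σ 1))) (x (σ 2)))) = 0) :
    ∀ x : ℕ → V,
      (∑ σ : Equiv.Perm (Fin (2 * a + 2 * b + 3)), (Equiv.Perm.sign σ : ℤ) •
          ∑ pos ∈ Finset.range (2 * (a + b) + 2),
            ((-1 : ℤ) ^ (2 * (a + b) + 1 - pos)) •
              unders k V L (a + 1) b (2 * a + b + 2) (insL k V L pos (permt V σ x))) =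
        ∑ σ : Equiv.Perm (Fin (2 * a + 2 * b + 3)), (Equiv.Perm.sign σ : ℤ) •
          (prepend k V (2 * a + b + 1) (permt V σ x 0)
              (unders k V L a (b + 1) (2 * a + b + 1) (fun n => permt V σ x (n + 1))) -
            append k V (2 * a + b + 1) (permt V σ x (2 * a + 2 * b + 2))
              (unders k V L a (b + 1) (2 * a + b + 1) (permt V σ x))) := by
  intro x
  simp only [lhs_eq, rhs_eq]
  have hr : ∀ y : ℕ → V, ∑ w ∈ Finset.univ.filter (fun w : Fin (a + b + 1) → Bool =>
        (Finset.univ.filter (fun t => w t = true)).card = b + 1),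
      ∑ q : Fin (a + b + 1), telDiff k V L (2 * a + b + 2) (List.ofFn w) q y =
      ∑ q : Fin (a + b + 1), ∑ w ∈ (Finset.univ.filter (fun w : Fin (a + b + 1) → Bool =>
        (Finset.univ.filter (fun t => w t = true)).card = b)) with w q = false,
        insDiff k V L (2 * a + b + 2) (List.ofFn w) q y := by
    intro y
    rw [Finset.sum_comm]
    apply Finset.sum_congr rfl
    intro q _
    have h1 : ∑ w ∈ (Finset.univ.filter (fun w : Fin (a + b + 1) → Bool =>
        (Finset.univ.filter (fun t => w t = true)).card = b)) with w q = false,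
        insDiff k V L (2 * a + b + 2) (List.ofFn w) q y =
        ∑ w ∈ (Finset.univ.filter (fun w : Fin (a + b + 1) → Bool =>
        (Finset.univ.filter (fun t => w t = true)).card = b)) with w q = false,
        telDiff k V L (2 * a + b + 2) (List.ofFn (Function.update w q true)) q y := by
      apply Finset.sum_congr rfl
      intro w hw
      exact insDiff_false k V L _ _ w q y (Finset.mem_filter.mp hw).2
    rw [h1, sum_swap (a + b + 1) b q
      (fun w => telDiff k V L (2 * a + b + 2) (List.ofFn w) q y)]
    symm
    apply Finset.sum_filter_of_ne
    intro w _ hne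
    by_contra hc
    exact hne (telDiff_false k V L _ _ w q y (by simpa using hc))
  have hl : ∀ y : ℕ → V, ∑ w ∈ Finset.univ.filter (fun w : Fin (a + b + 1) → Bool =>
        (Finset.univ.filter (fun t => w t = true)).card = b),
      ∑ q : Fin (a + b + 1), insDiff k V L (2 * a + b + 2) (List.ofFn w) q y =
      (∑ q : Fin (a + b + 1), ∑ w ∈ (Finset.univ.filter (fun w : Fin (a + b + 1) → Bool =>
        (Finset.univ.filter (fun t => w t = true)).card = b)) with w q = false,
        insDiff k V L (2 * a + b + 2) (List.ofFn w) q y) +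
      ∑ q : Fin (a + b + 1), ∑ w ∈ (Finset.univ.filter (fun w : Fin (a + b + 1) → Bool =>
        (Finset.univ.filter (fun t => w t = true)).card = b)) with ¬ w q = false,
        insDiff k V L (2 * a + b + 2) (List.ofFn w) q y := by
    intro y
    rw [Finset.sum_comm, ← Finset.sum_add_distrib]
    apply Finset.sum_congr rfl
    intro q _
    rw [Finset.sum_filter_add_sum_filter_not]
  simp only [hr, hl, zsmul_add, Finset.sum_add_distrib]
  rw [add_eq_left]
  simp only [zsum]
  rw [Finset.sum_comm]
  apply Finset.sum_eq_zero
  intro q _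
  rw [Finset.sum_comm]
  apply Finset.sum_eq_zero
  intro w hw
  exact insDiff_true k V L hJac _ _ _ (by ring) w q x (by simpa using (Finset.mem_filter.mp hw).2)

end PBW9
end
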